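/- arXiv:2603.25822 — 9 statements merged into one kernel-verified Lean document; each statement's English description precedes it below -/
import Mathlib

section
/- Let f : ℝⁿ → ℝ be twice continuously differentiable and consider the gradient flow ẋ = −∇f(x). For ν > 0, the following are equivalent: (i) there exists a norm ‖·‖ on ℝⁿ such that the logarithmic norm μ induced by ‖·‖ satisfies μ(−∇²f(x)) ≤ −ν for all x ∈ ℝⁿ (i.e., the gradient flow is infinitesimally contracting on ℝⁿ with rate ν); (ii) f is ν-strongly convex, i.e., vᵀ ∇²f(x) v ≥ ν‖v‖₂² for all x, v ∈ ℝⁿ. -/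
open scoped RealInnerProductSpace

/-- The matrix (operator) norm on linear maps of `ℝⁿ` induced by a norm `N` on `ℝⁿ`:
`‖A‖ = sup { N (A v) : N v = 1 }`. -/
noncomputable def inducedOpNorm {n : ℕ} (N : EuclideanSpace ℝ (Fin n) → ℝ)
    (A : EuclideanSpace ℝ (Fin n) →L[ℝ] EuclideanSpace ℝ (Fin n)) : ℝ :=
  sSup ((fun v => N (A v)) '' {v | N v = 1})

section InducedOpNorm

variable {n : ℕ} {N : EuclideanSpace ℝ (Fin n) → ℝ}

theorem nonneg_of_subadditive_of_absHomogeneous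
    (hsmul : ∀ (a : ℝ) (x : EuclideanSpace ℝ (Fin n)), N (a • x) = |a| * N x)
    (hadd : ∀ x y, N (x + y) ≤ N x + N y) (x : EuclideanSpace ℝ (Fin n)) : 0 ≤ N x := by
  have hzero : N 0 = 0 := by simpa using hsmul 0 0
  have h := hadd x ((-1 : ℝ) • x)
  rw [hsmul, neg_one_smul, add_neg_cancel, hzero, abs_neg, abs_one] at h
  linarith

theorem bddAbove_image_unitSphere_of_norm (h0 : ∀ x, N x = 0 ↔ x = 0)
    (hsmul : ∀ (a : ℝ) (x : EuclideanSpace ℝ (Fin n)), N (a • x) = |a| * N x)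
    (hadd : ∀ x y, N (x + y) ≤ N x + N y)
    (A : EuclideanSpace ℝ (Fin n) →L[ℝ] EuclideanSpace ℝ (Fin n)) :
    BddAbove ((fun v => N (A v)) '' {v | N v = 1}) := by
  have hconvex : ConvexOn ℝ Set.univ N := by
    refine ⟨convex_univ, fun x _ y _ a b ha hb _ => (hadd _ _).trans_eq ?_⟩
    rw [hsmul, hsmul, abs_of_nonneg ha, abs_of_nonneg hb, smul_eq_mul, smul_eq_mul]
  have hcont : Continuous N := hconvex.locallyLipschitz.continuous
  have hcompact : IsCompact {v | N v = 1} := by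
    refine Metric.isCompact_of_isClosed_isBounded (isClosed_eq hcont continuous_const) ?_
    obtain hS | hS := (Metric.sphere (0 : EuclideanSpace ℝ (Fin n)) 1).eq_empty_or_nonempty
    · refine Bornology.IsBounded.subset (Metric.isBounded_closedBall (x := 0) (r := 0)) ?_
      intro v _
      by_contra hv
      have hv0 : v ≠ 0 := by simpa using hv
      have : ‖v‖⁻¹ • v ∈ Metric.sphere (0 : EuclideanSpace ℝ (Fin n)) 1 := by
        simp [norm_smul, hv0]
      simp [hS] at this
    · obtain ⟨u, hu, hmin⟩ := (isCompact_sphere 0 1).exists_isMinOn hS hcont.continuousOn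
      have hu0 : u ≠ 0 := by
        rintro rfl
        simp at hu
      have hNu : 0 < N u := (nonneg_of_subadditive_of_absHomogeneous hsmul hadd u).lt_of_ne'
        (by simpa [h0] using hu0)
      refine Bornology.IsBounded.subset
        (Metric.isBounded_closedBall (x := 0) (r := (N u)⁻¹)) ?_
      intro v (hv : N v = 1)
      have hv0 : v ≠ 0 := by
        rintro rfl
        simp [(h0 0).2 rfl] at hv
      have hvpos : 0 < ‖v‖ := norm_pos_iff.2 hv0
      have hle : N u ≤ N (‖v‖⁻¹ • v) := hmin (by simp [norm_smul, hv0])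
      rw [hsmul, hv, abs_of_pos (inv_pos.2 hvpos), mul_one] at hle
      simpa using (le_inv_comm₀ hNu hvpos).1 hle
  exact (hcompact.image (hcont.comp A.continuous)).bddAbove

theorem le_inducedOpNorm_of_eigenvector (h0 : ∀ x, N x = 0 ↔ x = 0)
    (hsmul : ∀ (a : ℝ) (x : EuclideanSpace ℝ (Fin n)), N (a • x) = |a| * N x)
    (hadd : ∀ x y, N (x + y) ≤ N x + N y)
    {A : EuclideanSpace ℝ (Fin n) →L[ℝ] EuclideanSpace ℝ (Fin n)} {c : ℝ}
    {v : EuclideanSpace ℝ (Fin n)} (hv : v ≠ 0) (hA : A v = c • v) :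
    c ≤ inducedOpNorm N A := by
  have hNv : N v ≠ 0 := by simpa [h0] using hv
  have hunit : N ((N v)⁻¹ • v) = 1 := by
    have hnonneg : 0 ≤ N v := nonneg_of_subadditive_of_absHomogeneous hsmul hadd v
    rw [hsmul, abs_of_nonneg (inv_nonneg.2 hnonneg), inv_mul_cancel₀ hNv]
  refine (le_abs_self c).trans
    (le_csSup (bddAbove_image_unitSphere_of_norm h0 hsmul hadd A) ⟨_, hunit, ?_⟩)
  change N (A ((N v)⁻¹ • v)) = |c|
  rw [map_smul, hA, smul_comm, hsmul, hunit, mul_one]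

/-- The logarithmic norm of `-T` is at least the negative of every eigenvalue of `T`. -/
theorem neg_eigenvalue_le_of_tendsto_logNorm (h0 : ∀ x, N x = 0 ↔ x = 0)
    (hsmul : ∀ (a : ℝ) (x : EuclideanSpace ℝ (Fin n)), N (a • x) = |a| * N x)
    (hadd : ∀ x y, N (x + y) ≤ N x + N y)
    {T : EuclideanSpace ℝ (Fin n) →L[ℝ] EuclideanSpace ℝ (Fin n)} {c L : ℝ}
    {v : EuclideanSpace ℝ (Fin n)} (hv : v ≠ 0) (hT : T v = c • v)
    (hL : Filter.Tendsto (fun h : ℝ => (inducedOpNorm N (1 + h • (-T)) - 1) / h)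
      (nhdsWithin 0 (Set.Ioi 0)) (nhds L)) :
    -c ≤ L := by
  refine ge_of_tendsto hL (eventually_nhdsWithin_of_forall fun h (hh : 0 < h) => ?_)
  have hA : (1 + h • (-T)) v = (1 - h * c) • v := by
    simp only [add_apply, one_apply_eq_self,
      smul_apply, neg_apply, hT]
    module
  rw [le_div_iff₀ hh]
  linarith [le_inducedOpNorm_of_eigenvector h0 hsmul hadd hv hA]

/-- For the Euclidean norm, the logarithmic norm of `-T` with `T` symmetric is attained at an
eigenvalue of `T`. -/
theorem exists_eigenvector_tendsto_logNorm_euclidean (hn : 0 < n)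
    {T : EuclideanSpace ℝ (Fin n) →L[ℝ] EuclideanSpace ℝ (Fin n)}
    (hT : (T : EuclideanSpace ℝ (Fin n) →ₗ[ℝ] EuclideanSpace ℝ (Fin n)).IsSymmetric) :
    ∃ (c : ℝ) (v : EuclideanSpace ℝ (Fin n)), ‖v‖ = 1 ∧ T v = c • v ∧
      Filter.Tendsto (fun h : ℝ => (inducedOpNorm (fun v => ‖v‖) (1 + h • (-T)) - 1) / h)
        (nhdsWithin 0 (Set.Ioi 0)) (nhds (-c)) := by
  have hfin : Module.finrank ℝ (EuclideanSpace ℝ (Fin n)) = n := by simp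
  have : Nonempty (Fin n) := ⟨⟨0, hn⟩⟩
  let b := hT.eigenvectorBasis hfin
  let ev := hT.eigenvalues hfin
  obtain ⟨i, hi⟩ := Finite.exists_min ev
  obtain ⟨j, hj⟩ := Finite.exists_max ev
  have hTi : T (b i) = ev i • b i := hT.apply_eigenvectorBasis hfin i
  refine ⟨ev i, b i, b.norm_eq_one i, hTi, ?_⟩
  refine tendsto_const_nhds.congr' ?_
  have hsmall : ∀ᶠ h : ℝ in nhdsWithin 0 (Set.Ioi 0), h * ev j < 1 := by
    refine nhdsWithin_le_nhds (ContinuousAt.eventually_lt (by fun_prop) (by fun_prop) ?_)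
    simp
  filter_upwards [hsmall, self_mem_nhdsWithin] with h hh (hpos : 0 < h)
  have hnonneg (k) : 0 ≤ 1 - h * ev k := by
    nlinarith [mul_le_mul_of_nonneg_left (hj k) hpos.le]
  have hTrepr (v k) : b.repr (T v) k = ev k * b.repr v k :=
    hT.eigenvectorBasis_apply_self_apply hfin v k
  have hbound (v : EuclideanSpace ℝ (Fin n)) :
      ‖(1 + h • (-T)) v‖ ≤ (1 - h * ev i) * ‖v‖ := by
    refine le_of_sq_le_sq ?_ (mul_nonneg (hnonneg i) (norm_nonneg v))
    rw [mul_pow, ← b.repr.norm_map, ← b.repr.norm_map v, EuclideanSpace.norm_sq_eq,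
      EuclideanSpace.norm_sq_eq, Finset.mul_sum]
    refine Finset.sum_le_sum fun k _ => ?_
    have hk : b.repr ((1 + h • (-T)) v) k = (1 - h * ev k) * b.repr v k := by
      simp only [add_apply, one_apply_eq_self,
        smul_apply, neg_apply, map_add, map_smul,
        map_neg, PiLp.add_apply, PiLp.smul_apply, PiLp.neg_apply, hTrepr, smul_eq_mul]
      ring
    rw [hk, norm_mul, mul_pow, Real.norm_eq_abs (1 - h * ev k), sq_abs]
    gcongr
    · exact hnonneg k
    · exact hi k
  have hmax : inducedOpNorm (fun v => ‖v‖) (1 + h • (-T)) = 1 - h * ev i := by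
    refine IsGreatest.csSup_eq ⟨⟨b i, b.norm_eq_one i, ?_⟩, ?_⟩
    · have : (1 + h • (-T)) (b i) = (1 - h * ev i) • b i := by
        simp only [add_apply, one_apply_eq_self,
          smul_apply, neg_apply, hTi]
        module
      simp only [this, norm_smul, b.norm_eq_one i, mul_one, Real.norm_of_nonneg (hnonneg i)]
    · rintro _ ⟨v, hv, rfl⟩
      have hv1 : ‖v‖ = 1 := hv
      simpa [hv1] using hbound v
  rw [hmax]
  field_simp
  ring

end InducedOpNorm

theorem mul_norm_sq_le_inner_of_le_eigenvalues {E : Type*} [NormedAddCommGroup E]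
    [InnerProductSpace ℝ E] [FiniteDimensional ℝ E] {T : E →ₗ[ℝ] E} (hT : T.IsSymmetric)
    {c : ℝ} (hc : ∀ (a : ℝ) (v : E), v ≠ 0 → T v = a • v → c ≤ a) (v : E) :
    c * ‖v‖ ^ 2 ≤ ⟪T v, v⟫ := by
  let b := hT.eigenvectorBasis rfl
  have hTrepr (k) : b.repr (T v) k = hT.eigenvalues rfl k * b.repr v k :=
    hT.eigenvectorBasis_apply_self_apply rfl v k
  rw [← b.repr.norm_map v, ← b.repr.inner_map_map, EuclideanSpace.norm_sq_eq, Finset.mul_sum,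
    PiLp.inner_apply]
  refine Finset.sum_le_sum fun k _ => ?_
  have hk : c ≤ hT.eigenvalues rfl k :=
    hc _ (b k) (b.orthonormal.ne_zero k) (hT.apply_eigenvectorBasis rfl k)
  have := mul_le_mul_of_nonneg_right hk (sq_nonneg (b.repr v k))
  simp only [hTrepr, Real.norm_eq_abs, sq_abs, RCLike.inner_apply, conj_trivial]
  linarith

theorem ContDiff.isSymmetric_fderiv_gradient {E : Type*} [NormedAddCommGroup E]
    [InnerProductSpace ℝ E] [CompleteSpace E] {f : E → ℝ} (hf : ContDiff ℝ 2 f) (x : E) :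
    (fderiv ℝ (gradient f) x : E →ₗ[ℝ] E).IsSymmetric := by
  have hdiff : DifferentiableAt ℝ (fderiv ℝ f) x :=
    (hf.fderiv_right (m := 1) (by norm_num)).differentiable (by norm_num) x
  have hinner (v w : E) : ⟪fderiv ℝ (gradient f) x v, w⟫ = fderiv ℝ (fderiv ℝ f) x v w := by
    let e : StrongDual ℝ E ≃L[ℝ] E := (InnerProductSpace.toDual ℝ E).symm.toContinuousLinearEquiv
    have hgrad : HasFDerivAt (gradient f)
        ((e : StrongDual ℝ E →L[ℝ] E).comp (fderiv ℝ (fderiv ℝ f) x)) x :=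
      e.hasFDerivAt.comp x hdiff.hasFDerivAt
    rw [hgrad.fderiv]
    exact InnerProductSpace.toDual_symm_apply
  intro v w
  have hsymm := hf.contDiffAt.isSymmSndFDerivAt (x := x) (by simp)
  change ⟪fderiv ℝ (gradient f) x v, w⟫ = ⟪v, fderiv ℝ (gradient f) x w⟫
  rw [real_inner_comm _ v, hinner, hinner, hsymm.eq]

/-- For a `C²` function `f : ℝⁿ → ℝ` and `ν > 0`, the gradient flow `ẋ = -∇f(x)` is
infinitesimally contracting on `ℝⁿ` with rate `ν` with respect to the logarithmic norm
induced by some norm on `ℝⁿ` (i.e. `μ(-∇²f(x)) ≤ -ν` for all `x`, where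
`μ(A) = lim_{h→0⁺} (‖I + hA‖ - 1)/h`) if and only if `f` is `ν`-strongly convex
(i.e. `vᵀ ∇²f(x) v ≥ ν ‖v‖₂²` for all `x, v`). -/
theorem gradient_flow_infinitesimally_contracting_iff_strongly_convex
    {n : ℕ} (hn : 0 < n) (f : EuclideanSpace ℝ (Fin n) → ℝ)
    (hf : ContDiff ℝ 2 f) (ν : ℝ) (hν : 0 < ν) :
    (∃ N : EuclideanSpace ℝ (Fin n) → ℝ,
      (∀ x, N x = 0 ↔ x = 0) ∧
      (∀ (a : ℝ) (x : EuclideanSpace ℝ (Fin n)), N (a • x) = |a| * N x) ∧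
      (∀ x y, N (x + y) ≤ N x + N y) ∧
      (∀ x : EuclideanSpace ℝ (Fin n), ∃ L, L ≤ -ν ∧
        Filter.Tendsto
          (fun h : ℝ =>
            (inducedOpNorm N (1 + h • (-(fderiv ℝ (gradient f) x))) - 1) / h)
          (nhdsWithin 0 (Set.Ioi 0)) (nhds L)))
    ↔ (∀ (x v : EuclideanSpace ℝ (Fin n)),
        ν * ‖v‖ ^ 2 ≤ ⟪fderiv ℝ (gradient f) x v, v⟫) := by
  constructor
  · rintro ⟨N, h0, hsmul, hadd, hlog⟩ x v
    obtain ⟨L, hLν, hL⟩ := hlog x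
    refine mul_norm_sq_le_inner_of_le_eigenvalues (hf.isSymmetric_fderiv_gradient x)
      (fun a w hw hTw => ?_) v
    linarith [neg_eigenvalue_le_of_tendsto_logNorm h0 hsmul hadd hw hTw hL]
  · intro hconv
    refine ⟨fun v => ‖v‖, fun _ => norm_eq_zero, fun a x => by simp [norm_smul], norm_add_le,
      fun x => ?_⟩
    obtain ⟨c, v, hv, hTv, hL⟩ :=
      exists_eigenvector_tendsto_logNorm_euclidean hn (hf.isSymmetric_fderiv_gradient x)
    refine ⟨-c, ?_, hL⟩
    have h := hconv x v
    rw [hTv, real_inner_smul_left, real_inner_self_eq_norm_sq, hv] at h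
    linarith
end

section
/- Consider the ODE ẋ = g(x) with g : ℝⁿ → ℝⁿ continuously differentiable, and let M ∈ C¹(ℝⁿ, Sⁿ) be a Riemannian metric. Suppose there exist α, β > 0 with β I ⪯ M(x) ⪯ α I for all x ∈ ℝⁿ, and suppose M is a global contraction metric with rate ν > 0, i.e., M(x)∇g(x) + ∇g(x)ᵀ M(x) + Ṁ(x) ⪯ −2ν M(x) for all x ∈ ℝⁿ, where Ṁ(x) := DM(x)[g(x)] is the orbital derivative of M along g. Then any two solutions x(·), y(·) of the ODE satisfy ‖x(t) − y(t)‖₂ ≤ e^{−ν t} (α/β)^{1/2} ‖x(0) − y(0)‖₂ for all t ≥ 0. -/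
open scoped RealInnerProductSpace

open Set Filter Topology

/-- A curve with continuous velocity is approximated by its Euler steps uniformly on compact
time intervals. -/
theorem exists_forall_euler_step {E : Type*} [NormedAddCommGroup E] [NormedSpace ℝ E]
    {x x' : ℝ → E} (hx : ∀ t, 0 ≤ t → HasDerivAt x (x' t) t) (hx' : ContinuousOn x' (Ici 0))
    (T : ℝ) {δ : ℝ} (hδ : 0 < δ) :
    ∃ h₀ > 0, ∀ h, 0 ≤ h → h < h₀ → ∀ t ∈ Icc 0 T,
      ∃ ρ : E, ‖ρ‖ ≤ δ ∧ x (t + h) = x t + h • (x' t + ρ) := by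
  have huc : UniformContinuousOn x' (Icc 0 (T + 1)) :=
    isCompact_Icc.uniformContinuousOn_of_continuous (hx'.mono fun t ht => ht.1)
  obtain ⟨η, hη, hclose⟩ := Metric.uniformContinuousOn_iff.1 huc δ hδ
  refine ⟨min η 1, lt_min hη one_pos, fun h hh hlt t ht => ?_⟩
  have hlt₁ : h < η := hlt.trans_le (min_le_left _ _)
  have hlt₂ : h < 1 := hlt.trans_le (min_le_right _ _)
  rcases hh.eq_or_lt with rfl | hpos
  · exact ⟨0, by simpa using hδ.le, by simp⟩
  have hbound : ‖(x (t + h) - (t + h) • x' t) - (x t - t • x' t)‖ ≤ δ * (t + h - t) := by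
    refine norm_image_sub_le_of_norm_deriv_le_segment' (f := fun s => x s - s • x' t)
      (f' := fun s => x' s - x' t) (a := t) (b := t + h) (fun s hs => ?_) (fun s hs => ?_) _
      (right_mem_Icc.2 (by linarith))
    · have hlin : HasDerivAt (fun s : ℝ => s • x' t) (x' t) s := by
        simpa using (hasDerivAt_id s).smul_const (x' t)
      exact ((hx s (ht.1.trans hs.1)).sub hlin).hasDerivWithinAt
    · rw [← dist_eq_norm]
      refine (hclose s ⟨ht.1.trans hs.1, ?_⟩ t ⟨ht.1, ?_⟩ ?_).le
      · linarith [hs.2, ht.2]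
      · linarith [ht.2]
      · rw [Real.dist_eq, abs_of_nonneg (by linarith [hs.1])]
        linarith [hs.2]
  refine ⟨h⁻¹ • (x (t + h) - x t) - x' t, ?_, ?_⟩
  · have heq : h⁻¹ • (x (t + h) - x t) - x' t
        = h⁻¹ • ((x (t + h) - (t + h) • x' t) - (x t - t • x' t)) := by
      rw [add_smul, show x (t + h) - (t • x' t + h • x' t) - (x t - t • x' t)
        = (x (t + h) - x t) - h • x' t by abel, smul_sub h⁻¹ _ (h • x' t), smul_smul,
        inv_mul_cancel₀ hpos.ne', one_smul]
    rw [heq, norm_smul, norm_inv, Real.norm_of_nonneg hh, inv_mul_le_iff₀ hpos]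
    linarith
  · rw [add_sub_cancel, smul_smul, mul_inv_cancel₀ hpos.ne', one_smul, add_sub_cancel]

section Contraction

variable {E : Type*} [NormedAddCommGroup E] [InnerProductSpace ℝ E]

/-- The energy `⟪M (p + h u) (v + h b), v + h b⟫` of a tangent vector moved along straight lines
has the expected derivative in `h`. -/
theorem hasDerivAt_energy_line {M : E → E →L[ℝ] E} (hM : Differentiable ℝ M) (p u v b : E)
    (h : ℝ) :
    HasDerivAt (fun h : ℝ => ⟪M (p + h • u) (v + h • b), v + h • b⟫)
      (⟪M (p + h • u) (v + h • b), b⟫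
        + ⟪fderiv ℝ M (p + h • u) u (v + h • b) + M (p + h • u) b, v + h • b⟫) h := by
  have hline : ∀ q w : E, HasDerivAt (fun h : ℝ => q + h • w) w h := fun q w => by
    simpa using ((hasDerivAt_id h).smul_const w).const_add q
  have hMl : HasDerivAt (fun h : ℝ => M (p + h • u)) (fderiv ℝ M (p + h • u) u) h :=
    (hM (p + h • u)).hasFDerivAt.comp_hasDerivAt h (hline p u)
  exact (hMl.clm_apply (hline v b)).inner ℝ (hline v b)

/-- One perturbed Euler step contracts the energy of tangent vectors, uniformly on compact sets. -/
theorem exists_energy_euler_step_le {g : E → E} (hg : ContDiff ℝ 1 g)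
    {M : E → E →L[ℝ] E} (hM : ContDiff ℝ 1 M) (hsymm : ∀ x v w, ⟪M x v, w⟫ = ⟪v, M x w⟫)
    {ν : ℝ}
    (hcontr : ∀ x v,
      2 * ⟪M x (fderiv ℝ g x v), v⟫ + ⟪fderiv ℝ M x (g x) v, v⟫ ≤ -2 * ν * ⟪M x v, v⟫)
    {K : Set (E × E)} (hK : IsCompact K) {ε : ℝ} (hε : 0 < ε) :
    ∃ δ > 0, ∀ h, 0 ≤ h → h < δ → ∀ ρ ω : E, ‖ρ‖ < δ → ‖ω‖ < δ → ∀ p v, (p, v) ∈ K →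
      ⟪M (p + h • (g p + ρ)) (v + h • (fderiv ℝ g p v + ω)), v + h • (fderiv ℝ g p v + ω)⟫
        ≤ (1 - 2 * ν * h) * ⟪M p v, v⟫ + ε * h := by
  let D : (ℝ × E × E) → (E × E) → ℝ := fun z k =>
    ⟪M (k.1 + z.1 • (g k.1 + z.2.1)) (k.2 + z.1 • (fderiv ℝ g k.1 k.2 + z.2.2)),
      fderiv ℝ g k.1 k.2 + z.2.2⟫
    + ⟪fderiv ℝ M (k.1 + z.1 • (g k.1 + z.2.1)) (g k.1 + z.2.1)
          (k.2 + z.1 • (fderiv ℝ g k.1 k.2 + z.2.2))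
        + M (k.1 + z.1 • (g k.1 + z.2.1)) (fderiv ℝ g k.1 k.2 + z.2.2),
      k.2 + z.1 • (fderiv ℝ g k.1 k.2 + z.2.2)⟫
  have hgc := hg.continuous
  have hMc := hM.continuous
  have hdg : Continuous (fderiv ℝ g) := hg.continuous_fderiv one_ne_zero
  have hdM : Continuous (fderiv ℝ M) := hM.continuous_fderiv one_ne_zero
  have hD : Continuous fun q : (ℝ × E × E) × (E × E) => D q.1 q.2 := by
    dsimp only [D]
    fun_prop
  have hQ : Continuous fun q : (ℝ × E × E) × (E × E) =>
      -2 * ν * ⟪M q.2.1 q.2.2, q.2.2⟫ + ε := by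
    fun_prop
  have hev : ∀ᶠ z in 𝓝 (0 : ℝ × E × E), ∀ k ∈ K, D z k < -2 * ν * ⟪M k.1 k.2, k.2⟫ + ε := by
    refine hK.eventually_forall_of_forall_eventually fun k _ => ?_
    refine hD.continuousAt.eventually_lt hQ.continuousAt ?_
    have h₁ := hcontr k.1 k.2
    have h₂ : ⟪M k.1 k.2, fderiv ℝ g k.1 k.2⟫ = ⟪M k.1 (fderiv ℝ g k.1 k.2), k.2⟫ := by
      rw [hsymm, real_inner_comm]
    simp only [D, Prod.fst_zero, Prod.snd_zero, zero_smul, add_zero, inner_add_left, h₂]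
    linarith
  obtain ⟨δ, hδ, hball⟩ := Metric.eventually_nhds_iff.1 hev
  refine ⟨δ, hδ, fun h hh hhδ ρ ω hρ hω p v hk => ?_⟩
  have hder := fun s : ℝ => hasDerivAt_energy_line (hM.differentiable one_ne_zero) p (g p + ρ) v
    (fderiv ℝ g p v + ω) s
  have hmv := (convex_Icc 0 h).image_sub_le_mul_sub_of_deriv_le
    (fun s _ => (hder s).continuousAt.continuousWithinAt)
    (fun s _ => (hder s).differentiableAt.differentiableWithinAt)
    (C := -2 * ν * ⟪M p v, v⟫ + ε) (fun s hs => ?_) 0 (left_mem_Icc.2 hh) h (right_mem_Icc.2 hh) hh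
  · simp only [zero_smul, add_zero, sub_zero] at hmv
    linarith
  · rw [interior_Icc] at hs
    rw [(hder s).deriv]
    refine (hball (y := (s, ρ, ω)) ?_ (p, v) hk).le
    rw [dist_zero_right, Prod.norm_def, Prod.norm_def]
    refine max_lt ?_ (max_lt hρ hω)
    rw [Real.norm_of_nonneg hs.1.le]
    exact hs.2.trans hhδ

/-- A curve whose energy is at most `e` on `[0, 1]` moves a distance of at most `√(e / β)`. -/
theorem norm_sub_le_of_energy_le {M : E → E →L[ℝ] E} {β : ℝ} (hβ : 0 < β)
    (h_lower : ∀ x v, β * ‖v‖ ^ 2 ≤ ⟪M x v, v⟫) {c c' : ℝ → E}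
    (hc : ∀ s, HasDerivAt c (c' s) s) {e : ℝ}
    (he : ∀ s ∈ Icc (0 : ℝ) 1, ⟪M (c s) (c' s), c' s⟫ ≤ e) :
    ∀ s ∈ Icc (0 : ℝ) 1, ‖c' s‖ ≤ √(e / β) ∧ ‖c s - c 0‖ ≤ √(e / β) := by
  have hv : ∀ s ∈ Icc (0 : ℝ) 1, ‖c' s‖ ≤ √(e / β) := fun s hs => by
    refine Real.le_sqrt_of_sq_le ?_
    rw [le_div_iff₀ hβ]
    linarith [h_lower (c s) (c' s), he s hs]
  refine fun s hs => ⟨hv s hs, ?_⟩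
  have := norm_image_sub_le_of_norm_deriv_le_segment'
    (fun r _ => (hc r).hasDerivWithinAt) (fun r hr => hv r (Ico_subset_Icc_self hr)) s hs
  refine this.trans ?_
  rw [sub_zero]
  exact mul_le_of_le_one_right (Real.sqrt_nonneg _) hs.2

/-- The squared distance of two solutions decays exponentially up to an arbitrarily small error. -/
theorem sq_dist_solutions_le_add [ProperSpace E] {g : E → E} (hg : ContDiff ℝ 1 g)
    {M : E → E →L[ℝ] E} (hM : ContDiff ℝ 1 M) (hsymm : ∀ x v w, ⟪M x v, w⟫ = ⟪v, M x w⟫)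
    {α β : ℝ} (hα : 0 < α) (hβ : 0 < β) (h_lower : ∀ x v, β * ‖v‖ ^ 2 ≤ ⟪M x v, v⟫)
    (h_upper : ∀ x v, ⟪M x v, v⟫ ≤ α * ‖v‖ ^ 2) {ν : ℝ} (hν : 0 < ν)
    (hcontr : ∀ x v,
      2 * ⟪M x (fderiv ℝ g x v), v⟫ + ⟪fderiv ℝ M x (g x) v, v⟫ ≤ -2 * ν * ⟪M x v, v⟫)
    {x y : ℝ → E} (hx : ∀ t, 0 ≤ t → HasDerivAt x (g (x t)) t)
    (hy : ∀ t, 0 ≤ t → HasDerivAt y (g (y t)) t) {T : ℝ} (hT : 0 ≤ T) {ε : ℝ} (hε : 0 < ε) :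
    β * ‖x T - y T‖ ^ 2 ≤ Real.exp (-2 * ν * T) * (α * ‖x 0 - y 0‖ ^ 2) + ε * T := by
  have hxc : ContinuousOn x (Ici 0) := fun t ht => (hx t ht).continuousAt.continuousWithinAt
  have hyc : ContinuousOn y (Ici 0) := fun t ht => (hy t ht).continuousAt.continuousWithinAt
  obtain ⟨X, hX⟩ := isCompact_Icc.exists_bound_of_continuousOn
    (hxc.mono fun t (ht : t ∈ Icc 0 T) => ht.1)
  set e₀ : ℝ := α * ‖x 0 - y 0‖ ^ 2 with he₀
  have he₀_nonneg : 0 ≤ e₀ := by positivity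
  set R : ℝ := √((e₀ + ε * T) / β)
  obtain ⟨δ, hδ, hstep⟩ := exists_energy_euler_step_le hg hM hsymm hcontr
    ((isCompact_closedBall (0 : E) (X + R)).prod (isCompact_closedBall (0 : E) R)) hε
  obtain ⟨h₁, hh₁, hxstep⟩ := exists_forall_euler_step hx
    (hg.continuous.comp_continuousOn hxc) T (show 0 < δ / 4 by positivity)
  obtain ⟨h₂, hh₂, hystep⟩ := exists_forall_euler_step hy
    (hg.continuous.comp_continuousOn hyc) T (show 0 < δ / 4 by positivity)
  obtain ⟨N, hN, hNpos⟩ : ∃ N : ℕ, T / N < min (min δ (1 / (2 * ν))) (min h₁ h₂) ∧ 0 < N := by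
    have hlim := tendsto_const_div_atTop_nhds_zero_nat T
    exact ((hlim.eventually_lt_const (by positivity)).and (eventually_gt_atTop 0)).exists
  have hN' : (0 : ℝ) < N := Nat.cast_pos.2 hNpos
  set h : ℝ := T / N with hh
  have hh_nonneg : 0 ≤ h := by positivity
  simp only [lt_min_iff] at hN
  obtain ⟨⟨hhδ, hhν⟩, hhh₁, hhh₂⟩ := hN
  have hNh : N * h = T := by rw [hh]; field_simp
  have hfac : 0 ≤ 1 - 2 * ν * h := by
    rw [lt_div_iff₀ (by positivity)] at hhν
    linarith
  have hcurve : ∀ k : ℕ, k ≤ N → ∃ c c' : ℝ → E, (∀ s, HasDerivAt c (c' s) s) ∧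
      c 0 = x (k * h) ∧ c 1 = y (k * h) ∧ ∀ s ∈ Icc (0 : ℝ) 1,
        ⟪M (c s) (c' s), c' s⟫ ≤ Real.exp (-2 * ν * (k * h)) * e₀ + ε * (k * h) := by
    intro k
    induction k with
    | zero =>
      refine fun _ => ⟨fun s => x 0 + s • (y 0 - x 0), fun _ => y 0 - x 0, fun s => ?_, by simp,
        by simp, fun s _ => ?_⟩
      · simpa using ((hasDerivAt_id s).smul_const (y 0 - x 0)).const_add (x 0)
      · simpa [he₀, norm_sub_rev (x 0)] using h_upper (x 0 + s • (y 0 - x 0)) (y 0 - x 0)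
    | succ k ih =>
      intro hk
      obtain ⟨c, c', hc, hc0, hc1, he⟩ := ih (Nat.le_of_succ_le hk)
      have ht0 : 0 ≤ k * h := by positivity
      have htT : k * h ≤ T := by
        rw [← hNh]
        exact mul_le_mul_of_nonneg_right (Nat.cast_le.2 (Nat.le_of_succ_le hk)) hh_nonneg
      obtain ⟨ρ, hρ, hxρ⟩ := hxstep h hh_nonneg hhh₁ (k * h) ⟨ht0, htT⟩
      obtain ⟨σ, hσ, hyσ⟩ := hystep h hh_nonneg hhh₂ (k * h) ⟨ht0, htT⟩
      have htime : ((k + 1 : ℕ) : ℝ) * h = k * h + h := by push_cast; ring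
      refine ⟨fun s => c s + h • (g (c s) + (ρ + s • (σ - ρ))),
        fun s => c' s + h • (fderiv ℝ g (c s) (c' s) + (σ - ρ)), fun s => ?_, ?_, ?_,
        fun s hs => ?_⟩
      · have hlin : HasDerivAt (fun s : ℝ => ρ + s • (σ - ρ)) (σ - ρ) s := by
          simpa using ((hasDerivAt_id s).smul_const (σ - ρ)).const_add ρ
        have hgc : HasDerivAt (fun s => g (c s)) (fderiv ℝ g (c s) (c' s)) s :=
          (hg.differentiable one_ne_zero (c s)).hasFDerivAt.comp_hasDerivAt s (hc s)
        exact (hc s).add ((hgc.add hlin).const_smul h)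
      · simp only [zero_smul, add_zero]
        rw [htime, hxρ, hc0]
      · simp only [one_smul, add_sub_cancel]
        rw [htime, hyσ, hc1]
      · have hbd := norm_sub_le_of_energy_le hβ h_lower hc (e := e₀ + ε * T) (fun r hr => by
          refine (he r hr).trans (add_le_add ?_ (mul_le_mul_of_nonneg_left htT hε.le))
          refine mul_le_of_le_one_left he₀_nonneg (Real.exp_le_one_iff.2 ?_)
          nlinarith [mul_nonneg hν.le ht0]) s hs
        have hmem : (c s, c' s) ∈ Metric.closedBall (0 : E) (X + R) ×ˢ Metric.closedBall 0 R := by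
          refine ⟨?_, mem_closedBall_zero_iff.2 hbd.1⟩
          rw [mem_closedBall_zero_iff]
          calc ‖c s‖ = ‖c 0 + (c s - c 0)‖ := by rw [add_sub_cancel]
            _ ≤ ‖c 0‖ + ‖c s - c 0‖ := norm_add_le _ _
            _ ≤ X + R := add_le_add (hc0 ▸ hX _ ⟨ht0, htT⟩) hbd.2
        have hω : ‖σ - ρ‖ < δ := by linarith [norm_sub_le σ ρ]
        have hρs : ‖ρ + s • (σ - ρ)‖ < δ := by
          have h₃ : ‖s • (σ - ρ)‖ ≤ ‖σ - ρ‖ := by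
            rw [norm_smul, Real.norm_of_nonneg hs.1]
            exact mul_le_of_le_one_left (norm_nonneg _) hs.2
          linarith [norm_add_le ρ (s • (σ - ρ)), norm_sub_le σ ρ, norm_nonneg ρ]
        refine (hstep h hh_nonneg hhδ _ _ hρs hω _ _ hmem).trans ?_
        have hexp : (1 - 2 * ν * h) * Real.exp (-2 * ν * (k * h))
            ≤ Real.exp (-2 * ν * (k * h + h)) := by
          rw [show -2 * ν * (k * h + h) = -2 * ν * h + -2 * ν * (k * h) by ring, Real.exp_add]
          exact mul_le_mul_of_nonneg_right (by linarith [Real.add_one_le_exp (-2 * ν * h)])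
            (Real.exp_pos _).le
        have hdrop : (1 - 2 * ν * h) * (ε * (k * h)) ≤ ε * (k * h) :=
          mul_le_of_le_one_left (by positivity)
            (by linarith [mul_nonneg (mul_nonneg zero_le_two hν.le) hh_nonneg])
        rw [htime]
        linarith [mul_le_mul_of_nonneg_left (he s hs) hfac,
          mul_le_mul_of_nonneg_right hexp he₀_nonneg]
  obtain ⟨c, c', hc, hc0, hc1, he⟩ := hcurve N le_rfl
  have hend := (norm_sub_le_of_energy_le hβ h_lower hc he 1 (right_mem_Icc.2 zero_le_one)).2
  rw [hNh] at hc0 hc1 hend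
  rw [hc0, hc1, norm_sub_rev, Real.le_sqrt (norm_nonneg _) (by positivity),
    le_div_iff₀ hβ] at hend
  linarith

end Contraction

/-- Proposition (IES from a uniformly bounded global contraction metric).
Consider `ẋ = g(x)` with `g` continuously differentiable, and a `C¹` Riemannian metric
`M : ℝⁿ → Sⁿ` satisfying `β I ⪯ M(x) ⪯ α I` for all `x` (with `α, β > 0`). If `M` is a
global contraction metric with rate `ν > 0`, i.e.
`M(x) ∇g(x) + ∇g(x)ᵀ M(x) + Ṁ(x) ⪯ -2ν M(x)` for all `x`, where `Ṁ(x) = DM(x)[g(x)]`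
(stated equivalently via quadratic forms, using the symmetry of `M(x)`:
`2 vᵀ M(x) ∇g(x) v + vᵀ Ṁ(x) v ≤ -2ν vᵀ M(x) v`), then any two solutions satisfy
`‖x(t) - y(t)‖₂ ≤ e^{-νt} (α/β)^{1/2} ‖x(0) - y(0)‖₂` for all `t ≥ 0`. -/
theorem ies_of_uniformly_bounded_contraction_metric {n : ℕ}
    (g : EuclideanSpace ℝ (Fin n) → EuclideanSpace ℝ (Fin n))
    (hg : ContDiff ℝ 1 g)
    (M : EuclideanSpace ℝ (Fin n) → (EuclideanSpace ℝ (Fin n) →L[ℝ] EuclideanSpace ℝ (Fin n)))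
    (hM_smooth : ContDiff ℝ 1 M)
    (hM_symm : ∀ x v w, ⟪M x v, w⟫ = ⟪v, M x w⟫)
    (α β : ℝ) (hα : 0 < α) (hβ : 0 < β)
    (h_lower : ∀ x v, β * ‖v‖ ^ 2 ≤ ⟪M x v, v⟫)
    (h_upper : ∀ x v, ⟪M x v, v⟫ ≤ α * ‖v‖ ^ 2)
    (ν : ℝ) (hν : 0 < ν)
    (h_contr : ∀ x v,
      2 * ⟪M x (fderiv ℝ g x v), v⟫ + ⟪fderiv ℝ M x (g x) v, v⟫ ≤ -2 * ν * ⟪M x v, v⟫)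
    (x y : ℝ → EuclideanSpace ℝ (Fin n))
    (hx : ∀ t, 0 ≤ t → HasDerivAt x (g (x t)) t)
    (hy : ∀ t, 0 ≤ t → HasDerivAt y (g (y t)) t) :
    ∀ t, 0 ≤ t →
      ‖x t - y t‖ ≤ Real.exp (-ν * t) * Real.sqrt (α / β) * ‖x 0 - y 0‖ := by
  intro t ht
  have hsq : β * ‖x t - y t‖ ^ 2 ≤ Real.exp (-2 * ν * t) * (α * ‖x 0 - y 0‖ ^ 2) := by
    have hlim : Tendsto (fun ε : ℝ => Real.exp (-2 * ν * t) * (α * ‖x 0 - y 0‖ ^ 2) + ε * t)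
        (𝓝[>] 0) (𝓝 (Real.exp (-2 * ν * t) * (α * ‖x 0 - y 0‖ ^ 2) + 0 * t)) :=
      Continuous.tendsto' (by fun_prop) _ _ rfl |>.mono_left nhdsWithin_le_nhds
    rw [zero_mul, add_zero] at hlim
    refine ge_of_tendsto hlim ?_
    filter_upwards [self_mem_nhdsWithin] with ε hε
    exact sq_dist_solutions_le_add hg hM_smooth hM_symm hα hβ h_lower h_upper hν h_contr hx hy ht hε
  refine (sq_le_sq₀ (norm_nonneg _) (by positivity)).1 ?_
  rw [mul_pow, mul_pow, Real.sq_sqrt (by positivity), ← Real.exp_nat_mul,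
    show ((2 : ℕ) : ℝ) * (-ν * t) = -2 * ν * t by push_cast; ring]
  rw [← le_div_iff₀' hβ] at hsq
  refine hsq.trans_eq ?_
  ring
end

section
/- Let f : ℝⁿ → ℝ be twice continuously differentiable, proper (coercive), bounded below, attaining its minimum f* at a unique global minimizer x*, with vᵀ ∇²f(x*) v ≥ ν ‖v‖₂² for all v (for some ν > 0), and suppose f satisfies a 𝒦∞-PLI: there is a continuous, strictly increasing function α : [0,∞) → [0,∞) with α(0) = 0 and α(r) → ∞ as r → ∞ such that ‖∇f(x)‖₂ ≥ α(f(x) − f*) for all x ∈ ℝⁿ. Then for every ε ∈ (0, ν) there exists a Riemannian metric M̂ ∈ C¹(ℝⁿ, Sⁿ) and a constant β > 0 with β I ⪯ M̂(x) for all x, such that M̂(x)(−∇²f(x)) + (−∇²f(x)) M̂(x) + Ṁ̂(x) ⪯ −2(ν − ε) M̂(x) for all x ∈ ℝⁿ, where Ṁ̂(x) := DM̂(x)[−∇f(x)]. Consequently, x* is semi-globally exponentially stable for the gradient flow ẋ = −∇f(x) with rate ν − ε: there exists a continuous function h : ℝⁿ → [0,∞) such that every solution x(·) of the gradient flow satisfies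 ‖x(t) − x*‖₂ ≤ h(x(0)) e^{−(ν−ε) t} for all t ≥ 0. -/
open scoped RealInnerProductSpace

section GradientFlow

variable {E : Type*} [NormedAddCommGroup E] [InnerProductSpace ℝ E] [CompleteSpace E]

theorem ContDiff.gradient_of_two {f : E → ℝ} (hf : ContDiff ℝ 2 f) :
    ContDiff ℝ 1 (gradient f) := by
  have h : ContDiff ℝ 1 (fderiv ℝ f) := hf.fderiv_right (by norm_num)
  exact (InnerProductSpace.toDual ℝ E).symm.contDiff.comp h

/-- On a compact set, a Hessian lower bound `μ` at the critical points can be strengthened to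
`μ' < μ` everywhere, at the price of a multiple of the squared gradient norm. -/
theorem IsCompact.exists_hessian_bound {f : E → ℝ} (hf : ContDiff ℝ 2 f) {μ μ' : ℝ}
    (hμ : μ' < μ)
    (hcrit : ∀ x, gradient f x = 0 → ∀ v, μ * ‖v‖ ^ 2 ≤ ⟪fderiv ℝ (gradient f) x v, v⟫)
    {K : Set E} (hK : IsCompact K) :
    ∃ y, 0 ≤ y ∧ ∀ x ∈ K, ∀ v, 2 * μ' * ‖v‖ ^ 2 ≤
      2 * ⟪fderiv ℝ (gradient f) x v, v⟫ + y * ‖gradient f x‖ ^ 2 * ‖v‖ ^ 2 := by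
  have hg : ContDiff ℝ 1 (gradient f) := hf.gradient_of_two
  have hH : Continuous (fderiv ℝ (gradient f)) := hg.continuous_fderiv one_ne_zero
  refine hK.induction_on ⟨0, le_rfl, by simp⟩
    (fun _ _ h ⟨y, hy, H⟩ => ⟨y, hy, fun x hx => H x (h hx)⟩) ?_ ?_
  · rintro _ _ ⟨y₁, hy₁, H₁⟩ ⟨y₂, hy₂, H₂⟩
    refine ⟨y₁ + y₂, add_nonneg hy₁ hy₂, fun x hx v => ?_⟩
    have hn : 0 ≤ ‖gradient f x‖ ^ 2 * ‖v‖ ^ 2 := by positivity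
    have e₁ := mul_nonneg hy₁ hn
    have e₂ := mul_nonneg hy₂ hn
    rcases hx with hx | hx
    · linarith [H₁ x hx v]
    · linarith [H₂ x hx v]
  · intro x _
    by_cases h0 : gradient f x = 0
    · have hev : ∀ᶠ z in nhds x,
          ‖fderiv ℝ (gradient f) z - fderiv ℝ (gradient f) x‖ < μ - μ' := by
        have := (hH.sub continuous_const).norm.tendsto (x := x)
          (f := fun z => ‖fderiv ℝ (gradient f) z - fderiv ℝ (gradient f) x‖)
        rw [sub_self, norm_zero] at this
        exact this.eventually_lt_const (sub_pos.2 hμ)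
      refine ⟨_, mem_nhdsWithin_of_mem_nhds hev, 0, le_rfl, fun z hz v => ?_⟩
      have h1 := abs_le.1 (abs_real_inner_le_norm
        ((fderiv ℝ (gradient f) z - fderiv ℝ (gradient f) x) v) v)
      have h2 := (fderiv ℝ (gradient f) z - fderiv ℝ (gradient f) x).le_opNorm v
      have h3 := hcrit x h0 v
      have h4 := mul_le_mul_of_nonneg_right h2 (norm_nonneg v)
      have h5 := mul_le_mul_of_nonneg_right (le_of_lt hz) (sq_nonneg ‖v‖)
      rw [sub_apply, inner_sub_left] at h1
      rw [sub_apply] at h4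
      nlinarith [h1.1]
    · have hpos : 0 < ‖gradient f x‖ ^ 2 := by positivity
      set A : ℝ := ‖fderiv ℝ (gradient f) x‖ + 1 with hA
      have hA0 : 0 < A := by positivity
      have e₁ : ∀ᶠ z in nhds x, ‖fderiv ℝ (gradient f) z‖ < A :=
        (hH.norm.tendsto x).eventually_lt_const (by simp [hA])
      have e₂ : ∀ᶠ z in nhds x, ‖gradient f x‖ ^ 2 / 2 < ‖gradient f z‖ ^ 2 :=
        ((hg.continuous.norm.pow 2).tendsto x).eventually_const_lt (half_lt_self hpos)
      refine ⟨_, mem_nhdsWithin_of_mem_nhds (e₁.and e₂),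
        (2 * |μ'| + 2 * A) / (‖gradient f x‖ ^ 2 / 2), by positivity, fun z hz v => ?_⟩
      have h1 := (abs_le.1 (abs_real_inner_le_norm (fderiv ℝ (gradient f) z v) v)).1
      have h2 := mul_le_mul_of_nonneg_right ((fderiv ℝ (gradient f) z).le_opNorm v)
        (norm_nonneg v)
      have h3 := mul_le_mul_of_nonneg_right (le_of_lt hz.1) (sq_nonneg ‖v‖)
      have h4 : 2 * |μ'| + 2 * A ≤
          (2 * |μ'| + 2 * A) / (‖gradient f x‖ ^ 2 / 2) * ‖gradient f z‖ ^ 2 := by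
        rw [div_mul_eq_mul_div, le_div_iff₀ (by positivity)]
        exact mul_le_mul_of_nonneg_left (le_of_lt hz.2) (by positivity)
      have h5 := mul_le_mul_of_nonneg_right h4 (sq_nonneg ‖v‖)
      have h6 := mul_le_mul_of_nonneg_right (le_abs_self μ') (sq_nonneg ‖v‖)
      nlinarith

/-- The penalty weight in `IsCompact.exists_hessian_bound` can be chosen as a continuous function
of the value of `f`. -/
theorem exists_continuous_hessian_bound {f : E → ℝ} (hf : ContDiff ℝ 2 f)
    (hcoercive : Filter.Tendsto f (Filter.cocompact E) Filter.atTop) {μ μ' : ℝ} (hμ : μ' < μ)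
    (hcrit : ∀ x, gradient f x = 0 → ∀ v, μ * ‖v‖ ^ 2 ≤ ⟪fderiv ℝ (gradient f) x v, v⟫) :
    ∃ g : ℝ → ℝ, Continuous g ∧ (∀ r, 0 ≤ g r) ∧ ∀ x v, 2 * μ' * ‖v‖ ^ 2 ≤
      2 * ⟪fderiv ℝ (gradient f) x v, v⟫ + g (f x) * ‖gradient f x‖ ^ 2 * ‖v‖ ^ 2 := by
  obtain ⟨g, hg⟩ := exists_continuous_forall_mem_convex_of_local_const
    (t := fun r : ℝ => {y : ℝ | 0 ≤ y ∧ ∀ x v, f x = r → 2 * μ' * ‖v‖ ^ 2 ≤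
      2 * ⟪fderiv ℝ (gradient f) x v, v⟫ + y * ‖gradient f x‖ ^ 2 * ‖v‖ ^ 2})
    (fun r => by
      rintro y₁ ⟨h₁, H₁⟩ y₂ ⟨h₂, H₂⟩ s t hs ht hst
      refine ⟨by simp only [smul_eq_mul]; positivity, fun x v hx => ?_⟩
      have e₁ := mul_le_mul_of_nonneg_left (H₁ x v hx) hs
      have e₂ := mul_le_mul_of_nonneg_left (H₂ x v hx) ht
      obtain rfl : t = 1 - s := by linarith
      simp only [smul_eq_mul]
      linarith)
    (fun r => by
      obtain ⟨K, hK, hKsub⟩ := Filter.mem_cocompact.1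
        (hcoercive.eventually (Filter.eventually_gt_atTop (r + 1)))
      obtain ⟨y, hy, H⟩ := hK.exists_hessian_bound hf hμ hcrit
      refine ⟨y, ?_⟩
      filter_upwards [Iio_mem_nhds (lt_add_one r)] with s hs
      refine ⟨hy, fun x v hx => H x ?_ v⟩
      by_contra hxK
      have : r + 1 < f x := hKsub hxK
      rw [hx] at this
      exact lt_asymm this hs)
  exact ⟨g, g.continuous, fun r => (hg r).1, fun x v => (hg (f x)).2 x v rfl⟩

/-- Existence of a contraction metric, conformal to the Euclidean one. -/
theorem exists_contraction_metric {f : E → ℝ} (hf : ContDiff ℝ 2 f)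
    (hcoercive : Filter.Tendsto f (Filter.cocompact E) Filter.atTop)
    {c : ℝ} (hmin : ∀ x, c ≤ f x) {μ μ' : ℝ} (hμ : μ' < μ)
    (hcrit : ∀ x, gradient f x = 0 → ∀ v, μ * ‖v‖ ^ 2 ≤ ⟪fderiv ℝ (gradient f) x v, v⟫) :
    ∃ M : E → (E →L[ℝ] E),
      ContDiff ℝ 1 M ∧
      (∀ x v w, ⟪M x v, w⟫ = ⟪v, M x w⟫) ∧
      (∃ β > (0:ℝ), ∀ x v, β * ‖v‖ ^ 2 ≤ ⟪M x v, v⟫) ∧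
      (∀ x v,
        2 * ⟪M x (-(fderiv ℝ (gradient f) x v)), v⟫
            + ⟪fderiv ℝ M x (-(gradient f x)) v, v⟫
          ≤ -2 * μ' * ⟪M x v, v⟫) := by
  obtain ⟨g, hgc, hg0, hg⟩ := exists_continuous_hessian_bound hf hcoercive hμ hcrit
  set G : ℝ → ℝ := fun r => ∫ s in c..r, g s with hG
  have hGd : ∀ r, HasDerivAt G (g r) r := fun r =>
    intervalIntegral.integral_hasDerivAt_right (hgc.intervalIntegrable _ _)
      (hgc.stronglyMeasurableAtFilter _ _) hgc.continuousAt
  have hGc : ContDiff ℝ 1 G := by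
    refine contDiff_one_iff_deriv.2 ⟨fun r => (hGd r).differentiableAt, ?_⟩
    rwa [funext fun r => (hGd r).deriv]
  have hGf : ContDiff ℝ 1 fun x => Real.exp (G (f x)) :=
    (hGc.comp (hf.of_le (by norm_num))).exp
  have hfd : ∀ x, HasFDerivAt (fun x => Real.exp (G (f x)) • ContinuousLinearMap.id ℝ E)
      ((Real.exp (G (f x)) • g (f x) • fderiv ℝ f x).smulRight
        (ContinuousLinearMap.id ℝ E)) x := by
    intro x
    have h := (((hGd (f x)).comp_hasFDerivAt x
      (hf.differentiable two_ne_zero x).hasFDerivAt).exp).smul_const (ContinuousLinearMap.id ℝ E)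
    exact h
  refine ⟨fun x => Real.exp (G (f x)) • ContinuousLinearMap.id ℝ E, hGf.smul contDiff_const,
    fun x v w => by simp [inner_smul_left, inner_smul_right], ⟨1, one_pos, fun x v => ?_⟩,
    fun x v => ?_⟩
  · have : 0 ≤ G (f x) := intervalIntegral.integral_nonneg (hmin x) fun s _ => hg0 s
    have := mul_le_mul_of_nonneg_right (Real.one_le_exp this) (sq_nonneg ‖v‖)
    simpa [inner_smul_left] using this
  · have hgrad : fderiv ℝ f x (gradient f x) = ‖gradient f x‖ ^ 2 := by
      rw [← real_inner_self_eq_norm_sq]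
      nth_rewrite 3 [gradient]
      exact (InnerProductSpace.toDual_symm_apply).symm
    rw [(hfd x).fderiv]
    have h := mul_le_mul_of_nonneg_left (hg x v) (Real.exp_pos (G (f x))).le
    simp only [ContinuousLinearMap.smulRight_apply, smul_apply,
      ContinuousLinearMap.id_apply, map_neg, hgrad, smul_eq_mul, inner_neg_left,
      inner_smul_left, real_inner_self_eq_norm_sq, neg_apply,
      conj_trivial]
    linarith

/-- Along a gradient flow line, the squared gradient norm measured in a contraction metric decays
exponentially. -/
theorem gradient_flow_metric_decay {f : E → ℝ} (hf : ContDiff ℝ 2 f) {μ : ℝ}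
    {M : E → (E →L[ℝ] E)} (hM : ContDiff ℝ 1 M)
    (hsymm : ∀ x v w, ⟪M x v, w⟫ = ⟪v, M x w⟫)
    (hcontr : ∀ x v,
        2 * ⟪M x (-(fderiv ℝ (gradient f) x v)), v⟫
            + ⟪fderiv ℝ M x (-(gradient f x)) v, v⟫
          ≤ -2 * μ * ⟪M x v, v⟫)
    {x : ℝ → E} (hx : ∀ t, 0 ≤ t → HasDerivAt x (-(gradient f (x t))) t) {t : ℝ} (ht : 0 ≤ t) :
    ⟪M (x t) (gradient f (x t)), gradient f (x t)⟫ ≤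
      ⟪M (x 0) (gradient f (x 0)), gradient f (x 0)⟫ * Real.exp (-2 * μ * t) := by
  have hg : ContDiff ℝ 1 (gradient f) := hf.gradient_of_two
  set p : ℝ → ℝ := fun t => ⟪M (x t) (gradient f (x t)), gradient f (x t)⟫ with hp
  have hpd : ∀ s, 0 ≤ s → ∃ p', HasDerivAt p p' s ∧ p' ≤ -2 * μ * p s := by
    intro s hs
    have hMx := (hM.differentiable one_ne_zero (x s)).hasFDerivAt.comp_hasDerivAt s (hx s hs)
    have hgx := (hg.differentiable one_ne_zero (x s)).hasFDerivAt.comp_hasDerivAt s (hx s hs)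
    refine ⟨_, (hMx.clm_apply hgx).inner ℝ hgx, ?_⟩
    have h := hcontr (x s) (gradient f (x s))
    have h' := hsymm (x s) (gradient f (x s))
      (fderiv ℝ (gradient f) (x s) (-gradient f (x s)))
    rw [real_inner_comm _ (gradient f (x s))] at h'
    rw [← map_neg (fderiv ℝ (gradient f) (x s))] at h
    simp only [Function.comp_apply, inner_add_left, hp]
    linarith
  have hqd : ∀ s, 0 ≤ s → ∃ q' ≤ 0, HasDerivAt (fun s => p s * Real.exp (2 * μ * s)) q' s := by
    intro s hs
    obtain ⟨p', hp', hle⟩ := hpd s hs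
    refine ⟨_, ?_, hp'.mul ((hasDerivAt_id s).const_mul (2 * μ)).exp⟩
    have := mul_le_mul_of_nonneg_right hle (Real.exp_pos (2 * μ * s)).le
    simp only [id]
    linarith
  have hanti : AntitoneOn (fun s => p s * Real.exp (2 * μ * s)) (Set.Ici 0) := by
    refine antitoneOn_of_deriv_nonpos (convex_Ici 0) (fun s hs => ?_) (fun s hs => ?_)
      (fun s hs => ?_)
    · obtain ⟨q', -, hq⟩ := hqd s hs
      exact hq.continuousAt.continuousWithinAt
    · obtain ⟨q', -, hq⟩ := hqd s (interior_subset hs)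
      exact hq.differentiableAt.differentiableWithinAt
    · obtain ⟨q', hq', hq⟩ := hqd s (interior_subset hs)
      rwa [hq.deriv]
  have h := hanti Set.self_mem_Ici ht ht
  simp only [mul_zero, Real.exp_zero, mul_one] at h
  rw [neg_mul, neg_mul, Real.exp_neg, ← div_eq_mul_inv, le_div_iff₀ (Real.exp_pos _)]
  exact h

/-- A curve whose speed is at most `C * exp (-μ * t)` stays within `C / μ * exp (-μ * t)` of its
position at time `t`. -/
theorem norm_sub_le_of_deriv_exp_decay {F : Type*} [NormedAddCommGroup F] [NormedSpace ℝ F]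
    {x x' : ℝ → F} {C μ : ℝ} (hC : 0 ≤ C) (hμ : 0 < μ)
    (hx : ∀ t, 0 ≤ t → HasDerivAt x (x' t) t)
    (hbound : ∀ t, 0 ≤ t → ‖x' t‖ ≤ C * Real.exp (-μ * t)) {t s : ℝ} (ht : 0 ≤ t) (hts : t ≤ s) :
    ‖x s - x t‖ ≤ C / μ * Real.exp (-μ * t) := by
  have hB : ∀ r, HasDerivAt
      (fun r => C / μ * (Real.exp (-μ * t) - Real.exp (-μ * r))) (C * Real.exp (-μ * r)) r := by
    intro r
    have h := ((((hasDerivAt_id r).const_mul (-μ)).exp).const_sub (Real.exp (-μ * t))).const_mul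
      (C / μ)
    refine h.congr_deriv ?_
    simp only [id]
    field_simp
  have h := image_norm_le_of_norm_deriv_right_le_deriv_boundary
    (f := fun r => x r - x t) (a := t) (b := s)
    (fun r hr => ((hx r (ht.trans hr.1)).continuousAt.sub continuousAt_const).continuousWithinAt)
    (fun r hr => ((hx r (ht.trans hr.1)).sub_const (x t)).hasDerivWithinAt)
    (by simp) hB (fun r hr => hbound r (ht.trans hr.1)) (Set.right_mem_Icc.2 hts)
  refine h.trans (mul_le_mul_of_nonneg_left ?_ (by positivity))
  linarith [Real.exp_pos (-μ * s)]

/-- If the gradient decays exponentially along a flow line of `-gradient f` and `z` is the only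
critical point of `f`, then the flow line converges to `z` exponentially. -/
theorem gradient_flow_norm_sub_le [ProperSpace E] {f : E → ℝ} (hf : ContDiff ℝ 2 f) {z : E}
    (hz : ∀ y, gradient f y = 0 → y = z) {C μ : ℝ} (hC : 0 ≤ C) (hμ : 0 < μ)
    {x : ℝ → E} (hx : ∀ t, 0 ≤ t → HasDerivAt x (-(gradient f (x t))) t)
    (hbound : ∀ t, 0 ≤ t → ‖gradient f (x t)‖ ≤ C * Real.exp (-μ * t)) {t : ℝ} (ht : 0 ≤ t) :
    ‖x t - z‖ ≤ C / μ * Real.exp (-μ * t) := by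
  have hdist : ∀ s, t ≤ s → ‖x s - x t‖ ≤ C / μ * Real.exp (-μ * t) := fun s hs =>
    norm_sub_le_of_deriv_exp_decay hC hμ hx (fun r hr => by simpa using hbound r hr) ht hs
  have hmem : ∀ k : ℕ, x (t + k) ∈ Metric.closedBall (x t) (C / μ * Real.exp (-μ * t)) :=
    fun k => mem_closedBall_iff_norm.2 (hdist _ (by simp))
  obtain ⟨y, hy, φ, hφ, hlim⟩ := (isCompact_closedBall _ _).tendsto_subseq hmem
  have hgy : gradient f y = 0 := by
    have h1 := (hf.gradient_of_two.continuous.tendsto y).comp hlim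
    refine tendsto_nhds_unique h1 (squeeze_zero_norm (a := fun k : ℕ =>
      C * Real.exp (-μ * (t + φ k))) (fun k => hbound _ (by positivity)) ?_)
    have h2 : Filter.Tendsto (fun k : ℕ => t + (φ k : ℝ)) Filter.atTop Filter.atTop :=
      Filter.tendsto_atTop_add_const_left _ _
        (tendsto_natCast_atTop_atTop.comp hφ.tendsto_atTop)
    simpa using ((Real.tendsto_exp_atBot.comp
      (h2.const_mul_atTop_of_neg (neg_neg_of_pos hμ))).const_mul C)
  rw [← hz y hgy, ← norm_neg, neg_sub]
  exact mem_closedBall_iff_norm.1 hy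

/-- A contraction metric bounded below forces semi-global exponential convergence of the gradient
flow to the only critical point. -/
theorem exists_stability_bound_of_contraction_metric [ProperSpace E] {f : E → ℝ}
    (hf : ContDiff ℝ 2 f) {z : E} (hz : ∀ y, gradient f y = 0 → y = z) {μ : ℝ} (hμ : 0 < μ)
    {M : E → (E →L[ℝ] E)} (hM : ContDiff ℝ 1 M)
    (hsymm : ∀ x v w, ⟪M x v, w⟫ = ⟪v, M x w⟫)
    {β : ℝ} (hβ : 0 < β) (hMβ : ∀ x v, β * ‖v‖ ^ 2 ≤ ⟪M x v, v⟫)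
    (hcontr : ∀ x v,
        2 * ⟪M x (-(fderiv ℝ (gradient f) x v)), v⟫
            + ⟪fderiv ℝ M x (-(gradient f x)) v, v⟫
          ≤ -2 * μ * ⟪M x v, v⟫) :
    ∃ h : E → ℝ, Continuous h ∧ (∀ x, 0 ≤ h x) ∧
      ∀ x : ℝ → E, (∀ t, 0 ≤ t → HasDerivAt x (-(gradient f (x t))) t) →
        ∀ t, 0 ≤ t → ‖x t - z‖ ≤ h (x 0) * Real.exp (-μ * t) := by
  have hg : Continuous (gradient f) := hf.gradient_of_two.continuous
  refine ⟨fun x => √(⟪M x (gradient f x), gradient f x⟫ / β) / μ, ?_, fun x => by positivity, ?_⟩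
  · exact ((((hM.continuous.clm_apply hg).inner hg).div_const β).sqrt).div_const μ
  · intro x hx t ht
    refine gradient_flow_norm_sub_le hf hz (Real.sqrt_nonneg _) hμ hx (fun s hs => ?_) ht
    have h1 := (hMβ (x s) (gradient f (x s))).trans
      (gradient_flow_metric_decay hf hM hsymm hcontr hx hs)
    have h2 : 0 ≤ ⟪M (x 0) (gradient f (x 0)), gradient f (x 0)⟫ / β :=
      div_nonneg ((mul_nonneg hβ.le (sq_nonneg _)).trans (hMβ (x 0) _)) hβ.le
    refine (sq_le_sq₀ (norm_nonneg _) (by positivity)).1 ?_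
    rw [mul_pow, Real.sq_sqrt h2, div_mul_eq_mul_div, le_div_iff₀ hβ, ← Real.exp_nat_mul]
    convert h1 using 1
    · ring
    · congr 2
      push_cast
      ring

end GradientFlow

/-- Theorem 1 (semi-global exponential stability).
Let `f : ℝⁿ → ℝ` be `C²`, proper (coercive), bounded below, attaining its minimum at a unique
global minimizer `x*` where `vᵀ ∇²f(x*) v ≥ ν ‖v‖₂²` for some `ν > 0`, and satisfying a
`𝒦∞`-PLI `‖∇f(x)‖ ≥ α(f(x) - f*)`. Then for every `ε ∈ (0, ν)` there is a uniformly lower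
bounded `C¹` Riemannian metric `M̂` with
`M̂(x)(-∇²f(x)) + (-∇²f(x)) M̂(x) + Ṁ̂(x) ⪯ -2(ν-ε) M̂(x)` for all `x` (stated via quadratic
forms), and consequently `x*` is semi-globally exponentially stable for `ẋ = -∇f(x)` with
rate `ν - ε`. -/
theorem semiglobal_exponential_stability {n : ℕ}
    (f : EuclideanSpace ℝ (Fin n) → ℝ)
    (hf : ContDiff ℝ 2 f)
    (hcoercive : Filter.Tendsto f (Filter.cocompact (EuclideanSpace ℝ (Fin n))) Filter.atTop)
    (hbdd : BddBelow (Set.range f))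
    (xstar : EuclideanSpace ℝ (Fin n))
    (hmin : ∀ x, f xstar ≤ f x)
    (huniq : ∀ x, (∀ y, f x ≤ f y) → x = xstar)
    (ν : ℝ) (hν : 0 < ν)
    (hconv : ∀ v, ν * ‖v‖ ^ 2 ≤ ⟪fderiv ℝ (gradient f) xstar v, v⟫)
    (a : ℝ → ℝ)
    (ha_cont : ContinuousOn a (Set.Ici 0))
    (ha_mono : StrictMonoOn a (Set.Ici 0))
    (ha_zero : a 0 = 0)
    (ha_nonneg : ∀ r, 0 ≤ r → 0 ≤ a r)
    (ha_top : Filter.Tendsto a Filter.atTop Filter.atTop)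
    (hPLI : ∀ x, a (f x - f xstar) ≤ ‖gradient f x‖)
    (ε : ℝ) (hε : 0 < ε) (hεν : ε < ν) :
    (∃ M : EuclideanSpace ℝ (Fin n) →
        (EuclideanSpace ℝ (Fin n) →L[ℝ] EuclideanSpace ℝ (Fin n)),
      ContDiff ℝ 1 M ∧
      (∀ x v w, ⟪M x v, w⟫ = ⟪v, M x w⟫) ∧
      (∃ β > (0:ℝ), ∀ x v, β * ‖v‖ ^ 2 ≤ ⟪M x v, v⟫) ∧
      (∀ x v,
        2 * ⟪M x (-(fderiv ℝ (gradient f) x v)), v⟫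
            + ⟪fderiv ℝ M x (-(gradient f x)) v, v⟫
          ≤ -2 * (ν - ε) * ⟪M x v, v⟫)) ∧
    (∃ h : EuclideanSpace ℝ (Fin n) → ℝ, Continuous h ∧ (∀ x, 0 ≤ h x) ∧
      ∀ x : ℝ → EuclideanSpace ℝ (Fin n),
        (∀ t, 0 ≤ t → HasDerivAt x (-(gradient f (x t))) t) →
        ∀ t, 0 ≤ t →
          ‖x t - xstar‖ ≤ h (x 0) * Real.exp (-(ν - ε) * t)) := by
  have hz : ∀ y, gradient f y = 0 → y = xstar := by
    intro y hy
    refine huniq y fun w => ?_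
    have h0 : 0 ≤ f y - f xstar := sub_nonneg.2 (hmin y)
    have h := hPLI y
    rw [hy, norm_zero, ← ha_zero, ha_mono.le_iff_le h0 Set.self_mem_Ici] at h
    linarith [hmin w]
  have hμ : 0 < ν - ε := sub_pos.2 hεν
  obtain ⟨M, hM, hsymm, ⟨β, hβ, hMβ⟩, hcontr⟩ := exists_contraction_metric hf hcoercive hmin
    (sub_lt_self ν hε) (fun x hx v => by rw [hz x hx]; exact hconv v)
  exact ⟨⟨M, hM, hsymm, ⟨β, hβ, hMβ⟩, hcontr⟩,
    exists_stability_bound_of_contraction_metric hf hz hμ hM hsymm hβ hMβ hcontr⟩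
end

section
/- Let f : ℝⁿ → ℝ be twice continuously differentiable, proper (coercive), bounded below, attaining its minimum f* at a unique global minimizer x*, with vᵀ ∇²f(x*) v ≥ ν ‖v‖₂² for all v (for some ν > 0), and suppose f satisfies a 𝒦∞-PLI: there is a continuous, strictly increasing function α : [0,∞) → [0,∞) with α(0) = 0 and α(r) → ∞ as r → ∞ such that ‖∇f(x)‖₂ ≥ α(f(x) − f*) for all x ∈ ℝⁿ. Then for every compact set K ⊂ ℝⁿ containing x* in its interior that is forward invariant under the gradient flow ẋ = −∇f(x), and for every ε ∈ (0, ν), there exists c > 0 such that any two solutions x(·), y(·) of the gradient flow with x(0), y(0) ∈ K satisfy ‖x(t) − y(t)‖₂ ≤ c e^{−(ν−ε) t} ‖x(0) − y(0)‖₂ for all t ≥ 0; in particular, x* is exponentially stable on K. -/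
open scoped RealInnerProductSpace

section GradientFlow

variable {E : Type*} [NormedAddCommGroup E] [InnerProductSpace ℝ E]

/-- Two trajectories of `ẋ = -g x` contract at rate `k` on a time interval along which `g` is
`k`-strongly monotone between them; `k` may be negative. -/
theorem norm_sub_le_exp_mul_of_monotone_along {g : E → E} {x y : ℝ → E} {s t k : ℝ} (hst : s ≤ t)
    (hx : ∀ τ ∈ Set.Icc s t, HasDerivAt x (-g (x τ)) τ)
    (hy : ∀ τ ∈ Set.Icc s t, HasDerivAt y (-g (y τ)) τ)
    (hg : ∀ τ ∈ Set.Icc s t,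
      k * ‖x τ - y τ‖ ^ 2 ≤ ⟪g (x τ) - g (y τ), x τ - y τ⟫) :
    ‖x t - y t‖ ≤ Real.exp (-k * (t - s)) * ‖x s - y s‖ := by
  have hd : ∀ τ ∈ Set.Icc s t, HasDerivAt
      (fun τ => ‖x τ - y τ‖ ^ 2 * Real.exp (k * (τ - s)) ^ 2)
      (2 * Real.exp (k * (τ - s)) ^ 2 *
        (k * ‖x τ - y τ‖ ^ 2 - ⟪g (x τ) - g (y τ), x τ - y τ⟫)) τ := by
    intro τ hτ
    have h1 := ((hx τ hτ).sub (hy τ hτ)).norm_sq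
    have h2 := ((((hasDerivAt_id τ).sub_const s).const_mul k).exp).pow 2
    refine (h1.mul h2).congr_deriv ?_
    have h3 : -g (x τ) - -g (y τ) = -(g (x τ) - g (y τ)) := by abel
    simp only [Pi.sub_apply, Pi.pow_apply, id, h3, inner_neg_right,
      real_inner_comm (g (x τ) - g (y τ))]
    push_cast
    ring
  have hanti : AntitoneOn (fun τ => ‖x τ - y τ‖ ^ 2 * Real.exp (k * (τ - s)) ^ 2)
      (Set.Icc s t) := by
    refine antitoneOn_of_hasDerivWithinAt_nonpos (convex_Icc s t)
      (fun τ hτ => (hd τ hτ).continuousAt.continuousWithinAt)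
      (fun τ hτ => (hd τ (interior_subset hτ)).hasDerivWithinAt) fun τ hτ => ?_
    exact mul_nonpos_of_nonneg_of_nonpos (by positivity)
      (sub_nonpos.2 (hg τ (interior_subset hτ)))
  have h := hanti (Set.left_mem_Icc.2 hst) (Set.right_mem_Icc.2 hst) hst
  simp only [sub_self, mul_zero, Real.exp_zero, one_pow, mul_one, ← mul_pow] at h
  have h' := (pow_le_pow_iff_left₀ (by positivity) (by positivity) two_ne_zero).1 h
  rw [neg_mul, Real.exp_neg, inv_mul_eq_div, le_div_iff₀ (Real.exp_pos _)]
  exact h'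

/-- A strictly differentiable map whose derivative at `p` is `ν`-coercive is strongly monotone
near `p`, with any smaller constant. -/
theorem HasStrictFDerivAt.exists_ball_strongly_monotone {g : E → E} {A : E →L[ℝ] E} {p : E}
    (hg : HasStrictFDerivAt g A p) {ν ε : ℝ} (hε : 0 < ε)
    (hA : ∀ v, ν * ‖v‖ ^ 2 ≤ ⟪A v, v⟫) :
    ∃ δ > 0, ∀ x ∈ Metric.ball p δ, ∀ y ∈ Metric.ball p δ,
      (ν - ε) * ‖x - y‖ ^ 2 ≤ ⟪g x - g y, x - y⟫ := by
  obtain ⟨δ, hδ, h⟩ := Metric.eventually_nhds_iff_ball.1 (hg.isLittleO.def hε)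
  refine ⟨δ, hδ, fun x hx y hy => ?_⟩
  have hxy : ‖g x - g y - A (x - y)‖ ≤ ε * ‖x - y‖ :=
    h (x, y) (by rw [← ball_prod_same]; exact ⟨hx, hy⟩)
  have h1 := (abs_le.1 (abs_real_inner_le_norm (g x - g y - A (x - y)) (x - y))).1
  have h2 := mul_le_mul_of_nonneg_right hxy (norm_nonneg (x - y))
  have h3 := hA (x - y)
  rw [inner_sub_left] at h1
  nlinarith

variable [CompleteSpace E]

theorem ContDiff.gradient_right {f : E → ℝ} {m n : WithTop ℕ∞} (hf : ContDiff ℝ n f)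
    (hmn : m + 1 ≤ n) : ContDiff ℝ m (gradient f) :=
  (InnerProductSpace.toDual ℝ E).symm.toContinuousLinearEquiv.contDiff.comp (hf.fderiv_right hmn)

/-- Dissipation identity along a gradient flow. -/
theorem DifferentiableAt.hasDerivAt_comp_gradient_flow {f : E → ℝ} {x : ℝ → E} {t : ℝ}
    (hf : DifferentiableAt ℝ f (x t)) (hx : HasDerivAt x (-gradient f (x t)) t) :
    HasDerivAt (fun τ => f (x τ)) (-‖gradient f (x t)‖ ^ 2) t := by
  refine (hf.hasFDerivAt.comp_hasDerivAt t hx).congr_deriv ?_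
  rw [← inner_gradient_left, inner_neg_right, real_inner_self_eq_norm_sq]

/-- A differentiable function is nonincreasing along its gradient flow. -/
theorem Differentiable.antitoneOn_gradient_flow {f : E → ℝ} (hf : Differentiable ℝ f)
    {x : ℝ → E} (hx : ∀ t, 0 ≤ t → HasDerivAt x (-gradient f (x t)) t) :
    AntitoneOn (fun t => f (x t)) (Set.Ici 0) := by
  have hd : ∀ t ∈ Set.Ici (0 : ℝ), HasDerivAt (fun τ => f (x τ)) (-‖gradient f (x t)‖ ^ 2) t :=
    fun t ht => (hf _).hasDerivAt_comp_gradient_flow (hx t ht)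
  exact antitoneOn_of_hasDerivWithinAt_nonpos (convex_Ici 0)
    (fun t ht => (hd t ht).continuousAt.continuousWithinAt)
    (fun t ht => (hd t (interior_subset ht)).hasDerivWithinAt) fun t _ => by
      simp only [Left.neg_nonpos_iff]; positivity

/-- If the gradient has norm at least `b` on `{m ≤ f}`, then a gradient flow started at height at
most `M` lies in `{f ≤ m}` from time `T` on, as soon as `M - b² T ≤ m`. -/
theorem Differentiable.gradient_flow_le_of_le_norm_gradient {f : E → ℝ}
    (hf : Differentiable ℝ f) {x : ℝ → E}
    (hx : ∀ t, 0 ≤ t → HasDerivAt x (-gradient f (x t)) t) {m M b T t : ℝ} (hb : 0 ≤ b)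
    (hgrad : ∀ z, m ≤ f z → b ≤ ‖gradient f z‖) (hM : f (x 0) ≤ M) (hT : 0 ≤ T)
    (hMT : M - b ^ 2 * T ≤ m) (htT : T ≤ t) : f (x t) ≤ m := by
  have hanti := hf.antitoneOn_gradient_flow hx
  refine (hanti hT (hT.trans htT : (0 : ℝ) ≤ t) htT).trans ?_
  by_contra! hlt
  have hd : ∀ τ ∈ Set.Icc 0 T, HasDerivAt (fun τ => f (x τ) + b ^ 2 * τ)
      (-‖gradient f (x τ)‖ ^ 2 + b ^ 2) τ := fun τ hτ => by
    have h := ((hf _).hasDerivAt_comp_gradient_flow (hx τ hτ.1)).add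
      ((hasDerivAt_id τ).const_mul (b ^ 2))
    rw [mul_one] at h
    exact h
  have hanti' : AntitoneOn (fun τ => f (x τ) + b ^ 2 * τ) (Set.Icc 0 T) := by
    refine antitoneOn_of_hasDerivWithinAt_nonpos (convex_Icc 0 T)
      (fun τ hτ => (hd τ hτ).continuousAt.continuousWithinAt)
      (fun τ hτ => (hd τ (interior_subset hτ)).hasDerivWithinAt) fun τ hτ => ?_
    have hτ' := interior_subset hτ
    have hmτ : m ≤ f (x τ) := hlt.le.trans (hanti hτ'.1 hT hτ'.2)
    have := pow_le_pow_left₀ hb (hgrad _ hmτ) 2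
    linarith
  have := hanti' (Set.left_mem_Icc.2 hT) (Set.right_mem_Icc.2 hT) hT
  simp only [mul_zero, add_zero] at this
  linarith

end GradientFlow

/-- For a coercive continuous function with a unique global minimizer `p`, small sublevel sets are
contained in a prescribed ball around `p`. -/
theorem exists_sublevel_subset_ball {E : Type*} [PseudoMetricSpace E] {f : E → ℝ}
    (hf : Continuous f) (hcoercive : Filter.Tendsto f (Filter.cocompact E) Filter.atTop) {p : E}
    (hmin : ∀ x, f p ≤ f x) (huniq : ∀ x, (∀ y, f x ≤ f y) → x = p) {δ : ℝ} (hδ : 0 < δ) :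
    ∃ r > 0, ∀ x, f x ≤ f p + r → x ∈ Metric.ball p δ := by
  obtain ⟨S, hS, hSf⟩ := Filter.mem_cocompact.1
    (hcoercive.eventually (Filter.eventually_gt_atTop (f p + 1)))
  have hlt : ∀ x ∈ S \ Metric.ball p δ, f p < f x := fun x hx =>
    lt_of_le_of_ne (hmin x) fun h => hx.2 <| by
      rw [huniq x fun y => h ▸ hmin y]; exact Metric.mem_ball_self hδ
  obtain ⟨m, hm, hmle⟩ : ∃ m > f p, ∀ x ∈ S \ Metric.ball p δ, m ≤ f x := by
    rcases (S \ Metric.ball p δ).eq_empty_or_nonempty with h | h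
    · exact ⟨f p + 1, by simp, by simp [h]⟩
    · obtain ⟨z, hz, hzmin⟩ :=
        (hS.diff Metric.isOpen_ball).exists_isMinOn h hf.continuousOn
      exact ⟨f z, hlt z hz, fun x hx => hzmin hx⟩
  refine ⟨min 1 ((m - f p) / 2), lt_min one_pos (by linarith), fun x hx => ?_⟩
  have h1 := min_le_left 1 ((m - f p) / 2)
  have h2 := min_le_right 1 ((m - f p) / 2)
  by_contra hxb
  by_cases hxS : x ∈ S
  · linarith [hmle x ⟨hxS, hxb⟩]
  · have : f p + 1 < f x := hSf hxS
    linarith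

/-- Corollary (exponential stability on compact forward invariant sets).
Under the assumptions of the semi-global exponential stability theorem (`f` `C²`, coercive,
bounded below, unique global minimizer `x*` with `vᵀ ∇²f(x*) v ≥ ν ‖v‖₂²`, and a `𝒦∞`-PLI),
for every compact forward invariant set `K` containing `x*` in its interior and every
`ε ∈ (0, ν)`, the gradient flow is incrementally exponentially stable on `K` with rate
`ν - ε`; in particular `x*` is exponentially stable on `K`. -/
theorem exponential_stability_on_compacts {n : ℕ}
    (f : EuclideanSpace ℝ (Fin n) → ℝ)
    (hf : ContDiff ℝ 2 f)
    (hcoercive : Filter.Tendsto f (Filter.cocompact (EuclideanSpace ℝ (Fin n))) Filter.atTop)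
    (hbdd : BddBelow (Set.range f))
    (xstar : EuclideanSpace ℝ (Fin n))
    (hmin : ∀ x, f xstar ≤ f x)
    (huniq : ∀ x, (∀ y, f x ≤ f y) → x = xstar)
    (ν : ℝ) (hν : 0 < ν)
    (hconv : ∀ v, ν * ‖v‖ ^ 2 ≤ ⟪fderiv ℝ (gradient f) xstar v, v⟫)
    (a : ℝ → ℝ)
    (ha_cont : ContinuousOn a (Set.Ici 0))
    (ha_mono : StrictMonoOn a (Set.Ici 0))
    (ha_zero : a 0 = 0)
    (ha_nonneg : ∀ r, 0 ≤ r → 0 ≤ a r)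
    (ha_top : Filter.Tendsto a Filter.atTop Filter.atTop)
    (hPLI : ∀ x, a (f x - f xstar) ≤ ‖gradient f x‖)
    (K : Set (EuclideanSpace ℝ (Fin n)))
    (hK_compact : IsCompact K)
    (hK_xstar : xstar ∈ interior K)
    (hK_inv : ∀ x : ℝ → EuclideanSpace ℝ (Fin n),
      (∀ t, 0 ≤ t → HasDerivAt x (-(gradient f (x t))) t) →
      x 0 ∈ K → ∀ t, 0 ≤ t → x t ∈ K)
    (ε : ℝ) (hε : 0 < ε) (hεν : ε < ν) :
    ∃ c > (0:ℝ),
      (∀ x y : ℝ → EuclideanSpace ℝ (Fin n),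
        (∀ t, 0 ≤ t → HasDerivAt x (-(gradient f (x t))) t) →
        (∀ t, 0 ≤ t → HasDerivAt y (-(gradient f (y t))) t) →
        x 0 ∈ K → y 0 ∈ K →
        ∀ t, 0 ≤ t →
          ‖x t - y t‖ ≤ c * Real.exp (-(ν - ε) * t) * ‖x 0 - y 0‖) ∧
      (∀ x : ℝ → EuclideanSpace ℝ (Fin n),
        (∀ t, 0 ≤ t → HasDerivAt x (-(gradient f (x t))) t) →
        x 0 ∈ K →
        ∀ t, 0 ≤ t →
          ‖x t - xstar‖ ≤ c * Real.exp (-(ν - ε) * t) * ‖x 0 - xstar‖) := by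
  have hdiff : Differentiable ℝ f := hf.differentiable two_ne_zero
  have hgrad : ContDiff ℝ 1 (gradient f) := hf.gradient_right (by norm_num)
  obtain ⟨δ, hδ, hmono⟩ :=
    (hgrad.hasStrictFDerivAt one_ne_zero).exists_ball_strongly_monotone hε hconv
  obtain ⟨r, hr, hball⟩ :=
    exists_sublevel_subset_ball hf.continuous hcoercive hmin huniq hδ
  obtain ⟨L, hL⟩ : ∃ L, LipschitzOnWith L (gradient f) K :=
    hgrad.locallyLipschitz.locallyLipschitzOn.exists_lipschitzOnWith_of_compact hK_compact
  obtain ⟨M, hM⟩ := hK_compact.bddAbove_image hf.continuous.continuousOn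
  have hM' : ∀ z ∈ K, f z ≤ M := fun z hz => hM ⟨z, hz, rfl⟩
  have har : 0 < a r := ha_zero ▸ ha_mono Set.self_mem_Ici hr.le hr
  have hgrad_ge : ∀ z, f xstar + r ≤ f z → a r ≤ ‖gradient f z‖ := fun z hz =>
    (ha_mono.monotoneOn hr.le (hr.le.trans (by linarith) : (0 : ℝ) ≤ f z - f xstar)
      (by linarith)).trans (hPLI z)
  have hMx : f xstar ≤ M := hM' _ (interior_subset hK_xstar)
  set T := (M - f xstar) / a r ^ 2 with hTdef
  have hT : 0 ≤ T := div_nonneg (by linarith) (by positivity)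
  have hMT : M - a r ^ 2 * T ≤ f xstar + r := by
    rw [hTdef, mul_div_cancel₀ _ (by positivity)]; linarith
  have hincr : ∀ x y : ℝ → EuclideanSpace ℝ (Fin n),
      (∀ t, 0 ≤ t → HasDerivAt x (-(gradient f (x t))) t) →
      (∀ t, 0 ≤ t → HasDerivAt y (-(gradient f (y t))) t) →
      x 0 ∈ K → y 0 ∈ K → ∀ t, 0 ≤ t →
      ‖x t - y t‖ ≤ Real.exp ((L + ν) * T) * Real.exp (-(ν - ε) * t) * ‖x 0 - y 0‖ := by
    intro x y hx hy hx0 hy0 t ht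
    have hearly : ∀ s, 0 ≤ s → ‖x s - y s‖ ≤ Real.exp (L * s) * ‖x 0 - y 0‖ := by
      intro s hs
      have h := norm_sub_le_exp_mul_of_monotone_along (k := -(L : ℝ)) hs
        (fun τ hτ => hx τ hτ.1) (fun τ hτ => hy τ hτ.1) fun τ hτ => by
          have h1 := (abs_le.1 (abs_real_inner_le_norm
            (gradient f (x τ) - gradient f (y τ)) (x τ - y τ))).1
          have h2 := mul_le_mul_of_nonneg_right
            (hL.norm_sub_le (hK_inv x hx hx0 τ hτ.1) (hK_inv y hy hy0 τ hτ.1))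
            (norm_nonneg (x τ - y τ))
          nlinarith
      simpa using h
    rw [← Real.exp_add]
    rcases le_total t T with htT | hTt
    · refine (hearly t ht).trans ?_
      refine mul_le_mul_of_nonneg_right (Real.exp_le_exp.2 ?_) (norm_nonneg _)
      nlinarith [L.2, mul_nonneg L.2 (sub_nonneg.2 htT), mul_nonneg hν.le (sub_nonneg.2 htT),
        mul_nonneg hε.le ht]
    · have hin : ∀ z : ℝ → EuclideanSpace ℝ (Fin n),
          (∀ t, 0 ≤ t → HasDerivAt z (-(gradient f (z t))) t) → z 0 ∈ K →
          ∀ τ, T ≤ τ → z τ ∈ Metric.ball xstar δ := fun z hz hz0 τ hτ =>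
        hball _ (hdiff.gradient_flow_le_of_le_norm_gradient hz har.le hgrad_ge (hM' _ hz0)
          hT hMT hτ)
      refine (norm_sub_le_exp_mul_of_monotone_along hTt
        (fun τ hτ => hx τ (hT.trans hτ.1)) (fun τ hτ => hy τ (hT.trans hτ.1))
        fun τ hτ => hmono _ (hin x hx hx0 τ hτ.1) _ (hin y hy hy0 τ hτ.1)).trans ?_
      refine (mul_le_mul_of_nonneg_left (hearly T hT) (Real.exp_nonneg _)).trans ?_
      rw [← mul_assoc, ← Real.exp_add]
      refine mul_le_mul_of_nonneg_right (Real.exp_le_exp.2 ?_) (norm_nonneg _)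
      nlinarith [mul_nonneg hε.le hT]
  refine ⟨Real.exp ((L + ν) * T), Real.exp_pos _, hincr, fun x hx hx0 t ht => ?_⟩
  have hcrit : gradient f xstar = 0 := by
    have : IsLocalMin f xstar := Filter.Eventually.of_forall hmin
    simp [gradient, this.fderiv_eq_zero]
  exact hincr x (fun _ => xstar) hx
    (fun s _ => by simpa [hcrit] using hasDerivAt_const s xstar) hx0
    (interior_subset hK_xstar) t ht
end

section
/- Let f : ℝⁿ → ℝ be twice continuously differentiable, proper (coercive), bounded below, attaining its minimum f* at a unique global minimizer x*, with vᵀ ∇²f(x*) v ≥ ν ‖v‖₂² for all v (for some ν > 0), and suppose f satisfies a 𝒦∞-PLI: there is a continuous, strictly increasing function α : [0,∞) → [0,∞) with α(0) = 0 and α(r) → ∞ as r → ∞ such that ‖∇f(x)‖₂ ≥ α(f(x) − f*) for all x ∈ ℝⁿ. Assume further that f is m-state-bounded concave for some m > 0, i.e., the set S = { x ∈ ℝⁿ : λ_min(∇²f(x)) < m } is bounded. Then the gradient flow ẋ = −∇f(x) is globally incrementally exponentially stable: there exist c > 0 and κ > 0 such that any two solutions x(·), y(·) satisfy ‖x(t)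 − y(t)‖₂ ≤ c e^{−κ t} ‖x(0) − y(0)‖₂ for all t ≥ 0; in particular, x* is globally exponentially stable. -/
open scoped RealInnerProductSpace

/-- A continuous map is bounded in norm on every closed ball of a proper space. -/
lemma exists_norm_le_on_closedBall {E : Type*} [NormedAddCommGroup E]
    [ProperSpace E] {F : Type*} [NormedAddCommGroup F]
    {u : E → F} (hu : Continuous u) (R : ℝ) :
    ∃ C : ℝ, 0 ≤ C ∧ ∀ z, ‖z‖ ≤ R → ‖u z‖ ≤ C := by
  obtain ⟨C, hC⟩ :=
    (isCompact_closedBall (0 : E) R).exists_bound_of_continuousOn hu.continuousOn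
  exact ⟨max C 0, le_max_right _ _, fun z hz =>
    (hC z (mem_closedBall_zero_iff.2 hz)).trans (le_max_left _ _)⟩

section NormedSpace

variable {E : Type*} [NormedAddCommGroup E] [NormedSpace ℝ E]

/-- A `C¹` map is Lipschitz on every closed ball of a proper space. -/
lemma exists_lipschitz_on_closedBall [ProperSpace E] {F : Type*} [NormedAddCommGroup F]
    [NormedSpace ℝ F] {u : E → F} (hu : ContDiff ℝ 1 u) (R : ℝ) :
    ∃ C : ℝ, 0 ≤ C ∧ ∀ z w, ‖z‖ ≤ R → ‖w‖ ≤ R → ‖u z - u w‖ ≤ C * ‖z - w‖ := by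
  obtain ⟨C, hC⟩ := hu.contDiffOn.exists_lipschitzOnWith one_ne_zero
    (convex_closedBall (0 : E) R) (isCompact_closedBall _ _)
  exact ⟨C, C.2, fun z w hz hw => hC.norm_sub_le (mem_closedBall_zero_iff.2 hz)
    (mem_closedBall_zero_iff.2 hw)⟩

/-- First-order Taylor expansion of a `C²` function, with a quadratic remainder which is uniform
on a ball. -/
lemma exists_quadratic_remainder_on_closedBall [ProperSpace E] {u : E → ℝ}
    (hu : ContDiff ℝ 2 u) (R : ℝ) :
    ∃ C : ℝ, 0 ≤ C ∧ ∀ z w, ‖z‖ ≤ R → ‖w‖ ≤ R →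
      |u w - u z - fderiv ℝ u z (w - z)| ≤ C * ‖w - z‖ ^ 2 := by
  obtain ⟨C, hC0, hC⟩ := exists_lipschitz_on_closedBall
    (hu.fderiv_right (m := 1) (by norm_num)) R
  refine ⟨C, hC0, fun z w hz hw => ?_⟩
  have hseg : ∀ p ∈ segment ℝ z w, ‖p‖ ≤ R := fun p hp => mem_closedBall_zero_iff.1
    ((convex_closedBall (0 : E) R).segment_subset (mem_closedBall_zero_iff.2 hz)
      (mem_closedBall_zero_iff.2 hw) hp)
  have key := Convex.norm_image_sub_le_of_norm_fderiv_le' (𝕜 := ℝ) (f := u)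
    (C := C * ‖w - z‖) (s := segment ℝ z w) (φ := fderiv ℝ u z) (x := z) (y := w)
    (fun p _ => (hu.differentiable (by norm_num)).differentiableAt)
    (fun p hp => (hC p z (hseg p hp) hz).trans
      (mul_le_mul_of_nonneg_left (norm_sub_le_of_mem_segment hp) hC0))
    (convex_segment z w) (left_mem_segment ℝ z w) (right_mem_segment ℝ z w)
  rw [Real.norm_eq_abs] at key
  calc _ ≤ _ := key
    _ = _ := by ring

/-- One step of the explicit Euler scheme for `ẋ = -g(x)` with step size `h`. -/
def eulerStep (g : E → E) (h : ℝ) (z : E) : E := z - h • g z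

/-- The explicit Euler scheme is first-order accurate as long as it and the exact solution stay in
a ball on which `g` is bounded by `G` and `Λ`-Lipschitz. -/
lemma norm_sub_iterate_eulerStep_le {g : E → E} {x : ℝ → E} {h t R G Λ : ℝ} {N : ℕ}
    (hx : ∀ s, 0 ≤ s → HasDerivAt x (-(g (x s))) s) (hh : 0 ≤ h) (hN : N * h ≤ t)
    (hG0 : 0 ≤ G) (hΛ0 : 0 ≤ Λ) (hG : ∀ z, ‖z‖ ≤ R → ‖g z‖ ≤ G)
    (hΛ : ∀ z w, ‖z‖ ≤ R → ‖w‖ ≤ R → ‖g z - g w‖ ≤ Λ * ‖z - w‖)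
    (hxR : ∀ s, 0 ≤ s → s ≤ t → ‖x s‖ ≤ R)
    (hpR : ∀ k : ℕ, ‖(eulerStep g h)^[k] (x 0)‖ ≤ R) (k : ℕ) (hk : k ≤ N) :
    ‖x (k * h) - (eulerStep g h)^[k] (x 0)‖ ≤
      k * (Λ * G * h ^ 2) * Real.exp (k * (Λ * h)) := by
  induction k with
  | zero => simp
  | succ k ih =>
    have ih := ih (by omega)
    set p := (eulerStep g h)^[k] (x 0) with hp
    set b : ℝ := k * h with hb
    have hb0 : 0 ≤ b := by positivity
    have hbt : b + h ≤ t := by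
      have : ((k + 1 : ℕ) : ℝ) * h ≤ N * h :=
        mul_le_mul_of_nonneg_right (by exact_mod_cast hk) hh
      push_cast at this
      linarith
    have hvar : ∀ s ∈ Set.Icc b (b + h), ‖x s - x b‖ ≤ G * h := by
      intro s hs
      have := norm_image_sub_le_of_norm_deriv_le_segment' (f := x) (a := b) (b := b + h)
        (f' := fun s => -(g (x s))) (C := G)
        (fun s hs => (hx s (hb0.trans hs.1)).hasDerivWithinAt)
        (fun s hs => by
          rw [norm_neg]
          exact hG _ (hxR s (hb0.trans hs.1) (hs.2.le.trans hbt))) s hs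
      exact this.trans (mul_le_mul_of_nonneg_left (by linarith [hs.2]) hG0)
    have htrunc : ‖x (b + h) - x b + h • g (x b)‖ ≤ Λ * G * h ^ 2 := by
      have := norm_image_sub_le_of_norm_deriv_le_segment' (f := fun s => x s + s • g (x b))
        (a := b) (b := b + h)
        (f' := fun s => -(g (x s)) + (1 : ℝ) • g (x b)) (C := Λ * (G * h))
        (fun s hs => ((hx s (hb0.trans hs.1)).add
          ((hasDerivAt_id s).smul_const (g (x b)))).hasDerivWithinAt)
        (fun s hs => by
          have h1 := hΛ (x b) (x s) (hxR b hb0 (by linarith))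
            (hxR s (hb0.trans hs.1) (hs.2.le.trans hbt))
          rw [one_smul, neg_add_eq_sub]
          refine h1.trans (mul_le_mul_of_nonneg_left ?_ hΛ0)
          rw [norm_sub_rev]
          exact hvar s ⟨hs.1, hs.2.le⟩) (b + h) ⟨by linarith, le_rfl⟩
      have e : x (b + h) - x b + h • g (x b)
          = x (b + h) + (b + h) • g (x b) - (x b + b • g (x b)) := by
        rw [add_smul]; abel
      rw [e]
      refine this.trans (le_of_eq (by ring))
    have hstep : ‖x (b + h) - eulerStep g h p‖
        ≤ (1 + Λ * h) * ‖x b - p‖ + Λ * G * h ^ 2 := by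
      have e : x (b + h) - eulerStep g h p
          = (x (b + h) - x b + h • g (x b)) + (x b - p) - h • (g (x b) - g p) := by
        rw [eulerStep, smul_sub]; abel
      rw [e]
      have h1 : ‖h • (g (x b) - g p)‖ ≤ h * (Λ * ‖x b - p‖) := by
        rw [norm_smul, Real.norm_of_nonneg hh]
        exact mul_le_mul_of_nonneg_left (hΛ _ _ (hxR b hb0 (by linarith)) (hpR k)) hh
      have h2 := norm_sub_le ((x (b + h) - x b + h • g (x b)) + (x b - p)) (h • (g (x b) - g p))
      have h3 := norm_add_le (x (b + h) - x b + h • g (x b)) (x b - p)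
      nlinarith
    rw [Function.iterate_succ_apply']
    have e1 : ((k + 1 : ℕ) : ℝ) * h = b + h := by push_cast; ring
    have e2 : ((k + 1 : ℕ) : ℝ) * (Λ * h) = Λ * h + k * (Λ * h) := by push_cast; ring
    rw [e1, e2, Real.exp_add]
    set q := Real.exp (Λ * h)
    set Q := Real.exp (k * (Λ * h))
    have hq : 1 + Λ * h ≤ q := by linarith [Real.add_one_le_exp (Λ * h)]
    have hq1 : 1 ≤ q := by nlinarith [mul_nonneg hΛ0 hh]
    have hQ : 1 ≤ Q := Real.one_le_exp (by positivity)
    have hD : 0 ≤ Λ * G * h ^ 2 := by positivity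
    calc _ ≤ _ := hstep
      _ ≤ q * (k * (Λ * G * h ^ 2) * Q) + Λ * G * h ^ 2 * (q * Q) := by
        refine add_le_add (mul_le_mul hq ih (norm_nonneg _) (by positivity)) ?_
        exact le_mul_of_one_le_right hD (one_le_mul_of_one_le_of_one_le hq1 hQ)
      _ = _ := by push_cast; ring

end NormedSpace

section InnerProductSpace

variable {E : Type*} [NormedAddCommGroup E] [InnerProductSpace ℝ E]

/-- If `exp (2W) ‖·‖²` is infinitesimally contracted at rate `2κ` by the flow of `-g`, then a step of
the explicit Euler scheme contracts it at the same rate up to an error of second order. -/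
lemma exists_eulerStep_weighted_contraction [ProperSpace E] {g : E → E} (hg : ContDiff ℝ 1 g)
    {W : E → ℝ} (hW : ContDiff ℝ 2 W) {κ : ℝ}
    (hκ : ∀ z v, κ * ‖v‖ ^ 2 ≤ fderiv ℝ W z (g z) * ‖v‖ ^ 2 + ⟪fderiv ℝ g z v, v⟫) (R : ℝ) :
    ∃ C : ℝ, 0 ≤ C ∧ ∀ h z v, 0 ≤ h → ‖z‖ ≤ R → ‖eulerStep g h z‖ ≤ R →
      Real.exp (2 * W (eulerStep g h z)) * ‖v - h • fderiv ℝ g z v‖ ^ 2 ≤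
        Real.exp (2 * W z - 2 * κ * h + C * h ^ 2) * ‖v‖ ^ 2 := by
  obtain ⟨C, hC0, hC⟩ := exists_quadratic_remainder_on_closedBall hW R
  obtain ⟨G, hG0, hG⟩ := exists_norm_le_on_closedBall hg.continuous R
  obtain ⟨B, hB0, hB⟩ := exists_norm_le_on_closedBall (hg.continuous_fderiv one_ne_zero) R
  refine ⟨2 * (C * G ^ 2) + B ^ 2, by positivity, fun h z v hh hz hPz => ?_⟩
  set d := fderiv ℝ W z (g z)
  have hWP : W (eulerStep g h z) ≤ W z - h * d + C * G ^ 2 * h ^ 2 := by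
    have h1 := (abs_le.1 (hC z _ hz hPz)).2
    have e : eulerStep g h z - z = -(h • g z) := by rw [eulerStep]; abel
    rw [e, map_neg, map_smul, norm_neg, norm_smul, Real.norm_of_nonneg hh, smul_eq_mul] at h1
    have h2 : (h * ‖g z‖) ^ 2 ≤ (h * G) ^ 2 :=
      pow_le_pow_left₀ (by positivity) (mul_le_mul_of_nonneg_left (hG z hz) hh) 2
    nlinarith [mul_le_mul_of_nonneg_left h2 hC0]
  have hHv : ‖v - h • fderiv ℝ g z v‖ ^ 2 ≤
      Real.exp (-2 * h * (κ - d) + B ^ 2 * h ^ 2) * ‖v‖ ^ 2 := by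
    have h1 : ‖fderiv ℝ g z v‖ ^ 2 ≤ (B * ‖v‖) ^ 2 :=
      pow_le_pow_left₀ (norm_nonneg _) ((fderiv ℝ g z).le_of_opNorm_le (hB z hz) v) 2
    have h2 : ‖v - h • fderiv ℝ g z v‖ ^ 2
        ≤ (-2 * h * (κ - d) + B ^ 2 * h ^ 2 + 1) * ‖v‖ ^ 2 := by
      rw [norm_sub_sq_real, inner_smul_right, norm_smul, Real.norm_of_nonneg hh, real_inner_comm]
      nlinarith [mul_le_mul_of_nonneg_left (hκ z v) hh,
        mul_le_mul_of_nonneg_left h1 (sq_nonneg h)]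
    exact h2.trans (mul_le_mul_of_nonneg_right (Real.add_one_le_exp _) (sq_nonneg _))
  calc _ ≤ Real.exp (2 * (W z - h * d + C * G ^ 2 * h ^ 2)) *
        (Real.exp (-2 * h * (κ - d) + B ^ 2 * h ^ 2) * ‖v‖ ^ 2) := by gcongr
    _ = _ := by
      rw [← mul_assoc, ← Real.exp_add]
      ring_nf

/-- Bound on the derivative of the iterated Euler scheme on an invariant set, given a weighted
contraction estimate for one step. -/
lemma exists_hasFDerivAt_iterate_eulerStep {g : E → E} (hg : Differentiable ℝ g)
    {W : E → ℝ} {A h c : ℝ} (hWA : ∀ z, -A ≤ W z) (hW0 : ∀ z, W z ≤ 0) {K : Set E}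
    (hK : ∀ z ∈ K, eulerStep g h z ∈ K)
    (hstep : ∀ z ∈ K, ∀ v,
      Real.exp (2 * W (eulerStep g h z)) * ‖v - h • fderiv ℝ g z v‖ ^ 2 ≤
        Real.exp (2 * W z - 2 * c) * ‖v‖ ^ 2) (k : ℕ) {z : E} (hz : z ∈ K) :
    ∃ D : E →L[ℝ] E, HasFDerivAt (eulerStep g h)^[k] D z ∧ ‖D‖ ≤ Real.exp (A - k * c) := by
  have hmem : ∀ k : ℕ, (eulerStep g h)^[k] z ∈ K := fun k => by
    induction k with
    | zero => exact hz
    | succ k ih => rw [Function.iterate_succ_apply']; exact hK _ ih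
  have key : ∃ D : E →L[ℝ] E, HasFDerivAt (eulerStep g h)^[k] D z ∧ ∀ v,
      Real.exp (2 * W ((eulerStep g h)^[k] z)) * ‖D v‖ ^ 2 ≤
        Real.exp (2 * W z - 2 * (k * c)) * ‖v‖ ^ 2 := by
    induction k with
    | zero => exact ⟨ContinuousLinearMap.id ℝ E, hasFDerivAt_id z, fun v => by simp⟩
    | succ k ih =>
      obtain ⟨D, hD, hb⟩ := ih
      set p := (eulerStep g h)^[k] z with hp
      have hP : HasFDerivAt (eulerStep g h)
          (ContinuousLinearMap.id ℝ E - h • fderiv ℝ g p) p :=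
        (hasFDerivAt_id p).sub ((hg p).hasFDerivAt.const_smul h)
      refine ⟨(ContinuousLinearMap.id ℝ E - h • fderiv ℝ g p).comp D, ?_, fun v => ?_⟩
      · rw [Function.iterate_succ']
        exact hP.comp z hD
      · rw [Function.iterate_succ_apply', ← hp]
        have h1 := hstep p (hmem k) (D v)
        calc _ ≤ _ := h1
          _ = Real.exp (-2 * c) * (Real.exp (2 * W p) * ‖D v‖ ^ 2) := by
            rw [← mul_assoc, ← Real.exp_add]; ring_nf
          _ ≤ Real.exp (-2 * c) * (Real.exp (2 * W z - 2 * (k * c)) * ‖v‖ ^ 2) := by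
            exact mul_le_mul_of_nonneg_left (hb v) (Real.exp_nonneg _)
          _ = _ := by
            rw [← mul_assoc, ← Real.exp_add]; push_cast; ring_nf
  obtain ⟨D, hD, hb⟩ := key
  refine ⟨D, hD, D.opNorm_le_bound (Real.exp_nonneg _) fun v => ?_⟩
  refine abs_le_of_sq_le_sq' ?_ (by positivity) |>.2
  have hpos := Real.exp_pos (2 * W ((eulerStep g h)^[k] z))
  refine le_of_mul_le_mul_left ?_ hpos
  calc _ ≤ _ := hb v
    _ ≤ Real.exp (2 * W ((eulerStep g h)^[k] z) + (A - k * c) + (A - k * c)) * ‖v‖ ^ 2 := by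
      gcongr
      linarith [hWA ((eulerStep g h)^[k] z), hW0 z]
    _ = _ := by rw [Real.exp_add, Real.exp_add]; ring

/-- Incremental exponential stability from a conformal contraction metric `exp (2W) ‖·‖²` with
bounded weight, for a flow `ẋ = -g(x)` admitting a coercive Lyapunov function `f`. -/
theorem norm_sub_le_of_weighted_contraction [ProperSpace E] {g : E → E} (hg : ContDiff ℝ 1 g)
    {f W : E → ℝ} (hf : ContDiff ℝ 2 f) (hfg : ∀ z, fderiv ℝ f z (g z) = ‖g z‖ ^ 2)
    (hcoercive : Filter.Tendsto f (Filter.cocompact E) Filter.atTop)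
    (hW : ContDiff ℝ 2 W) {A κ : ℝ} (hWA : ∀ z, -A ≤ W z) (hW0 : ∀ z, W z ≤ 0) (hκ0 : 0 < κ)
    (hκ : ∀ z v, κ * ‖v‖ ^ 2 ≤ fderiv ℝ W z (g z) * ‖v‖ ^ 2 + ⟪fderiv ℝ g z v, v⟫)
    {x y : ℝ → E} (hx : ∀ s, 0 ≤ s → HasDerivAt x (-(g (x s))) s)
    (hy : ∀ s, 0 ≤ s → HasDerivAt y (-(g (y s))) s) {t : ℝ} (ht : 0 ≤ t) :
    ‖x t - y t‖ ≤ Real.exp A * Real.exp (-(κ / 2) * t) * ‖x 0 - y 0‖ := by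
  have hbound : ∀ u : ℝ → E, (∀ s, 0 ≤ s → HasDerivAt u (-(g (u s))) s) →
      ∃ C : ℝ, ∀ s ∈ Set.Icc 0 t, ‖u s‖ ≤ C := fun u hu =>
    isCompact_Icc.exists_bound_of_continuousOn
      fun s hs => (hu s hs.1).continuousAt.continuousWithinAt
  obtain ⟨r₁, hr₁⟩ := hbound x hx
  obtain ⟨r₂, hr₂⟩ := hbound y hy
  set r := max r₁ r₂
  replace hr₁ : ∀ s, 0 ≤ s → s ≤ t → ‖x s‖ ≤ r :=
    fun s h0 h1 => (hr₁ s ⟨h0, h1⟩).trans (le_max_left _ _)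
  replace hr₂ : ∀ s, 0 ≤ s → s ≤ t → ‖y s‖ ≤ r :=
    fun s h0 h1 => (hr₂ s ⟨h0, h1⟩).trans (le_max_right _ _)
  obtain ⟨L, -, hL⟩ := exists_norm_le_on_closedBall hf.continuous r
  set K : Set E := {z | f z ≤ L}
  have hballK : ∀ z, ‖z‖ ≤ r → z ∈ K := fun z hz => (le_abs_self _).trans (hL z hz)
  obtain ⟨R₀, hR₀⟩ : ∃ R₀ : ℝ, ∀ z ∈ K, ‖z‖ ≤ R₀ := by
    have h1 : ∀ᶠ z in Filter.cocompact E, L < f z := hcoercive.eventually_gt_atTop L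
    obtain ⟨Q, hQ, hQsub⟩ := Filter.mem_cocompact.1 h1
    obtain ⟨R₀, hR₀⟩ := hQ.isBounded.exists_norm_le
    refine ⟨R₀, fun z hz => hR₀ z ?_⟩
    by_contra hzQ
    exact absurd (show f z ≤ L from hz) (not_le.2 (hQsub hzQ))
  set R := R₀ + 1
  have hKR : ∀ z ∈ K, ‖z‖ ≤ R := fun z hz => (hR₀ z hz).trans (by linarith)
  obtain ⟨G, hG0, hG⟩ := exists_norm_le_on_closedBall hg.continuous R
  obtain ⟨Λ, hΛ0, hΛ⟩ := exists_lipschitz_on_closedBall hg R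
  obtain ⟨Cf, hCf0, hCf⟩ := exists_quadratic_remainder_on_closedBall hf R
  obtain ⟨C, hC0, hC⟩ := exists_eulerStep_weighted_contraction hg hW hκ R
  have hlim : Filter.Tendsto (fun N : ℕ => t / (N : ℝ)) Filter.atTop (nhds 0) :=
    tendsto_const_div_atTop_nhds_zero_nat t
  have hsmall : ∀ c ε : ℝ, 0 < ε → ∀ᶠ N : ℕ in Filter.atTop, c * (t / N) ≤ ε := fun c ε hε => by
    have : Filter.Tendsto (fun N : ℕ => c * (t / (N : ℝ))) Filter.atTop (nhds 0) := by
      simpa using hlim.const_mul c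
    exact this.eventually_le_const hε
  have hmain : ∀ᶠ N : ℕ in Filter.atTop,
      ‖x t - y t‖ ≤ Real.exp A * Real.exp (-(κ / 2) * t) * ‖x 0 - y 0‖ +
        2 * (t * (Λ * G * (t / N)) * Real.exp (Λ * t)) := by
    filter_upwards [hsmall G 1 one_pos, hsmall Cf 1 one_pos, hsmall C κ hκ0,
      Filter.eventually_gt_atTop 0] with N hN1 hN2 hN3 hN0
    have hNh : (N : ℝ) * (t / N) = t := by
      have : (N : ℝ) ≠ 0 := by exact_mod_cast hN0.ne'
      field_simp
    set h := t / (N : ℝ)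
    have hh0 : 0 ≤ h := by positivity
    have hPR : ∀ z ∈ K, ‖eulerStep g h z‖ ≤ R := fun z hz => by
      have h1 := norm_sub_le z (h • g z)
      rw [norm_smul, Real.norm_of_nonneg hh0] at h1
      have h2 := mul_le_mul_of_nonneg_left (hG z (hKR z hz)) hh0
      rw [eulerStep]
      linarith [hR₀ z hz]
    have hPK : ∀ z ∈ K, eulerStep g h z ∈ K := fun z hz => by
      have h1 := (abs_le.1 (hCf z _ (hKR z hz) (hPR z hz))).2
      have e : eulerStep g h z - z = -(h • g z) := by rw [eulerStep]; abel
      rw [e, map_neg, map_smul, norm_neg, norm_smul, Real.norm_of_nonneg hh0, smul_eq_mul,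
        hfg] at h1
      have h2 : Cf * h * (h * ‖g z‖ ^ 2) ≤ 1 * (h * ‖g z‖ ^ 2) :=
        mul_le_mul_of_nonneg_right hN2 (by positivity)
      have h3 : f z ≤ L := hz
      change f (eulerStep g h z) ≤ L
      nlinarith
    have hiter : ∀ z ∈ K, ∀ k : ℕ, ‖(eulerStep g h)^[k] z‖ ≤ R := fun z hz k => by
      refine hKR _ ?_
      induction k with
      | zero => exact hz
      | succ k ih => rw [Function.iterate_succ_apply']; exact hPK _ ih
    have hstep : ∀ z ∈ K, ∀ v,
        Real.exp (2 * W (eulerStep g h z)) * ‖v - h • fderiv ℝ g z v‖ ^ 2 ≤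
          Real.exp (2 * W z - 2 * (κ / 2 * h)) * ‖v‖ ^ 2 := fun z hz v => by
      refine (hC h z v hh0 (hKR z hz) (hPR z hz)).trans ?_
      gcongr
      nlinarith
    have hx0 := hr₁ 0 le_rfl ht
    have hy0 := hr₂ 0 le_rfl ht
    choose! D hD hDb using fun z (hz : z ∈ K) => exists_hasFDerivAt_iterate_eulerStep
      (hg.differentiable one_ne_zero) hWA hW0 hPK hstep N hz
    have hdiff := Convex.norm_image_sub_le_of_norm_hasFDerivWithin_le (𝕜 := ℝ)
      (f := (eulerStep g h)^[N]) (f' := D) (s := Metric.closedBall (0 : E) r)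
      (C := Real.exp (A - N * (κ / 2 * h)))
      (fun z hz => (hD z (hballK z (mem_closedBall_zero_iff.1 hz))).hasFDerivWithinAt)
      (fun z hz => hDb z (hballK z (mem_closedBall_zero_iff.1 hz)))
      (convex_closedBall _ _) (mem_closedBall_zero_iff.2 hy0) (mem_closedBall_zero_iff.2 hx0)
    have e1 : Real.exp (A - N * (κ / 2 * h)) = Real.exp A * Real.exp (-(κ / 2) * t) := by
      rw [← Real.exp_add]
      congr 1
      linear_combination (-(κ / 2)) * hNh
    have herr : ∀ u : ℝ → E, (∀ s, 0 ≤ s → HasDerivAt u (-(g (u s))) s) →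
        (∀ s, 0 ≤ s → s ≤ t → ‖u s‖ ≤ r) →
        ‖u t - (eulerStep g h)^[N] (u 0)‖ ≤ t * (Λ * G * h) * Real.exp (Λ * t) := by
      intro u hu hur
      have := norm_sub_iterate_eulerStep_le hu hh0 hNh.le hG0 hΛ0 hG hΛ
        (fun s h0 h1 => hKR _ (hballK _ (hur s h0 h1)))
        (hiter _ (hballK _ (hur 0 le_rfl ht))) N le_rfl
      rw [hNh] at this
      refine this.trans (le_of_eq ?_)
      rw [show (N : ℝ) * (Λ * h) = Λ * t by rw [← hNh]; ring,
        show (N : ℝ) * (Λ * G * h ^ 2) = t * (Λ * G * h) by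
          linear_combination (Λ * G * h) * hNh]
    have hex := herr x hx hr₁
    have hey := herr y hy hr₂
    rw [e1] at hdiff
    have e2 : x t - y t = (x t - (eulerStep g h)^[N] (x 0)) +
        ((eulerStep g h)^[N] (x 0) - (eulerStep g h)^[N] (y 0)) -
        (y t - (eulerStep g h)^[N] (y 0)) := by abel
    rw [e2]
    refine (norm_sub_le _ _).trans ?_
    have := norm_add_le (x t - (eulerStep g h)^[N] (x 0))
      ((eulerStep g h)^[N] (x 0) - (eulerStep g h)^[N] (y 0))
    linarith
  refine ge_of_tendsto ?_ hmain
  have h1 : Filter.Tendsto (fun N : ℕ => t * (Λ * G * (t / (N : ℝ))) * Real.exp (Λ * t))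
      Filter.atTop (nhds 0) := by
    simpa using ((hlim.const_mul (Λ * G)).const_mul t).mul_const (Real.exp (Λ * t))
  simpa using (h1.const_mul 2).const_add
    (Real.exp A * Real.exp (-(κ / 2) * t) * ‖x 0 - y 0‖)

/-- If the quadratic form of `H x` is at least `m > 0` outside a bounded set and positive definite at
the only zero of `φ ≥ 0`, then adding a large multiple of `φ` makes it uniformly positive
definite. -/
lemma exists_add_mul_uniformly_posDef [ProperSpace E] {H : E → E →L[ℝ] E} (hH : Continuous H)
    {φ : E → ℝ} (hφ : Continuous φ) (hφ0 : ∀ z, 0 ≤ φ z) {p : E} (hφp : ∀ z, z ≠ p → 0 < φ z)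
    {ν m : ℝ} (hν : 0 < ν) (hp : ∀ v, ν * ‖v‖ ^ 2 ≤ ⟪H p v, v⟫) (hm : 0 < m)
    (hS : Bornology.IsBounded {z : E | ∃ v, ‖v‖ = 1 ∧ ⟪H z v, v⟫ < m}) :
    ∃ A : ℝ, 0 ≤ A ∧ ∃ κ : ℝ, 0 < κ ∧
      ∀ z v, κ * ‖v‖ ^ 2 ≤ A * φ z * ‖v‖ ^ 2 + ⟪H z v, v⟫ := by
  have hCS : ∀ (T : E →L[ℝ] E) v, -(‖T‖ * ‖v‖ ^ 2) ≤ ⟪T v, v⟫ := fun T v => by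
    have h1 := (abs_le.1 (abs_real_inner_le_norm (T v) v)).1
    have h2 := mul_le_mul_of_nonneg_right (T.le_opNorm v) (norm_nonneg v)
    nlinarith
  obtain ⟨R, hR⟩ := hS.exists_norm_le
  set U : Set E := {z | ‖H z - H p‖ < ν / 2} with hU
  have hUo : IsOpen U := isOpen_lt (hH.sub continuous_const).norm continuous_const
  have hUb : ∀ z ∈ U, ∀ v, ν / 2 * ‖v‖ ^ 2 ≤ ⟪H z v, v⟫ := fun z hz v => by
    have h1 := hCS (H z - H p) v
    rw [sub_apply, inner_sub_left] at h1
    have h2 : ‖H z - H p‖ < ν / 2 := hz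
    nlinarith [hp v, mul_le_mul_of_nonneg_right h2.le (sq_nonneg ‖v‖)]
  have hout : ∀ z, R < ‖z‖ → ∀ v, m * ‖v‖ ^ 2 ≤ ⟪H z v, v⟫ := fun z hz v => by
    rcases eq_or_ne v 0 with rfl | hv
    · simp
    · by_contra! hlt
      refine absurd (hR z ⟨‖v‖⁻¹ • v, norm_smul_inv_norm hv, ?_⟩) (not_le.2 hz)
      have hv' : 0 < ‖v‖ := norm_pos_iff.2 hv
      rw [map_smul, real_inner_smul_left, real_inner_smul_right, ← mul_assoc, ← sq, inv_pow,
        inv_mul_lt_iff₀ (by positivity)]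
      linarith
  have hQ : IsCompact (Metric.closedBall (0 : E) R \ U) :=
    (isCompact_closedBall 0 R).diff hUo
  obtain ⟨ε, hε, hεb⟩ : ∃ ε : ℝ, 0 < ε ∧ ∀ z ∈ Metric.closedBall (0 : E) R \ U, ε ≤ φ z := by
    refine hQ.exists_forall_le' hφ.continuousOn fun z hz => hφp z ?_
    rintro rfl
    exact hz.2 (by simp [hU, hν])
  obtain ⟨B, hB0, hB⟩ := exists_norm_le_on_closedBall hH R
  set κ := min m (ν / 2)
  have hκ0 : 0 < κ := lt_min hm (by positivity)
  refine ⟨(B + κ) / ε, by positivity, κ, hκ0, fun z v => ?_⟩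
  have hv2 := sq_nonneg ‖v‖
  have hA : 0 ≤ (B + κ) / ε * φ z * ‖v‖ ^ 2 := by
    have := hφ0 z
    positivity
  by_cases hzU : z ∈ U
  · have := mul_le_mul_of_nonneg_right (min_le_right m (ν / 2)) hv2
    linarith [hUb z hzU v]
  by_cases hzR : ‖z‖ ≤ R
  · have h1 := hCS (H z) v
    have h2 := mul_le_mul_of_nonneg_right (hB z hzR) hv2
    have h3 : B + κ ≤ (B + κ) / ε * φ z := by
      rw [div_mul_eq_mul_div, le_div_iff₀ hε]
      exact mul_le_mul_of_nonneg_left (hεb z ⟨mem_closedBall_zero_iff.2 hzR, hzU⟩)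
        (by positivity)
    nlinarith [mul_le_mul_of_nonneg_right h3 hv2]
  · have := mul_le_mul_of_nonneg_right (min_le_left m (ν / 2)) hv2
    linarith [hout z (not_le.1 hzR) v]

end InnerProductSpace

/-- Theorem 2 (global IES for state-bounded concave functions).
Let `f : ℝⁿ → ℝ` be `C²`, coercive, bounded below, with a unique global minimizer `x*` where
`vᵀ ∇²f(x*) v ≥ ν ‖v‖₂²` (`ν > 0`), satisfying a `𝒦∞`-PLI. If moreover `f` is
`m`-state-bounded concave for some `m > 0`, i.e. the set
`S = { x : λ_min(∇²f(x)) < m }` (expressed via the quadratic form on unit vectors) is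
bounded, then the gradient flow `ẋ = -∇f(x)` is globally incrementally exponentially stable;
in particular `x*` is globally exponentially stable. -/
theorem global_ies_state_bounded_concave {n : ℕ}
    (f : EuclideanSpace ℝ (Fin n) → ℝ)
    (hf : ContDiff ℝ 2 f)
    (hcoercive : Filter.Tendsto f (Filter.cocompact (EuclideanSpace ℝ (Fin n))) Filter.atTop)
    (hbdd : BddBelow (Set.range f))
    (xstar : EuclideanSpace ℝ (Fin n))
    (hmin : ∀ x, f xstar ≤ f x)
    (huniq : ∀ x, (∀ y, f x ≤ f y) → x = xstar)
    (ν : ℝ) (hν : 0 < ν)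
    (hconv : ∀ v, ν * ‖v‖ ^ 2 ≤ ⟪fderiv ℝ (gradient f) xstar v, v⟫)
    (a : ℝ → ℝ)
    (ha_cont : ContinuousOn a (Set.Ici 0))
    (ha_mono : StrictMonoOn a (Set.Ici 0))
    (ha_zero : a 0 = 0)
    (ha_nonneg : ∀ r, 0 ≤ r → 0 ≤ a r)
    (ha_top : Filter.Tendsto a Filter.atTop Filter.atTop)
    (hPLI : ∀ x, a (f x - f xstar) ≤ ‖gradient f x‖)
    (m : ℝ) (hm : 0 < m)
    (hSbounded : Bornology.IsBounded
      {x : EuclideanSpace ℝ (Fin n) |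
        ∃ v, ‖v‖ = 1 ∧ ⟪fderiv ℝ (gradient f) x v, v⟫ < m}) :
    ∃ c > (0:ℝ), ∃ κ > (0:ℝ),
      (∀ x y : ℝ → EuclideanSpace ℝ (Fin n),
        (∀ t, 0 ≤ t → HasDerivAt x (-(gradient f (x t))) t) →
        (∀ t, 0 ≤ t → HasDerivAt y (-(gradient f (y t))) t) →
        ∀ t, 0 ≤ t →
          ‖x t - y t‖ ≤ c * Real.exp (-κ * t) * ‖x 0 - y 0‖) ∧
      (∀ x : ℝ → EuclideanSpace ℝ (Fin n),
        (∀ t, 0 ≤ t → HasDerivAt x (-(gradient f (x t))) t) →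
        ∀ t, 0 ≤ t →
          ‖x t - xstar‖ ≤ c * Real.exp (-κ * t) * ‖x 0 - xstar‖) := by
  have hg : ContDiff ℝ 1 (gradient f) :=
    (InnerProductSpace.toDual ℝ (EuclideanSpace ℝ (Fin n))).symm.contDiff.comp
      (hf.fderiv_right (m := 1) (by norm_num))
  have hfg : ∀ z, fderiv ℝ f z (gradient f z) = ‖gradient f z‖ ^ 2 := fun z => by
    rw [← inner_gradient_left, real_inner_self_eq_norm_sq]
  have hg0 : gradient f xstar = 0 := by
    have : IsLocalMin f xstar := Filter.Eventually.of_forall hmin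
    rw [gradient, this.fderiv_eq_zero, map_zero]
  have hgpos : ∀ z, z ≠ xstar → 0 < ‖gradient f z‖ := fun z hz => by
    have hlt : 0 < f z - f xstar := by
      by_contra! hle
      exact hz (huniq z fun y => by linarith [hmin y])
    have := ha_mono Set.self_mem_Ici hlt.le hlt
    rw [ha_zero] at this
    exact this.trans_le (hPLI z)
  obtain ⟨A, hA0, κ, hκ0, hκ⟩ := exists_add_mul_uniformly_posDef
    (hg.continuous_fderiv one_ne_zero)
    (φ := fun z => Real.exp (-(f z - f xstar)) * ‖gradient f z‖ ^ 2)
    (by have := hf.continuous; have := hg.continuous; fun_prop)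
    (fun z => by positivity) (p := xstar)
    (fun z hz => by have := hgpos z hz; positivity) hν hconv hm hSbounded
  set W : EuclideanSpace ℝ (Fin n) → ℝ := fun z => -A * Real.exp (-(f z - f xstar)) with hWdef
  have hW : ContDiff ℝ 2 W := by fun_prop
  have hWd : ∀ z, fderiv ℝ W z (gradient f z)
      = A * (Real.exp (-(f z - f xstar)) * ‖gradient f z‖ ^ 2) := fun z => by
    have hd : HasFDerivAt f (fderiv ℝ f z) z :=
      (hf.differentiable (by norm_num) z).hasFDerivAt
    have : HasFDerivAt W (-A • Real.exp (-(f z - f xstar)) • -fderiv ℝ f z) z :=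
      (((hd.sub_const (f xstar)).neg).exp).const_mul (-A)
    rw [this.fderiv]
    simp only [smul_apply, neg_apply, smul_eq_mul, hfg]
    ring
  have hexp : ∀ z, Real.exp (-(f z - f xstar)) ≤ 1 := fun z =>
    Real.exp_le_one_iff.2 (by linarith [hmin z])
  have hstab : ∀ x y : ℝ → EuclideanSpace ℝ (Fin n),
      (∀ t, 0 ≤ t → HasDerivAt x (-(gradient f (x t))) t) →
      (∀ t, 0 ≤ t → HasDerivAt y (-(gradient f (y t))) t) →
      ∀ t, 0 ≤ t →
        ‖x t - y t‖ ≤ Real.exp A * Real.exp (-(κ / 2) * t) * ‖x 0 - y 0‖ :=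
    fun x y hx hy t ht => norm_sub_le_of_weighted_contraction hg hf hfg hcoercive hW
      (A := A) (fun z => by simp only [hWdef]; nlinarith [hexp z])
      (fun z => by simp only [hWdef]; nlinarith [Real.exp_pos (-(f z - f xstar))]) hκ0
      (fun z v => by rw [hWd]; exact hκ z v) hx hy ht
  refine ⟨Real.exp A, Real.exp_pos A, κ / 2, by positivity, hstab, fun x hx t ht => ?_⟩
  refine hstab x (fun _ => xstar) hx (fun s _ => ?_) t ht
  rw [hg0, neg_zero]
  exact hasDerivAt_const s xstar
end

section
/- Let f : ℝⁿ → ℝ be twice continuously differentiable, bounded below with minimum f*, and satisfying a 𝒦∞-PLI with comparison function α. Let v : ℝ → ℝ be continuous and non-decreasing, continuously differentiable on (v∘f)⁻¹((a−ε, b+ε)) for given a < b and ε > 0, and set X := (v∘f)⁻¹((a,b)). Suppose the metric M(x) = e^{2 v(f(x))} I satisfies the contraction inequality M(x)(−∇²f(x)) + (−∇²f(x))M(x) + Ṁ(x) ⪯ −2β M(x) for all x ∈ X, for some β > 0, where Ṁ(x) := DM(x)[−∇f(x)]. Suppose additionally that λ_min(∇²f(x)) ≥ ν > 0 for all x in the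 complement of X. Then there exists a metric M̂ ∈ C¹(ℝⁿ, Sⁿ), with M̂(x) positive definite for all x, satisfying M̂(x)(−∇²f(x)) + (−∇²f(x))M̂(x) + Ṁ̂(x) ⪯ −2 min(β, ν) M̂(x) for all x ∈ ℝⁿ. -/
open scoped RealInnerProductSpace

/-- For `δ > 0` there is a `C¹` non-decreasing function with slope one on `[a, b]`
which is constant to the left of `a - δ` and to the right of `b + δ`. -/
lemma exists_contDiff_monotone_truncation {a b δ : ℝ} (hδ : 0 < δ) :
    ∃ G : ℝ → ℝ, ContDiff ℝ 1 G ∧ Monotone G ∧ (∀ t ∈ Set.Icc a b, G t = t - a) ∧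
      (∀ t ≤ a - δ, G t = G (a - δ)) ∧ (∀ t, b + δ ≤ t → G t = G (b + δ)) := by
  obtain ⟨ψ, hψ, hψ0, hψ1, hψl, hψr⟩ : ∃ ψ : ℝ → ℝ, Continuous ψ ∧ (∀ t, 0 ≤ ψ t) ∧
      (∀ t ∈ Set.Icc a b, ψ t = 1) ∧ (∀ t ≤ a - δ, ψ t = 0) ∧ (∀ t, b + δ ≤ t → ψ t = 0) := by
    refine ⟨fun t => max 0 (min 1 (min (1 + (t - a) / δ) (1 + (b - t) / δ))), by fun_prop,
      fun t => le_max_left _ _, ?_, ?_, ?_⟩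
    · rintro t ⟨h₁, h₂⟩
      beta_reduce
      have h₃ : 0 ≤ (t - a) / δ := div_nonneg (by linarith) hδ.le
      have h₄ : 0 ≤ (b - t) / δ := div_nonneg (by linarith) hδ.le
      rw [min_eq_left (le_min (le_add_of_nonneg_right h₃) (le_add_of_nonneg_right h₄)),
        max_eq_right zero_le_one]
    · intro t ht
      have : (t - a) / δ ≤ -1 := by rw [div_le_iff₀ hδ]; linarith
      exact max_eq_left ((min_le_right _ _).trans ((min_le_left _ _).trans (by linarith)))
    · intro t ht
      have : (b - t) / δ ≤ -1 := by rw [div_le_iff₀ hδ]; linarith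
      exact max_eq_left ((min_le_right _ _).trans ((min_le_right _ _).trans (by linarith)))
  have hint (s t : ℝ) : IntervalIntegrable ψ MeasureTheory.volume s t := hψ.intervalIntegrable s t
  have hsub (s t : ℝ) : (∫ u in a..t, ψ u) - ∫ u in a..s, ψ u = ∫ u in s..t, ψ u :=
    intervalIntegral.integral_interval_sub_left (hint a t) (hint a s)
  have hderiv (t : ℝ) : HasDerivAt (fun t => ∫ u in a..t, ψ u) (ψ t) t :=
    intervalIntegral.integral_hasDerivAt_right (hint a t)
      hψ.stronglyMeasurable.stronglyMeasurableAtFilter hψ.continuousAt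
  refine ⟨fun t => ∫ u in a..t, ψ u, ?_, ?_, ?_, ?_, ?_⟩
  · rw [contDiff_one_iff_deriv]
    refine ⟨fun t => (hderiv t).differentiableAt, ?_⟩
    rwa [show deriv (fun t => ∫ u in a..t, ψ u) = ψ from funext fun t => (hderiv t).deriv]
  · exact monotone_of_hasDerivAt_nonneg hderiv hψ0
  · rintro t ⟨h₁, h₂⟩
    have : ∫ u in a..t, ψ u = ∫ _ in a..t, (1 : ℝ) := by
      refine intervalIntegral.integral_congr fun u hu => ?_
      rw [Set.uIcc_of_le h₁] at hu
      exact hψ1 u ⟨hu.1, hu.2.trans h₂⟩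
    simp [this]
  · intro t ht
    rw [← sub_eq_zero, hsub]
    refine (intervalIntegral.integral_congr (g := fun _ => 0) fun u hu => ?_).trans (by simp)
    rw [Set.uIcc_of_ge ht] at hu
    exact hψl u hu.2
  · intro t ht
    rw [← sub_eq_zero, hsub]
    refine (intervalIntegral.integral_congr (g := fun _ => 0) fun u hu => ?_).trans (by simp)
    rw [Set.uIcc_of_le ht] at hu
    exact hψr u hu.1

/-- A continuous non-decreasing function that is `C¹` where its values lie in `(a - ε, b + ε)`
can be replaced by a `C¹` non-decreasing function that differs from it by a constant where its
values lie in `[a, b]`. -/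
lemma exists_contDiff_monotone_eq_sub {v : ℝ → ℝ} (hv : Continuous v) (hmono : Monotone v)
    {a b ε : ℝ} (hε : 0 < ε)
    (hdiff : ContDiffOn ℝ 1 v (v ⁻¹' Set.Ioo (a - ε) (b + ε))) :
    ∃ φ : ℝ → ℝ, ContDiff ℝ 1 φ ∧ Monotone φ ∧ ∀ s, v s ∈ Set.Icc a b → φ s = v s - a := by
  obtain ⟨G, hG, hGmono, hGid, hGl, hGr⟩ :=
    exists_contDiff_monotone_truncation (half_pos hε)
  refine ⟨G ∘ v, contDiff_iff_contDiffAt.2 fun s => ?_, hGmono.comp hmono, fun s hs => hGid _ hs⟩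
  rcases lt_or_ge (v s) (a - ε / 2) with h₁ | h₁
  · refine (contDiffAt_const (c := G (a - ε / 2))).congr_of_eventuallyEq ?_
    filter_upwards [hv.continuousAt.eventually_lt_const h₁] with t ht using hGl _ ht.le
  rcases lt_or_ge (b + ε / 2) (v s) with h₂ | h₂
  · refine (contDiffAt_const (c := G (b + ε / 2))).congr_of_eventuallyEq ?_
    filter_upwards [hv.continuousAt.eventually_const_lt h₂] with t ht using hGr _ ht.le
  · exact hG.contDiffAt.comp s (hdiff.contDiffAt
      ((isOpen_Ioo.preimage hv).mem_nhds ⟨by linarith, by linarith⟩))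

/-- Lemma (interpolation / patching of contraction metrics).
Let `f : ℝⁿ → ℝ` be `C²`, bounded below with attained minimum `f*`, satisfying a `𝒦∞`-PLI
with comparison function `α`. Let `v : ℝ → ℝ` be continuous, non-decreasing, and `C¹` on
`v⁻¹((a-ε, b+ε))`, set `X := (v ∘ f)⁻¹((a, b))`, and suppose the metric
`M(x) = e^{2 v(f(x))} I` satisfies the contraction inequality with rate `β > 0` on `X`
(stated via quadratic forms, with orbital derivative `Ṁ(x) = DM(x)[-∇f(x)]`). If
`λ_min(∇²f(x)) ≥ ν > 0` on the complement of `X`, then there is a `C¹` Riemannian metric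
`M̂` on `ℝⁿ`, positive definite everywhere, satisfying the contraction inequality with rate
`min β ν` on all of `ℝⁿ`. -/
theorem patching_contraction_metrics {n : ℕ}
    (f : EuclideanSpace ℝ (Fin n) → ℝ)
    (hf : ContDiff ℝ 2 f)
    (fstar : ℝ)
    (hbdd : ∀ x, fstar ≤ f x)
    (hattain : ∃ x, f x = fstar)
    (a : ℝ → ℝ)
    (ha_cont : ContinuousOn a (Set.Ici 0))
    (ha_mono : StrictMonoOn a (Set.Ici 0))
    (ha_zero : a 0 = 0)
    (ha_nonneg : ∀ r, 0 ≤ r → 0 ≤ a r)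
    (ha_top : Filter.Tendsto a Filter.atTop Filter.atTop)
    (hPLI : ∀ x, a (f x - fstar) ≤ ‖gradient f x‖)
    (v : ℝ → ℝ) (hv_cont : Continuous v) (hv_mono : Monotone v)
    (aa bb ε : ℝ) (hab : aa < bb) (hε : 0 < ε)
    (hv_diff : ContDiffOn ℝ 1 v (v ⁻¹' Set.Ioo (aa - ε) (bb + ε)))
    (β : ℝ) (hβ : 0 < β)
    (h_contr_on_X : ∀ x ∈ (fun y => v (f y)) ⁻¹' Set.Ioo aa bb, ∀ w,
      2 * ⟪(Real.exp (2 * v (f x)) •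
              (1 : EuclideanSpace ℝ (Fin n) →L[ℝ] EuclideanSpace ℝ (Fin n)))
            (-(fderiv ℝ (gradient f) x w)), w⟫
        + ⟪(fderiv ℝ (fun y : EuclideanSpace ℝ (Fin n) =>
              Real.exp (2 * v (f y)) •
                (1 : EuclideanSpace ℝ (Fin n) →L[ℝ] EuclideanSpace ℝ (Fin n)))
              x (-(gradient f x))) w, w⟫
        ≤ -2 * β * ⟪(Real.exp (2 * v (f x)) •
              (1 : EuclideanSpace ℝ (Fin n) →L[ℝ] EuclideanSpace ℝ (Fin n))) w, w⟫)
    (ν : ℝ) (hν : 0 < ν)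
    (h_convex_off_X : ∀ x ∉ (fun y => v (f y)) ⁻¹' Set.Ioo aa bb, ∀ w,
      ν * ‖w‖ ^ 2 ≤ ⟪fderiv ℝ (gradient f) x w, w⟫) :
    ∃ M : EuclideanSpace ℝ (Fin n) →
        (EuclideanSpace ℝ (Fin n) →L[ℝ] EuclideanSpace ℝ (Fin n)),
      ContDiff ℝ 1 M ∧
      (∀ x w₁ w₂, ⟪M x w₁, w₂⟫ = ⟪w₁, M x w₂⟫) ∧
      (∀ x w, w ≠ 0 → 0 < ⟪M x w, w⟫) ∧
      (∀ x w,
        2 * ⟪M x (-(fderiv ℝ (gradient f) x w)), w⟫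
            + ⟪fderiv ℝ M x (-(gradient f x)) w, w⟫
          ≤ -2 * min β ν * ⟪M x w, w⟫) := by
  obtain ⟨φ, hφ, hφmono, hφv⟩ :=
    exists_contDiff_monotone_eq_sub hv_cont hv_mono hε hv_diff
  have hg : ContDiff ℝ 1 fun y => Real.exp (2 * φ (f y)) :=
    (contDiff_const.mul (hφ.comp (hf.of_le one_le_two))).exp
  refine ⟨fun y => Real.exp (2 * φ (f y)) •
    (1 : EuclideanSpace ℝ (Fin n) →L[ℝ] EuclideanSpace ℝ (Fin n)),
    hg.smul contDiff_const, ?_, ?_, ?_⟩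
  · intro x w₁ w₂
    simp [inner_smul_left, inner_smul_right]
  · intro x w hw
    simpa [inner_smul_left] using mul_pos (Real.exp_pos (2 * φ (f x))) (by positivity)
  intro x w
  by_cases hx : x ∈ (fun y => v (f y)) ⁻¹' Set.Ioo aa bb
  · have hE : (fun y => Real.exp (2 * φ (f y)) •
          (1 : EuclideanSpace ℝ (Fin n) →L[ℝ] EuclideanSpace ℝ (Fin n))) =ᶠ[nhds x]
        Real.exp (-2 * aa) • fun y => Real.exp (2 * v (f y)) •
          (1 : EuclideanSpace ℝ (Fin n) →L[ℝ] EuclideanSpace ℝ (Fin n)) := by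
      filter_upwards [(isOpen_Ioo.preimage (hv_cont.comp hf.continuous)).mem_nhds hx] with y hy
      rw [hφv _ (Set.Ioo_subset_Icc_self hy), Pi.smul_apply, smul_smul, ← Real.exp_add]
      ring_nf
    have hfd := (hE.fderiv_eq (𝕜 := ℝ)).trans
      (congrFun (fderiv_const_smul_field (𝕜 := ℝ) (f := fun y => Real.exp (2 * v (f y)) •
        (1 : EuclideanSpace ℝ (Fin n) →L[ℝ] EuclideanSpace ℝ (Fin n))) (Real.exp (-2 * aa))) x)
    have key := mul_le_mul_of_nonneg_left (h_contr_on_X x hx w) (Real.exp_pos (-2 * aa)).le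
    have hEx := hE.self_of_nhds
    simp only [Pi.smul_apply] at hEx
    beta_reduce
    rw [hfd, hEx]
    have hmin : β * (Real.exp (-2 * aa) * (Real.exp (2 * v (f x)) * ‖w‖ ^ 2)) ≥
        min β ν * (Real.exp (-2 * aa) * (Real.exp (2 * v (f x)) * ‖w‖ ^ 2)) := by
      gcongr
      exact min_le_left _ _
    simp only [Pi.smul_apply, smul_apply, one_apply_eq_self,
      inner_smul_left, real_inner_self_eq_norm_sq, conj_trivial] at key ⊢
    linarith
  · have hd : HasFDerivAt (fun y => Real.exp (2 * φ (f y))) _ x :=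
      (((hφ.differentiable one_ne_zero (f x)).hasDerivAt.comp_hasFDerivAt x
        (hf.differentiable two_ne_zero x).hasFDerivAt).const_mul 2).exp
    have hgrad : fderiv ℝ f x (gradient f x) = ‖gradient f x‖ ^ 2 := by
      rw [← real_inner_self_eq_norm_sq, inner_gradient_left]
    rw [(hd.smul_const (1 : EuclideanSpace ℝ (Fin n) →L[ℝ] EuclideanSpace ℝ (Fin n))).fderiv]
    have hφ' : 0 ≤ deriv φ (f x) := hφmono.deriv_nonneg
    have h₁ : min β ν * ‖w‖ ^ 2 ≤ ⟪fderiv ℝ (gradient f) x w, w⟫ :=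
      le_trans (by gcongr; exact min_le_right _ _) (h_convex_off_X x hx w)
    have h₂ := mul_le_mul_of_nonneg_left h₁ (Real.exp_pos (2 * φ (f x))).le
    have h₃ : 0 ≤ Real.exp (2 * φ (f x)) * (deriv φ (f x) * ‖gradient f x‖ ^ 2) * ‖w‖ ^ 2 := by
      positivity
    simp only [ContinuousLinearMap.smulRight_apply, smul_apply,
      one_apply_eq_self, inner_smul_left, real_inner_self_eq_norm_sq, conj_trivial,
      map_neg, neg_apply, hgrad, inner_neg_left, smul_eq_mul, Function.comp_apply] at h₂ h₃ ⊢
    linarith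
end

section
/- Let g : ℝⁿ → ℝⁿ be continuously differentiable with g(x*) = 0, and let ‖·‖ be a norm on ℝⁿ with induced logarithmic norm μ. Suppose there exist ν > 0 and ε > 0 such that μ(∇g(x)) ≤ −ν for all x in the open ball B_ε(x*) = { x : ‖x − x*‖ < ε }. Then B_ε(x*) is forward invariant for the ODE ẋ = g(x): every solution starting in B_ε(x*) remains in B_ε(x*) for all t ≥ 0. -/
open scoped RealInnerProductSpace

namespace Seminorm

/-- A seminorm on a finite-dimensional real normed space is continuous. -/
theorem continuous_of_finiteDimensional {E : Type*} [NormedAddCommGroup E] [NormedSpace ℝ E]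
    [FiniteDimensional ℝ E] (p : Seminorm ℝ E) : Continuous p :=
  p.convexOn.locallyLipschitz.continuous

/-- Hahn–Banach for seminorms: a point admits a linear functional dominated by the seminorm and
attaining it at that point. -/
theorem exists_linearMap_le_apply_eq {E : Type*} [AddCommGroup E] [Module ℝ E]
    (p : Seminorm ℝ E) (e : E) : ∃ f : E →ₗ[ℝ] ℝ, f e = p e ∧ ∀ x, f x ≤ p x := by
  rcases eq_or_ne e 0 with rfl | he
  · exact ⟨0, by simp, fun x => by simp⟩
  obtain ⟨f, hf, hle⟩ := exists_extension_of_le_sublinear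
    (LinearPMap.mkSpanSingleton e (p e) he : E →ₗ.[ℝ] ℝ) p
    (fun c hc x => by simp [map_smul_eq_mul, abs_of_pos hc]) (map_add_le_add p) (by
      rintro ⟨x, hx⟩
      obtain ⟨c, rfl⟩ := Submodule.mem_span_singleton.1 hx
      rw [LinearPMap.mkSpanSingleton'_apply]
      simpa [map_smul_eq_mul] using
        mul_le_mul_of_nonneg_right (le_abs_self c) (apply_nonneg p e))
  refine ⟨f, ?_, hle⟩
  rw [← LinearPMap.mkSpanSingleton_apply ℝ ℝ he (p e)]
  exact hf ⟨e, Submodule.mem_span_singleton_self e⟩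

end Seminorm

theorem apply_le_inducedOpNorm_mul {n : ℕ} (p : Seminorm ℝ (EuclideanSpace ℝ (Fin n)))
    (A : EuclideanSpace ℝ (Fin n) →L[ℝ] EuclideanSpace ℝ (Fin n))
    (hA : BddAbove ((fun v => p (A v)) '' {v | p v = 1}))
    {e : EuclideanSpace ℝ (Fin n)} (he : 0 < p e) : p (A e) ≤ inducedOpNorm p A * p e := by
  have h : p (A ((p e)⁻¹ • e)) ≤ inducedOpNorm p A :=
    le_csSup hA ⟨(p e)⁻¹ • e, by simp [map_smul_eq_mul, abs_of_pos he, he.ne'], rfl⟩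
  rw [map_smul, map_smul_eq_mul, Real.norm_eq_abs, abs_of_pos (inv_pos.2 he)] at h
  rwa [inv_mul_le_iff₀ he, mul_comm] at h

/-- A functional norming `e` sees `A e` with rate at most the logarithmic norm of `A`. -/
theorem norming_apply_le_logNorm_mul {n : ℕ} (p : Seminorm ℝ (EuclideanSpace ℝ (Fin n)))
    (A : EuclideanSpace ℝ (Fin n) →L[ℝ] EuclideanSpace ℝ (Fin n)) {L : ℝ}
    (hL : Filter.Tendsto (fun h : ℝ => (inducedOpNorm p (1 + h • A) - 1) / h)
      (nhdsWithin 0 (Set.Ioi 0)) (nhds L))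
    {e : EuclideanSpace ℝ (Fin n)} (he : 0 < p e) (f : EuclideanSpace ℝ (Fin n) →ₗ[ℝ] ℝ)
    (hfe : f e = p e) (hf : ∀ x, f x ≤ p x) : f (A e) ≤ L * p e := by
  refine ge_of_tendsto (hL.mul_const (p e)) ?_
  have hinv : ∀ᶠ h : ℝ in nhdsWithin 0 (Set.Ioi 0), 1 - L < h⁻¹ :=
    tendsto_inv_nhdsGT_zero.eventually_gt_atTop _
  filter_upwards [hL.eventually_const_lt (sub_one_lt L), hinv, self_mem_nhdsWithin]
    with h hlt hh (hpos : 0 < h)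
  -- An unbounded image would make the quotient equal to `-1 / h`.
  have hbdd : BddAbove ((fun v => p ((1 + h • A) v)) '' {v | p v = 1}) := by
    by_contra hb
    rw [inducedOpNorm, Real.sSup_of_not_bddAbove hb, zero_sub, neg_div, one_div] at hlt
    linarith
  have h1 := (hf _).trans (apply_le_inducedOpNorm_mul p (1 + h • A) hbdd he)
  have h2 : f ((1 + h • A) e) = p e + h * f (A e) := by simp [hfe]
  rw [div_mul_eq_mul_div, le_div_iff₀ hpos]
  linarith

/-- Integrated form of the contraction estimate along the segment from an equilibrium. -/
theorem norming_apply_vectorField_le {n : ℕ} (p : Seminorm ℝ (EuclideanSpace ℝ (Fin n)))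
    {g : EuclideanSpace ℝ (Fin n) → EuclideanSpace ℝ (Fin n)} (hg : Differentiable ℝ g)
    {a e : EuclideanSpace ℝ (Fin n)} (ha : g a = 0) {ν ε : ℝ}
    (hcontr : ∀ x, p (x - a) < ε → ∃ L, L ≤ -ν ∧
      Filter.Tendsto (fun h : ℝ => (inducedOpNorm p (1 + h • fderiv ℝ g x) - 1) / h)
        (nhdsWithin 0 (Set.Ioi 0)) (nhds L))
    (he : 0 < p e) (heε : p e < ε) (f : EuclideanSpace ℝ (Fin n) →ₗ[ℝ] ℝ)
    (hfe : f e = p e) (hf : ∀ x, f x ≤ p x) : f (g (a + e)) ≤ -ν * p e := by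
  have hline : ∀ s : ℝ, HasDerivAt (fun s : ℝ => f (g (a + s • e)))
      (f (fderiv ℝ g (a + s • e) e)) s := fun s => by
    have h1 : HasDerivAt (fun s : ℝ => a + s • e) e s := by
      simpa using ((hasDerivAt_id s).smul_const e).const_add a
    exact f.toContinuousLinearMap.hasFDerivAt.comp_hasDerivAt s
      ((hg _).hasFDerivAt.comp_hasDerivAt s h1)
  obtain ⟨s, ⟨hs0, hs1⟩, hs⟩ := exists_hasDerivAt_eq_slope _ _ zero_lt_one
    (fun s _ => (hline s).continuousAt.continuousWithinAt) (fun s _ => hline s)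
  obtain ⟨L, hLν, hL⟩ := hcontr (a + s • e) (by
    rw [add_sub_cancel_left, map_smul_eq_mul, Real.norm_eq_abs, abs_of_pos hs0]
    nlinarith)
  have hle := norming_apply_le_logNorm_mul p _ hL he f hfe hf
  simp only [one_smul, zero_smul, add_zero, ha, map_zero, sub_zero, div_one] at hs
  rw [← hs]
  exact hle.trans (mul_le_mul_of_nonneg_right hLν he.le)

/-- Lemma (forward invariance of a contracting ball).
Let `g : ℝⁿ → ℝⁿ` be `C¹` with `g(x*) = 0`, and `‖·‖` a norm on `ℝⁿ` with induced
logarithmic norm `μ(A) = lim_{h→0⁺} (‖I + hA‖ - 1)/h`. If `μ(∇g(x)) ≤ -ν < 0` for all `x`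
in the ball `B_ε(x*) = {x : ‖x - x*‖ < ε}`, then `B_ε(x*)` is forward invariant for
`ẋ = g(x)`. -/
theorem forward_invariance_of_contracting_ball {n : ℕ}
    (g : EuclideanSpace ℝ (Fin n) → EuclideanSpace ℝ (Fin n))
    (hg : ContDiff ℝ 1 g)
    (xstar : EuclideanSpace ℝ (Fin n)) (heq : g xstar = 0)
    (N : EuclideanSpace ℝ (Fin n) → ℝ)
    (hN_def : ∀ x, N x = 0 ↔ x = 0)
    (hN_smul : ∀ (c : ℝ) (x : EuclideanSpace ℝ (Fin n)), N (c • x) = |c| * N x)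
    (hN_add : ∀ x y, N (x + y) ≤ N x + N y)
    (ν ε : ℝ) (hν : 0 < ν) (hε : 0 < ε)
    (h_contr : ∀ x : EuclideanSpace ℝ (Fin n), N (x - xstar) < ε →
      ∃ L, L ≤ -ν ∧
        Filter.Tendsto
          (fun h : ℝ => (inducedOpNorm N (1 + h • fderiv ℝ g x) - 1) / h)
          (nhdsWithin 0 (Set.Ioi 0)) (nhds L)) :
    ∀ x : ℝ → EuclideanSpace ℝ (Fin n),
      (∀ t, 0 ≤ t → HasDerivAt x (g (x t)) t) →
      N (x 0 - xstar) < ε →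
      ∀ t, 0 ≤ t → N (x t - xstar) < ε := by
  intro x hx hx0 T hT
  let p : Seminorm ℝ (EuclideanSpace ℝ (Fin n)) := Seminorm.of N hN_add hN_smul
  change p (x 0 - xstar) < ε at hx0
  change p (x T - xstar) < ε
  by_contra! hTε
  obtain ⟨c, hc0, hcε⟩ := exists_between hx0
  have hcpos : 0 < c := (apply_nonneg p _).trans_lt hc0
  have hcont : ContinuousOn (fun t => p (x t - xstar)) (Set.Icc 0 T) := fun t ht =>
    (p.continuous_of_finiteDimensional.continuousAt.comp
      ((hx t ht.1).continuousAt.sub continuousAt_const)).continuousWithinAt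
  -- `τ` is the first time at which the distance to the equilibrium reaches `c`.
  obtain ⟨τ, ⟨⟨hτ0, hτT⟩, hcτ⟩, hmin⟩ :=
    (isCompact_Icc.of_isClosed_subset
      (hcont.preimage_isClosed_of_isClosed isClosed_Icc (isClosed_Ici (a := c)))
      Set.inter_subset_left).exists_isLeast ⟨T, ⟨hT, le_rfl⟩, hcε.le.trans hTε⟩
  change c ≤ p (x τ - xstar) at hcτ
  have hτpos : 0 < τ := hτ0.lt_of_ne (by rintro rfl; exact hc0.not_ge hcτ)
  have hbefore : ∀ᶠ s in nhdsWithin τ (Set.Iio τ), p (x s - xstar) < c := by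
    filter_upwards [Ioo_mem_nhdsLT hτpos] with s hs
    by_contra! hcs
    exact hs.2.not_ge (hmin ⟨⟨hs.1.le, hs.2.le.trans hτT⟩, hcs⟩)
  have hτc : p (x τ - xstar) ≤ c :=
    le_of_tendsto ((p.continuous_of_finiteDimensional.continuousAt.comp
      ((hx τ hτ0).continuousAt.sub continuousAt_const)).tendsto.mono_left nhdsWithin_le_nhds)
      (hbefore.mono fun _ h => h.le)
  obtain ⟨f, hfe, hf⟩ := p.exists_linearMap_le_apply_eq (x τ - xstar)
  have hneg := norming_apply_vectorField_le p (hg.differentiable one_ne_zero) heq h_contr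
    (hcpos.trans_le hcτ) (hτc.trans_lt hcε) f hfe hf
  rw [add_sub_cancel] at hneg
  have hderiv : HasDerivAt (fun t => f (x t - xstar)) (f (g (x τ))) τ :=
    f.toContinuousLinearMap.hasFDerivAt.comp_hasDerivAt τ ((hx τ hτ0).sub_const xstar)
  have hnonneg : 0 ≤ f (g (x τ)) := by
    have hslope := hderiv.tendsto_slope.mono_left
      (nhdsWithin_mono τ fun s (hs : s ∈ Set.Iio τ) => ne_of_lt hs)
    refine ge_of_tendsto (x := nhdsWithin τ (Set.Iio τ)) hslope ?_
    filter_upwards [hbefore, self_mem_nhdsWithin] with s hs (hsτ : s < τ)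
    rw [slope_def_field]
    refine div_nonneg_of_nonpos ?_ (by linarith)
    linarith [hf (x s - xstar)]
  nlinarith
end

section
/- Let g : ℝⁿ → ℝⁿ be continuously differentiable and suppose the ODE ẋ = g(x) has a unique globally asymptotically stable equilibrium x*. Let ‖·‖ be a norm on ℝⁿ with induced logarithmic norm μ, let K ⊂ ℝⁿ be compact with x* ∉ K, and suppose μ(∇g(x)) ≤ −ν < 0 for all x ∈ ℝⁿ \ K. Then the ODE is incrementally exponentially stable on ℝⁿ: there exists c > 0 such that any two solutions x(·), y(·) satisfy ‖x(t) − y(t)‖ ≤ c e^{−ν t} ‖x(0) − y(0)‖ for all t ≥ 0. -/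
open scoped RealInnerProductSpace

section NormLike

open Set Filter Topology Metric
open scoped NNReal

variable {E : Type*} [NormedAddCommGroup E] [NormedSpace ℝ E]

/-- `N` satisfies the norm axioms on the real vector space `E`. -/
structure IsVecNorm (N : E → ℝ) : Prop where
  eq_zero : ∀ x, N x = 0 ↔ x = 0
  smul : ∀ (c : ℝ) (x : E), N (c • x) = |c| * N x
  add : ∀ x y, N (x + y) ≤ N x + N y

namespace IsVecNorm

variable {N : E → ℝ}

theorem zero (hN : IsVecNorm N) : N 0 = 0 := (hN.eq_zero 0).2 rfl

theorem neg (hN : IsVecNorm N) (x : E) : N (-x) = N x := by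
  simpa using hN.smul (-1) x

theorem sub_comm (hN : IsVecNorm N) (x y : E) : N (x - y) = N (y - x) := by
  rw [← hN.neg, neg_sub]

theorem nonneg (hN : IsVecNorm N) (x : E) : 0 ≤ N x := by
  have h := hN.add x (-x)
  rw [add_neg_cancel, hN.zero, hN.neg] at h
  linarith

theorem sub_le (hN : IsVecNorm N) (x y z : E) : N (x - z) ≤ N (x - y) + N (y - z) := by
  simpa using hN.add (x - y) (y - z)

theorem convexOn (hN : IsVecNorm N) : ConvexOn ℝ univ N := by
  refine ⟨convex_univ, fun x _ y _ a b ha hb _ => (hN.add _ _).trans ?_⟩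
  rw [hN.smul, hN.smul, abs_of_nonneg ha, abs_of_nonneg hb]
  rfl

variable [FiniteDimensional ℝ E]

theorem continuous (hN : IsVecNorm N) : Continuous N :=
  continuousOn_univ.1 (hN.convexOn.continuousOn isOpen_univ)

theorem exists_bounds (hN : IsVecNorm N) :
    ∃ c > 0, ∃ C > 0, ∀ x, c * ‖x‖ ≤ N x ∧ N x ≤ C * ‖x‖ := by
  have hS : IsCompact (sphere (0 : E) 1) := isCompact_sphere 0 1
  have key : ∃ c > 0, ∃ C > 0, ∀ u ∈ sphere (0 : E) 1, c ≤ N u ∧ N u ≤ C := by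
    rcases (sphere (0 : E) 1).eq_empty_or_nonempty with h | h
    · exact ⟨1, one_pos, 1, one_pos, fun u hu => by simp [h] at hu⟩
    · obtain ⟨p, hp, hpm⟩ := hS.exists_isMinOn h hN.continuous.continuousOn
      obtain ⟨q, hq, hqm⟩ := hS.exists_isMaxOn h hN.continuous.continuousOn
      have pos : ∀ u ∈ sphere (0 : E) 1, 0 < N u := fun u hu =>
        (hN.nonneg u).lt_of_ne' fun h0 => by
          rw [(hN.eq_zero u).1 h0] at hu
          simp at hu
      exact ⟨N p, pos p hp, N q, pos q hq, fun u hu => ⟨hpm hu, hqm hu⟩⟩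
  obtain ⟨c, hc, C, hC, h⟩ := key
  refine ⟨c, hc, C, hC, fun x => ?_⟩
  rcases eq_or_ne x 0 with rfl | hx
  · simp [hN.zero]
  have hx' : 0 < ‖x‖ := norm_pos_iff.2 hx
  have hu : ‖x‖⁻¹ • x ∈ sphere (0 : E) 1 := by
    simp [norm_smul, hx'.ne']
  have hxe : N x = ‖x‖ * N (‖x‖⁻¹ • x) := by
    rw [hN.smul, abs_of_pos (inv_pos.2 hx')]
    field_simp
  obtain ⟨h1, h2⟩ := h _ hu
  rw [hxe]
  constructor <;> nlinarith

/-- Every vector has a supporting functional (Hahn–Banach). -/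
theorem exists_support (hN : IsVecNorm N) (v : E) :
    ∃ l : E →L[ℝ] ℝ, (∀ w, l w ≤ N w) ∧ l v = N v := by
  have H : ∀ c : ℝ, c • v = 0 → (RingHom.id ℝ) c • N v = 0 := by
    intro c hc
    have h := hN.smul c v
    rw [hc, hN.zero] at h
    rcases mul_eq_zero.1 h.symm with h | h
    · simp [abs_eq_zero.1 h]
    · simp [h]
  obtain ⟨l, hl, hlN⟩ := exists_extension_of_le_sublinear
    (LinearPMap.mkSpanSingleton' v (N v) H) N
    (fun c hc x => by rw [hN.smul, abs_of_pos hc]) hN.add (by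
      rintro ⟨w, hw⟩
      obtain ⟨c, rfl⟩ := Submodule.mem_span_singleton.1 hw
      rw [LinearPMap.mkSpanSingleton'_apply]
      simp only [RingHom.id_apply, smul_eq_mul, hN.smul]
      exact mul_le_mul_of_nonneg_right (le_abs_self c) (hN.nonneg v))
  refine ⟨LinearMap.toContinuousLinearMap l, hlN, ?_⟩
  have hv := hl ⟨v, Submodule.mem_span_singleton_self v⟩
  exact hv.trans (LinearPMap.mkSpanSingleton'_apply_self _ _ _ _)

end IsVecNorm

/-- The bound `μ(A) ≤ lam` on the logarithmic norm, expressed by supporting functionals. -/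
def LogNormLE (N : E → ℝ) (A : E →L[ℝ] E) (lam : ℝ) : Prop :=
  ∀ l : E →L[ℝ] ℝ, (∀ w, l w ≤ N w) → ∀ v, l v = N v → l (A v) ≤ lam * N v

/-- A curve passing through `v` with velocity `w` has `N` growing at rate at most `lam`. -/
def OneSidedLE (N : E → ℝ) (lam : ℝ) (v w : E) : Prop :=
  ∀ l : E →L[ℝ] ℝ, (∀ u, l u ≤ N u) → l v = N v → l w ≤ lam * N v

variable {N : E → ℝ} {g : E → E}

theorem LogNormLE.mono (hN : IsVecNorm N) {A : E →L[ℝ] E} {a b : ℝ} (h : LogNormLE N A a)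
    (hab : a ≤ b) : LogNormLE N A b := fun l hl v hv =>
  (h l hl v hv).trans (mul_le_mul_of_nonneg_right hab (hN.nonneg v))

theorem oneSidedLE_of_segment (hg : Differentiable ℝ g) {lam : ℝ} {x y : E}
    (h : ∀ z ∈ segment ℝ x y, LogNormLE N (fderiv ℝ g z) lam) :
    OneSidedLE N lam (x - y) (g x - g y) := by
  intro l hl hv
  obtain ⟨z, hz, he⟩ := domain_mvt (f := fun z => l (g z)) (s := univ) (x := y) (y := x)
    (f' := fun z => l.comp (fderiv ℝ g z))
    (fun z _ => (l.hasFDerivAt.comp z (hg z).hasFDerivAt).hasFDerivWithinAt)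
    convex_univ (mem_univ _) (mem_univ _)
  rw [map_sub, he]
  exact h z (segment_symm ℝ y x ▸ hz) l hl _ hv

section Comparison

variable [FiniteDimensional ℝ E]

theorem IsVecNorm.weighted_le_of_lt (hN : IsVecNorm N) {v v' : ℝ → E} {lam lam' a b : ℝ}
    (hab : a ≤ b) (hlam : lam < lam')
    (hv : ∀ t ∈ Icc a b, HasDerivAt v (v' t) t)
    (h : ∀ t ∈ Ioc a b, OneSidedLE N lam (v t) (v' t)) :
    Real.exp (-lam' * b) * N (v b) ≤ Real.exp (-lam' * a) * N (v a) := by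
  set w : ℝ → ℝ := fun t => Real.exp (-lam' * t) * N (v t) with hw
  have hcont : ContinuousOn w (Icc a b) := by
    refine ContinuousOn.mul (by fun_prop) (hN.continuous.comp_continuousOn ?_)
    exact fun t ht => (hv t ht).continuousAt.continuousWithinAt
  obtain ⟨s, hs, hmax⟩ := isCompact_Icc.exists_isMaxOn (nonempty_Icc.2 hab) hcont
  have hb : w b ≤ w s := hmax (right_mem_Icc.2 hab)
  rcases hs.1.eq_or_lt with rfl | has
  · exact hb
  by_cases h0 : N (v s) = 0
  · have : w s = 0 := by simp [hw, h0]
    exact (hb.trans this.le).trans (mul_nonneg (Real.exp_pos _).le (hN.nonneg _))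
  exfalso
  obtain ⟨l, hl, hls⟩ := hN.exists_support (v s)
  have hpos : 0 < N (v s) := (hN.nonneg _).lt_of_ne' h0
  have hle := h s ⟨has, hs.2⟩ l hl hls
  have hder : HasDerivAt (fun t => Real.exp (-lam' * t) * l (v t))
      (Real.exp (-lam' * s) * (-lam') * l (v s) + Real.exp (-lam' * s) * l (v' s)) s := by
    have h1 : HasDerivAt (fun t => Real.exp (-lam' * t)) (Real.exp (-lam' * s) * (-lam')) s := by
      simpa using ((hasDerivAt_id s).const_mul (-lam')).exp
    exact h1.mul (l.hasFDerivAt.comp_hasDerivAt s (hv s hs))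
  have hloc : IsLocalMaxOn (fun t => Real.exp (-lam' * t) * l (v t)) (Icc a s) s := by
    refine IsMaxOn.localize fun t ht => ?_
    have h1 : w t ≤ w s := hmax ⟨ht.1, ht.2.trans hs.2⟩
    simp only [mem_ofPred_eq, hls]
    exact (mul_le_mul_of_nonneg_left (hl _) (Real.exp_pos _).le).trans h1
  have hcone : a - s ∈ posTangentConeAt (Icc a s) s :=
    sub_mem_posTangentConeAt_of_segment_subset (by
      rw [segment_symm, segment_eq_Icc has.le])
  have := hloc.hasFDerivWithinAt_nonpos hder.hasFDerivAt.hasFDerivWithinAt hcone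
  simp only [ContinuousLinearMap.toSpanSingleton_apply, smul_eq_mul, hls] at this
  have hneg : Real.exp (-lam' * s) * (-lam') * N (v s) + Real.exp (-lam' * s) * l (v' s) < 0 := by
    have : -lam' * N (v s) + l (v' s) < 0 := by nlinarith
    nlinarith [Real.exp_pos (-lam' * s)]
  nlinarith

theorem IsVecNorm.le_exp_mul (hN : IsVecNorm N) {v v' : ℝ → E} {lam a b : ℝ}
    (hab : a ≤ b) (hv : ∀ t ∈ Icc a b, HasDerivAt v (v' t) t)
    (h : ∀ t ∈ Ioo a b, OneSidedLE N lam (v t) (v' t)) :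
    N (v b) ≤ Real.exp (lam * (b - a)) * N (v a) := by
  have weighted : ∀ t ∈ Ico a b,
      Real.exp (-lam * t) * N (v t) ≤ Real.exp (-lam * a) * N (v a) := by
    intro t ht
    have hl : ∀ᶠ m in 𝓝[>] lam,
        Real.exp (-m * t) * N (v t) ≤ Real.exp (-m * a) * N (v a) := by
      filter_upwards [self_mem_nhdsWithin] with m hm
      exact hN.weighted_le_of_lt ht.1 hm (fun s hs => hv s ⟨hs.1, hs.2.trans ht.2.le⟩)
        fun s hs => h s ⟨hs.1, hs.2.trans_lt ht.2⟩
    have hc : ∀ s r : ℝ, Tendsto (fun m : ℝ => Real.exp (-m * s) * r) (𝓝[>] lam)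
        (𝓝 (Real.exp (-lam * s) * r)) := fun s r =>
      ((by fun_prop : Continuous fun m : ℝ => Real.exp (-m * s) * r).tendsto lam).mono_left
        nhdsWithin_le_nhds
    exact le_of_tendsto_of_tendsto (hc _ _) (hc _ _) hl
  have hb : Real.exp (-lam * b) * N (v b) ≤ Real.exp (-lam * a) * N (v a) := by
    rcases hab.eq_or_lt with rfl | hlt
    · exact le_rfl
    have hmem : b ∈ closure (Ico a b) := by
      rw [closure_Ico hlt.ne]
      exact right_mem_Icc.2 hab
    refine ContinuousWithinAt.closure_le hmem ?_ continuousWithinAt_const weighted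
    refine ContinuousAt.continuousWithinAt (ContinuousAt.mul (by fun_prop) ?_)
    exact hN.continuous.continuousAt.comp (hv b (right_mem_Icc.2 hab)).continuousAt
  calc N (v b) = Real.exp (lam * b) * (Real.exp (-lam * b) * N (v b)) := by
        rw [← mul_assoc, ← Real.exp_add]
        simp
    _ ≤ Real.exp (lam * b) * (Real.exp (-lam * a) * N (v a)) := by gcongr
    _ = Real.exp (lam * (b - a)) * N (v a) := by
        rw [← mul_assoc, ← Real.exp_add]
        ring_nf

end Comparison

/-- A forward solution of `ẋ = g(x)` on `[0, ∞)`. -/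
def IsForwardSol (g : E → E) (x : ℝ → E) : Prop :=
  ∀ t, 0 ≤ t → HasDerivAt x (g (x t)) t

theorem IsForwardSol.shift {x : ℝ → E} (hx : IsForwardSol g x) {a : ℝ} (ha : 0 ≤ a) :
    IsForwardSol g fun s => x (a + s) := fun t ht => by
  simpa using! (hx (a + t) (by linarith)).comp_const_add a t

section Flow

variable [FiniteDimensional ℝ E]

theorem IsVecNorm.exists_logNormLE_of_isCompact (hN : IsVecNorm N) (hg : ContDiff ℝ 1 g)
    {K : Set E} (hK : IsCompact K) :
    ∃ M, 0 ≤ M ∧ ∀ z ∈ K, LogNormLE N (fderiv ℝ g z) M := by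
  obtain ⟨c, hc, C, hC, hcC⟩ := hN.exists_bounds
  obtain ⟨B, hB⟩ := hK.exists_bound_of_continuousOn
    (hg.continuous_fderiv one_ne_zero).continuousOn
  refine ⟨C * max B 0 / c, by positivity, fun z hz l hl v _ => ?_⟩
  have h1 : l (fderiv ℝ g z v) ≤ C * ‖fderiv ℝ g z v‖ := (hl _).trans (hcC _).2
  have h2 : ‖fderiv ℝ g z v‖ ≤ max B 0 * ‖v‖ :=
    ((fderiv ℝ g z).le_opNorm v).trans
      (mul_le_mul_of_nonneg_right ((hB z hz).trans (le_max_left _ _)) (norm_nonneg _))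
  have h3 : ‖v‖ ≤ N v / c := by
    rw [le_div_iff₀ hc, mul_comm]
    exact (hcC v).1
  calc l (fderiv ℝ g z v) ≤ C * (max B 0 * (N v / c)) := by
        refine h1.trans ?_
        gcongr
        exact h2.trans (by gcongr)
    _ = C * max B 0 / c * N v := by ring

theorem IsVecNorm.sol_sub_le (hN : IsVecNorm N) {x y : ℝ → E} {lam a b : ℝ} (hab : a ≤ b)
    (hx : ∀ t ∈ Icc a b, HasDerivAt x (g (x t)) t)
    (hy : ∀ t ∈ Icc a b, HasDerivAt y (g (y t)) t)
    (h : ∀ t ∈ Ioo a b, OneSidedLE N lam (x t - y t) (g (x t) - g (y t))) :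
    N (x b - y b) ≤ Real.exp (lam * (b - a)) * N (x a - y a) :=
  hN.le_exp_mul (v := fun t => x t - y t) hab (fun t ht => (hx t ht).sub (hy t ht)) h

variable {M : ℝ} {p : E}

/-- A `C¹` field with a global one-sided Lipschitz bound and an equilibrium `p` has solutions on
every interval `[0, T)`. -/
theorem IsVecNorm.exists_solution_Ico (hN : IsVecNorm N) (hg : ContDiff ℝ 1 g) (hM : 0 ≤ M)
    (hgM : ∀ x y, OneSidedLE N M (x - y) (g x - g y)) (hp : g p = 0) (x₀ : E) {T : ℝ}
    (hT : 0 < T) :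
    ∃ x : ℝ → E, x 0 = x₀ ∧ ∀ t ∈ Ico 0 T, HasDerivAt x (g (x t)) t := by
  obtain ⟨c, hc, C, hC, hcC⟩ := hN.exists_bounds
  set R : ℝ := Real.exp (M * T) * N (x₀ - p) / c with hR
  have hR0 : 0 ≤ R := by
    have := hN.nonneg (x₀ - p)
    positivity
  let χ : ContDiffBump p := ⟨R + 1, R + 2, by linarith, by linarith⟩
  let G : E → E := fun z => χ z • g z
  have hG : ContDiff ℝ 1 G := χ.contDiff.smul hg
  have hGc : HasCompactSupport G := χ.hasCompactSupport.smul_right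
  obtain ⟨L, hL⟩ := ContDiff.lipschitzWith_of_hasCompactSupport hGc hG one_ne_zero
  obtain ⟨B, hB⟩ := hGc.exists_bound_of_continuous hG.continuous
  have hPL : IsPicardLindelof (fun _ => G) (tmin := -T) (tmax := T)
      ⟨0, by constructor <;> linarith⟩ x₀ (Real.toNNReal B * Real.toNNReal T) 0
      (Real.toNNReal B) L :=
    { lipschitzOnWith := fun _ _ => hL.lipschitzOnWith
      continuousOn := fun _ _ => continuousOn_const
      norm_le := fun _ _ z _ => (hB z).trans (Real.le_coe_toNNReal B)
      mul_max_le := by simp [hT.le] }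
  obtain ⟨x, hx0, hx⟩ := hPL.exists_eq_forall_mem_Icc_hasDerivWithinAt₀
  have hx' : ∀ t ∈ Ico 0 T, HasDerivAt x (G (x t)) t := fun t ht =>
    (hx t ⟨by linarith [ht.1], ht.2.le⟩).hasDerivAt
      (Icc_mem_nhds (by linarith [ht.1]) ht.2)
  refine ⟨x, hx0, fun t ht => ?_⟩
  have hbound : N (x t - p) ≤ Real.exp (M * (t - 0)) * N (x 0 - p) := by
    refine hN.le_exp_mul (v := fun s => x s - p) (v' := fun s => G (x s)) ht.1
      (fun s hs => (hx' s ⟨hs.1, hs.2.trans_lt ht.2⟩).sub_const p) fun s _ l hl hls => ?_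
    have h1 := hgM (x s) p l hl hls
    rw [hp, sub_zero] at h1
    have h2 : 0 ≤ M * N (x s - p) := mul_nonneg hM (hN.nonneg _)
    change l (χ (x s) • g (x s)) ≤ _
    rw [map_smul, smul_eq_mul]
    nlinarith [χ.nonneg (x := x s), χ.le_one (x := x s)]
  have hmem : x t ∈ closedBall p χ.rIn := by
    rw [mem_closedBall, dist_eq_norm]
    have h1 : ‖x t - p‖ ≤ R := by
      rw [hR, le_div_iff₀ hc, mul_comm]
      refine ((hcC _).1.trans hbound).trans ?_
      have hx0' : x 0 = x₀ := hx0
      rw [hx0']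
      refine mul_le_mul_of_nonneg_right (Real.exp_le_exp.2 ?_) (hN.nonneg _)
      nlinarith [ht.2]
    exact h1.trans (by change R ≤ R + 1; linarith)
  have := hx' t ht
  simpa [G, χ.one_of_mem_closedBall hmem] using this

theorem IsVecNorm.exists_isForwardSol (hN : IsVecNorm N) (hg : ContDiff ℝ 1 g) (hM : 0 ≤ M)
    (hgM : ∀ x y, OneSidedLE N M (x - y) (g x - g y)) (hp : g p = 0) (x₀ : E) :
    ∃ x : ℝ → E, x 0 = x₀ ∧ IsForwardSol g x := by
  have hex : ∀ n : ℕ, ∃ x : ℝ → E, x 0 = x₀ ∧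
      ∀ t ∈ Ico (0 : ℝ) (n + 2), HasDerivAt x (g (x t)) t := fun n =>
    hN.exists_solution_Ico hg hM hgM hp x₀ (by positivity)
  choose z hz0 hz using hex
  have agree : ∀ m n : ℕ, ∀ t : ℝ, 0 ≤ t → t < m + 2 → t < n + 2 → z m t = z n t := by
    intro m n t ht hm hn
    have h := hN.sol_sub_le (lam := M) ht
      (fun s hs => hz m s ⟨hs.1, hs.2.trans_lt hm⟩)
      (fun s hs => hz n s ⟨hs.1, hs.2.trans_lt hn⟩) (fun s _ => hgM _ _)
    rw [hz0, hz0, sub_self, hN.zero, mul_zero] at h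
    exact sub_eq_zero.1 ((hN.eq_zero _).1 (le_antisymm h (hN.nonneg _)))
  refine ⟨fun t => z ⌊t⌋₊ t, by simpa using hz0 0, fun t ht => ?_⟩
  have hlt := Nat.lt_floor_add_one t
  refine (hz ⌊t⌋₊ t ⟨ht, by linarith⟩).congr_of_eventuallyEq ?_
  rcases ht.eq_or_lt with rfl | hpos
  · filter_upwards [Iio_mem_nhds (zero_lt_one' ℝ)] with s hs
    have : ⌊s⌋₊ = 0 := Nat.floor_eq_zero.2 hs
    simp [this]
  · filter_upwards [Ioo_mem_nhds hpos hlt] with s hs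
    have := Nat.lt_floor_add_one s
    exact agree _ _ s hs.1.le (by linarith) (by linarith [hs.2])

/-- Trajectories issued from a compact set that misses the globally asymptotically stable
equilibrium `p` leave this set for good after a uniform time. -/
theorem IsVecNorm.exists_uniform_leaving_time (hN : IsVecNorm N) (hg : ContDiff ℝ 1 g)
    (hM : 0 ≤ M) (hgM : ∀ x y, OneSidedLE N M (x - y) (g x - g y)) (hp : g p = 0)
    (hstable : ∀ δ > (0:ℝ), ∃ η > (0:ℝ), ∀ x : ℝ → E, IsForwardSol g x →
      N (x 0 - p) < η → ∀ t, 0 ≤ t → N (x t - p) < δ)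
    (hattract : ∀ x : ℝ → E, IsForwardSol g x → Tendsto x atTop (𝓝 p))
    {K : Set E} (hK : IsCompact K) (hpK : p ∉ K) :
    ∃ T, 0 ≤ T ∧ ∀ x : ℝ → E, IsForwardSol g x → x 0 ∈ K → ∀ t, T ≤ t → x t ∉ K := by
  obtain ⟨c, hc, C, hC, hcC⟩ := hN.exists_bounds
  obtain ⟨r, hr, hrK⟩ := Metric.isOpen_iff.1 hK.isClosed.isOpen_compl p hpK
  obtain ⟨η, hη, hηs⟩ := hstable (c * r) (by positivity)
  have stay : ∀ x : ℝ → E, IsForwardSol g x → N (x 0 - p) < η → ∀ t, 0 ≤ t → x t ∉ K := by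
    intro x hx h0 t ht
    refine hrK ?_
    rw [mem_ball, dist_eq_norm]
    exact lt_of_mul_lt_mul_left ((hcC _).1.trans_lt (hηs x hx h0 t ht)) hc.le
  refine hK.induction_on (p := fun S => ∃ T, 0 ≤ T ∧ ∀ x : ℝ → E, IsForwardSol g x →
    x 0 ∈ S → ∀ t, T ≤ t → x t ∉ K) ⟨0, le_rfl, by simp⟩ ?_ ?_ ?_
  · rintro S S' hS ⟨T, hT, h⟩
    exact ⟨T, hT, fun x hx h0 => h x hx (hS h0)⟩
  · rintro S S' ⟨T, hT, h⟩ ⟨T', hT', h'⟩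
    refine ⟨max T T', hT.trans (le_max_left _ _), fun x hx h0 t ht => ?_⟩
    rcases h0 with h0 | h0
    · exact h x hx h0 t ((le_max_left _ _).trans ht)
    · exact h' x hx h0 t ((le_max_right _ _).trans ht)
  · intro q _
    obtain ⟨y, hy0, hy⟩ := hN.exists_isForwardSol hg hM hgM hp q
    have hlim : Tendsto (fun t => N (y t - p)) atTop (𝓝 0) := by
      have h := (hN.continuous.tendsto _).comp ((hattract y hy).sub_const p)
      rwa [sub_self, hN.zero] at h
    obtain ⟨T, hTη, hT⟩ := ((hlim.eventually_lt_const (half_pos hη)).and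
      (eventually_ge_atTop 0)).exists
    have hnear : ∀ᶠ q' in 𝓝 q, Real.exp (M * (T - 0)) * N (q' - q) < η / 2 := by
      have hcont : Continuous fun q' => Real.exp (M * (T - 0)) * N (q' - q) :=
        continuous_const.mul (hN.continuous.comp (by fun_prop))
      refine (hcont.tendsto q).eventually_lt_const ?_
      rw [sub_self, hN.zero, mul_zero]
      exact half_pos hη
    refine ⟨_, mem_nhdsWithin_of_mem_nhds hnear, T, hT, fun x hx h0 t ht => ?_⟩
    have h1 := hN.sol_sub_le (lam := M) hT (fun s hs => hx s hs.1) (fun s hs => hy s hs.1)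
      (fun s _ => hgM _ _)
    rw [hy0] at h1
    have h2 := hN.sub_le (x T) (y T) p
    have h3 : Real.exp (M * (T - 0)) * N (x 0 - q) < η / 2 := h0
    have := stay _ (hx.shift hT) (by simp only [add_zero]; linarith) (t - T) (by linarith)
    simpa using this

/-- Two solutions that stay uniformly close to each other contract exponentially, up to the
time `T` which the first one may spend in the thickening of `K`. -/
theorem IsVecNorm.sol_sub_le_of_close (hN : IsVecNorm N) (hg : Differentiable ℝ g)
    (hM : 0 ≤ M) (hgM : ∀ x y, OneSidedLE N M (x - y) (g x - g y)) {K : Set E} {ε ν T : ℝ}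
    (hν : 0 < ν) (hcontr : ∀ z ∉ K, LogNormLE N (fderiv ℝ g z) (-ν)) (hT : 0 ≤ T)
    (hleave : ∀ x : ℝ → E, IsForwardSol g x → x 0 ∈ cthickening ε K →
      ∀ t, T ≤ t → x t ∉ cthickening ε K)
    {x y : ℝ → E} (hx : IsForwardSol g x) (hy : IsForwardSol g y) {t : ℝ} (ht : 0 ≤ t)
    (hclose : ∀ s ∈ Icc 0 t, dist (x s) (y s) ≤ ε) :
    N (x t - y t) ≤ Real.exp ((M + ν) * T) * Real.exp (-ν * t) * N (x 0 - y 0) := by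
  have grow : ∀ a b, 0 ≤ a → a ≤ b →
      N (x b - y b) ≤ Real.exp (M * (b - a)) * N (x a - y a) := fun a b ha hab =>
    hN.sol_sub_le hab (fun s hs => hx s (ha.trans hs.1)) (fun s hs => hy s (ha.trans hs.1))
      fun s _ => hgM _ _
  have decay : ∀ a b, 0 ≤ a → a ≤ b → b ≤ t → (∀ s ∈ Ioo a b, x s ∉ cthickening ε K) →
      N (x b - y b) ≤ Real.exp (-ν * (b - a)) * N (x a - y a) := by
    intro a b ha hab hbt hout
    refine hN.sol_sub_le hab (fun s hs => hx s (ha.trans hs.1))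
      (fun s hs => hy s (ha.trans hs.1)) fun s hs => oneSidedLE_of_segment hg fun z hz => ?_
    refine hcontr z fun hzK => hout s hs ?_
    refine mem_cthickening_of_dist_le _ z ε K hzK ?_
    have h1 := segment_subset_closedBall_left (x s) (y s) hz
    rw [mem_closedBall] at h1
    rw [dist_comm]
    exact h1.trans (hclose s ⟨ha.trans hs.1.le, hs.2.le.trans hbt⟩)
  have h0 := hN.nonneg (x 0 - y 0)
  by_cases hit : ∃ s ∈ Icc 0 t, x s ∈ cthickening ε K
  · have hclosed : IsCompact (Icc 0 t ∩ x ⁻¹' cthickening ε K) := by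
      have hc : ContinuousOn x (Icc 0 t) := fun s hs =>
        (hx s hs.1).continuousAt.continuousWithinAt
      exact isCompact_Icc.of_isClosed_subset
        (hc.preimage_isClosed_of_isClosed isClosed_Icc isClosed_cthickening) inter_subset_left
    obtain ⟨a, ⟨ha, haK⟩, hmin⟩ := hclosed.exists_isLeast hit
    have first : N (x a - y a) ≤ Real.exp (-ν * a) * N (x 0 - y 0) := by
      have h := decay 0 a le_rfl ha.1 ha.2 fun s hs hsK =>
        (hmin ⟨⟨hs.1.le, hs.2.le.trans ha.2⟩, hsK⟩).not_gt hs.2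
      rwa [sub_zero] at h
    rcases le_total t (a + T) with hta | hta
    · calc N (x t - y t) ≤ Real.exp (M * (t - a)) * (Real.exp (-ν * a) * N (x 0 - y 0)) :=
            (grow a t ha.1 ha.2).trans (by gcongr)
        _ = Real.exp (M * (t - a) + -ν * a) * N (x 0 - y 0) := by rw [Real.exp_add, mul_assoc]
        _ ≤ Real.exp ((M + ν) * T + -ν * t) * N (x 0 - y 0) := by
            refine mul_le_mul_of_nonneg_right (Real.exp_le_exp.2 ?_) h0
            nlinarith
        _ = _ := by rw [Real.exp_add]
    · have haT : 0 ≤ a + T := add_nonneg ha.1 hT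
      have last := decay (a + T) t haT hta le_rfl fun s hs hsK => by
        have h := hleave _ (hx.shift ha.1) (by simpa using haK) (s - a) (by linarith [hs.1])
        exact h (by simpa using hsK)
      calc N (x t - y t)
          ≤ Real.exp (-ν * (t - (a + T))) * (Real.exp (M * (a + T - a)) *
              (Real.exp (-ν * a) * N (x 0 - y 0))) := by
            refine last.trans ?_
            gcongr
            refine (grow a (a + T) ha.1 (by linarith)).trans ?_
            gcongr
        _ = Real.exp ((M + ν) * T) * Real.exp (-ν * t) * N (x 0 - y 0) := by
            simp only [← mul_assoc, ← Real.exp_add]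
            ring_nf
  · have h := decay 0 t le_rfl ht le_rfl fun s hs hsK => hit ⟨s, ⟨hs.1.le, hs.2.le⟩, hsK⟩
    rw [sub_zero] at h
    refine h.trans (mul_le_mul_of_nonneg_right ?_ h0)
    exact le_mul_of_one_le_left (Real.exp_pos _).le (Real.one_le_exp (by positivity))

/-- A bound between close solutions propagates to arbitrary pairs of solutions, by subdividing
the segment between the initial points. -/
theorem IsVecNorm.sol_sub_le_of_forall_close (hN : IsVecNorm N) (hg : ContDiff ℝ 1 g)
    (hM : 0 ≤ M) (hgM : ∀ x y, OneSidedLE N M (x - y) (g x - g y)) (hp : g p = 0)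
    {ε A t : ℝ} (hε : 0 < ε) (ht : 0 ≤ t)
    (hA : ∀ x y : ℝ → E, IsForwardSol g x → IsForwardSol g y →
      (∀ s ∈ Icc 0 t, dist (x s) (y s) ≤ ε) → N (x t - y t) ≤ A * N (x 0 - y 0))
    {x y : ℝ → E} (hx : IsForwardSol g x) (hy : IsForwardSol g y) :
    N (x t - y t) ≤ A * N (x 0 - y 0) := by
  obtain ⟨c, hc, C, hC, hcC⟩ := hN.exists_bounds
  have grow : ∀ x y : ℝ → E, IsForwardSol g x → IsForwardSol g y → ∀ s, 0 ≤ s →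
      N (x s - y s) ≤ Real.exp (M * s) * N (x 0 - y 0) := by
    intro x y hx hy s hs
    have h := hN.sol_sub_le (lam := M) hs (fun r hr => hx r hr.1) (fun r hr => hy r hr.1)
      fun r _ => hgM _ _
    rwa [sub_zero] at h
  have uniq : ∀ x y : ℝ → E, IsForwardSol g x → IsForwardSol g y → x 0 = y 0 → x t = y t := by
    intro x y hx hy h0
    have h := grow x y hx hy t ht
    rw [h0, sub_self, hN.zero, mul_zero] at h
    exact sub_eq_zero.1 ((hN.eq_zero _).1 (le_antisymm h (hN.nonneg _)))
  choose φ hφ0 hφ using hN.exists_isForwardSol hg hM hgM hp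
  set D := N (x 0 - y 0) with hD
  obtain ⟨k, hk⟩ := exists_nat_gt (Real.exp (M * t) * D / (c * ε))
  have hD0 : 0 ≤ D := hN.nonneg _
  have hk0 : (0 : ℝ) < k := lt_of_le_of_lt (by positivity) hk
  let q : ℕ → E := fun i => x 0 + ((i : ℝ) / k) • (y 0 - x 0)
  have hstep : ∀ i, N (q i - q (i + 1)) = D / k := by
    intro i
    have : q i - q (i + 1) = (1 / (k : ℝ)) • (x 0 - y 0) := by
      simp only [q, Nat.cast_add, Nat.cast_one, add_div, add_smul, smul_sub]
      abel
    rw [this, hN.smul, abs_of_pos (by positivity)]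
    ring
  have hsmall : ∀ i, N (φ (q i) t - φ (q (i + 1)) t) ≤ A * (D / k) := by
    intro i
    have h := hA _ _ (hφ (q i)) (hφ (q (i + 1))) fun s hs => by
      have h1 := grow _ _ (hφ (q i)) (hφ (q (i + 1))) s hs.1
      rw [hφ0, hφ0, hstep] at h1
      rw [dist_eq_norm]
      refine le_of_mul_le_mul_left (((hcC _).1.trans h1).trans ?_) hc
      have h2 : Real.exp (M * s) ≤ Real.exp (M * t) :=
        Real.exp_le_exp.2 (mul_le_mul_of_nonneg_left hs.2 hM)
      calc Real.exp (M * s) * (D / k) ≤ Real.exp (M * t) * (D / k) := by gcongr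
        _ = Real.exp (M * t) * D / k := by ring
        _ ≤ c * ε := by
          rw [div_le_iff₀ hk0]
          rw [div_lt_iff₀ (by positivity)] at hk
          linarith
    rwa [hφ0, hφ0, hstep] at h
  have hsum : ∀ j : ℕ, N (φ (q 0) t - φ (q j) t) ≤ j * (A * (D / k)) := by
    intro j
    induction j with
    | zero => simp [hN.zero]
    | succ j ih =>
      have h := hN.sub_le (φ (q 0) t) (φ (q j) t) (φ (q (j + 1)) t)
      have := hsmall j
      push_cast
      linarith
  have hxt : x t = φ (q 0) t := uniq _ _ hx (hφ _) (by simp [hφ0, q])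
  have hyt : y t = φ (q k) t := uniq _ _ hy (hφ _) (by simp [hφ0, q, hk0.ne'])
  rw [hxt, hyt]
  refine (hsum k).trans_eq ?_
  field_simp

end Flow

end NormLike

/-- The limit defining the logarithmic norm bounds supporting functionals. -/
theorem IsVecNorm.logNormLE_of_tendsto {n : ℕ} {N : EuclideanSpace ℝ (Fin n) → ℝ}
    (hN : IsVecNorm N) {A : EuclideanSpace ℝ (Fin n) →L[ℝ] EuclideanSpace ℝ (Fin n)} {L : ℝ}
    (hL : Filter.Tendsto (fun h : ℝ => (inducedOpNorm N (1 + h • A) - 1) / h)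
      (nhdsWithin 0 (Set.Ioi 0)) (nhds L)) : LogNormLE N A L := by
  obtain ⟨c, hc, C, hC, hcC⟩ := hN.exists_bounds
  have le_op : ∀ (B : EuclideanSpace ℝ (Fin n) →L[ℝ] EuclideanSpace ℝ (Fin n)) v,
      N (B v) ≤ inducedOpNorm N B * N v := by
    intro B v
    rcases eq_or_ne v 0 with rfl | hv
    · simp [hN.zero]
    have hpos : 0 < N v := (hN.nonneg v).lt_of_ne' fun h => hv ((hN.eq_zero v).1 h)
    have hbdd : BddAbove ((fun v => N (B v)) '' {v | N v = 1}) := by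
      refine ⟨C * (‖B‖ * (1 / c)), ?_⟩
      rintro _ ⟨u, hu, rfl⟩
      have h1 : ‖u‖ ≤ 1 / c := by
        rw [le_div_iff₀ hc, mul_comm]
        exact (hcC u).1.trans_eq hu
      refine (hcC _).2.trans ?_
      gcongr
      exact (B.le_opNorm u).trans (by gcongr)
    have h1 : N (B ((N v)⁻¹ • v)) ≤ inducedOpNorm N B := by
      refine le_csSup hbdd ⟨_, ?_, rfl⟩
      change N ((N v)⁻¹ • v) = 1
      rw [hN.smul, abs_of_pos (inv_pos.2 hpos), inv_mul_cancel₀ hpos.ne']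
    rw [map_smul, hN.smul, abs_of_pos (inv_pos.2 hpos), inv_mul_le_iff₀ hpos] at h1
    linarith
  intro l hl v hv
  refine ge_of_tendsto (hL.mul_const (N v)) ?_
  filter_upwards [self_mem_nhdsWithin] with h hh
  have hh' : 0 < h := hh
  have h1 := (hl _).trans (le_op (1 + h • A) v)
  have h2 : l ((1 + h • A) v) = N v + h * l (A v) := by simp [hv]
  rw [h2] at h1
  rw [div_mul_eq_mul_div, le_div_iff₀ hh']
  linarith

/-- Theorem (IES for systems contracting outside a compact set).
Let `g : ℝⁿ → ℝⁿ` be `C¹` and suppose `ẋ = g(x)` has a unique globally asymptotically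
stable equilibrium `x*` (Lyapunov stable, and every solution converges to `x*`). Let `‖·‖`
be a norm on `ℝⁿ` with induced logarithmic norm `μ`, let `K` be compact with `x* ∉ K`, and
suppose `μ(∇g(x)) ≤ -ν < 0` for all `x ∉ K`. Then the system is incrementally exponentially
stable on `ℝⁿ` with rate `ν`: there is `c > 0` such that any two solutions satisfy
`‖x(t) - y(t)‖ ≤ c e^{-νt} ‖x(0) - y(0)‖` for all `t ≥ 0`. -/
theorem ies_contracting_outside_compact {n : ℕ}
    (g : EuclideanSpace ℝ (Fin n) → EuclideanSpace ℝ (Fin n))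
    (hg : ContDiff ℝ 1 g)
    (xstar : EuclideanSpace ℝ (Fin n)) (heq : g xstar = 0)
    (huniq : ∀ x, g x = 0 → x = xstar)
    (N : EuclideanSpace ℝ (Fin n) → ℝ)
    (hN_def : ∀ x, N x = 0 ↔ x = 0)
    (hN_smul : ∀ (c : ℝ) (x : EuclideanSpace ℝ (Fin n)), N (c • x) = |c| * N x)
    (hN_add : ∀ x y, N (x + y) ≤ N x + N y)
    (hstable : ∀ δ > (0:ℝ), ∃ η > (0:ℝ), ∀ x : ℝ → EuclideanSpace ℝ (Fin n),
      (∀ t, 0 ≤ t → HasDerivAt x (g (x t)) t) →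
      N (x 0 - xstar) < η → ∀ t, 0 ≤ t → N (x t - xstar) < δ)
    (hattract : ∀ x : ℝ → EuclideanSpace ℝ (Fin n),
      (∀ t, 0 ≤ t → HasDerivAt x (g (x t)) t) →
      Filter.Tendsto x Filter.atTop (nhds xstar))
    (K : Set (EuclideanSpace ℝ (Fin n)))
    (hK : IsCompact K) (hxK : xstar ∉ K)
    (ν : ℝ) (hν : 0 < ν)
    (h_contr : ∀ x ∉ K,
      ∃ L, L ≤ -ν ∧
        Filter.Tendsto
          (fun h : ℝ => (inducedOpNorm N (1 + h • fderiv ℝ g x) - 1) / h)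
          (nhdsWithin 0 (Set.Ioi 0)) (nhds L)) :
    ∃ c > (0:ℝ), ∀ x y : ℝ → EuclideanSpace ℝ (Fin n),
      (∀ t, 0 ≤ t → HasDerivAt x (g (x t)) t) →
      (∀ t, 0 ≤ t → HasDerivAt y (g (y t)) t) →
      ∀ t, 0 ≤ t →
        N (x t - y t) ≤ c * Real.exp (-ν * t) * N (x 0 - y 0) := by
  have hN : IsVecNorm N := ⟨hN_def, hN_smul, hN_add⟩
  have hcontr : ∀ z ∉ K, LogNormLE N (fderiv ℝ g z) (-ν) := fun z hz => by
    obtain ⟨L, hL, hlim⟩ := h_contr z hz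
    exact (hN.logNormLE_of_tendsto hlim).mono hN hL
  obtain ⟨M, hM, hKM⟩ := hN.exists_logNormLE_of_isCompact hg hK
  have hgM : ∀ x y, OneSidedLE N M (x - y) (g x - g y) := fun x y =>
    oneSidedLE_of_segment (hg.differentiable one_ne_zero) fun z _ => by
      by_cases hz : z ∈ K
      · exact hKM z hz
      · exact (hcontr z hz).mono hN (by linarith)
  obtain ⟨ε, hε, hεK⟩ := hK.exists_cthickening_subset_open isOpen_compl_singleton
    (Set.subset_compl_singleton_iff.2 hxK)
  obtain ⟨T, hT, hleave⟩ := hN.exists_uniform_leaving_time hg hM hgM heq hstable hattract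
    hK.cthickening (Set.subset_compl_singleton_iff.1 hεK)
  refine ⟨Real.exp ((M + ν) * T), Real.exp_pos _, fun x y hx hy t ht => ?_⟩
  exact hN.sol_sub_le_of_forall_close hg hM hgM heq hε ht
    (fun x y hx hy hclose => hN.sol_sub_le_of_close (hg.differentiable one_ne_zero) hM hgM hν
      hcontr hT hleave hx hy ht hclose) hx hy
end

section
/- Define f : ℝ → ℝ by f(x) = x·log(x + √(1 + x²)) − √(1 + x²) + 1. Then f satisfies the generalized Łojasiewicz inequality |f'(x)| ≥ (1/2)·log(1 + f(x)) for all x ∈ ℝ, i.e., f satisfies a 𝒦∞-PLI with comparison function α(s) = (1/2)·log(1 + s). -/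
open Real in
/-- `x ↦ x * arsinh x - √(1 + x ^ 2)` is an antiderivative of `arsinh`. -/
theorem hasDerivAt_mul_arsinh_sub_sqrt (x : ℝ) :
    HasDerivAt (fun y : ℝ => y * arsinh y - √(1 + y ^ 2)) (arsinh x) x := by
  have hpos : 0 < 1 + x ^ 2 := by positivity
  have hs : 0 < √(1 + x ^ 2) := Real.sqrt_pos.2 hpos
  have h := ((hasDerivAt_id x).mul (hasDerivAt_arsinh x)).sub
    ((((hasDerivAt_id x).pow 2).const_add 1).sqrt hpos.ne')
  refine h.congr_deriv ?_
  simp only [id, Pi.pow_apply]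
  field_simp
  push_cast
  ring

open Real in
theorem cosh_le_one_add_mul_sinh {t : ℝ} (ht : 0 ≤ t) : cosh t ≤ 1 + t * sinh t := by
  have h1 : 1 - exp (-t) ≤ t := by linarith [add_one_le_exp (-t)]
  have h2 : (1 - exp (-t)) * sinh t ≤ t * sinh t :=
    mul_le_mul_of_nonneg_right h1 (sinh_nonneg_iff.2 ht)
  have h3 : exp t * exp (-t) = 1 := by rw [← exp_add]; simp
  rw [sinh_eq] at h2 ⊢
  rw [cosh_eq]
  nlinarith [sq_nonneg (1 - exp (-t))]

open Real in
theorem two_add_mul_sinh_sub_cosh_le_exp {t : ℝ} (ht : 0 ≤ t) :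
    2 + t * sinh t - cosh t ≤ exp (2 * t) := by
  have h1 : t ≤ exp t - 1 := by linarith [add_one_le_exp t]
  have h2 : sinh t ≤ exp t / 2 := by rw [sinh_eq]; linarith [exp_pos (-t)]
  have h3 : t * sinh t ≤ (exp t - 1) * (exp t / 2) :=
    mul_le_mul h1 h2 (sinh_nonneg_iff.2 ht) (ht.trans h1)
  rw [two_mul, exp_add]
  nlinarith [one_le_cosh t, one_le_exp ht]

open Real in
theorem log_two_add_mul_sinh_sub_cosh_le (t : ℝ) :
    log (2 + t * sinh t - cosh t) ≤ 2 * |t| := by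
  wlog ht : 0 ≤ t generalizing t
  · simpa using this (-t) (by linarith)
  rw [abs_of_nonneg ht, log_le_iff_le_exp (by linarith [cosh_le_one_add_mul_sinh ht])]
  exact two_add_mul_sinh_sub_cosh_le_exp ht


/-- The function `f(x) = x log(x + √(1+x²)) - √(1+x²) + 1` satisfies the generalized
Łojasiewicz inequality `|f'(x)| ≥ ½ log(1 + f(x))` for all `x ∈ ℝ`, i.e. a `𝒦∞`-PLI with
comparison function `α(s) = ½ log(1 + s)` (note `f* = f(0) = 0`). -/
theorem example_function_K_infty_PLI
    (f : ℝ → ℝ)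
    (hf : ∀ x, f x = x * Real.log (x + Real.sqrt (1 + x ^ 2))
      - Real.sqrt (1 + x ^ 2) + 1) :
    ∀ x : ℝ, (1 / 2) * Real.log (1 + f x) ≤ |deriv f x| := by
  intro x
  have hf' : f = fun y => y * Real.arsinh y - √(1 + y ^ 2) + 1 := funext hf
  have hd : deriv f x = Real.arsinh x := by
    rw [hf']
    exact ((hasDerivAt_mul_arsinh_sub_sqrt x).add_const 1).deriv
  have h := log_two_add_mul_sinh_sub_cosh_le (Real.arsinh x)
  rw [Real.sinh_arsinh, Real.cosh_arsinh] at h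
  have he : 1 + f x = 2 + Real.arsinh x * x - √(1 + x ^ 2) := by
    rw [hf']
    ring
  rw [hd, he]
  linarith
end
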